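/- (a) For each fixed N ≥ 2K+1 there exists a constant A > 0, depending only on N, B_0 and the polynomials G_{i,r}, such that for all squarefree moduli q satisfying IFH(G_{1,r},…,G_{K,r}; B_0) for every r ∈ {1,…,L} and all coprime residues (w_1,…,w_K) ∈ U_q^K: #Ṽ_{N,K}(q;(w_i)) / φ(q)^N ≤ φ(q)^{−K} · exp(A·√(log 3q)). (b) For each fixed N ≥ 1 there exists a constant A' > 0, depending only on N, B_0 and the polynomials G_{i,r}, such that for all squarefree moduli q and all coprime residues (w_1,…,w_K) ∈ U_q^K: #Ṽ_{N,K}(q;(w_i)) / φ(q)^N ≤ q^{−min{K, N/2}} · e^{A'·ω(q)}, where ω(q) is the number of distinct prime factors of q. -/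

import Mathlib

open Polynomial
open scoped Classical

noncomputable section

/-- `f : ℕ → ℤ` is a multiplicative arithmetic function. -/
def IsMultFn (f : ℕ → ℤ) : Prop :=
  f 1 = 1 ∧ ∀ m n : ℕ, Nat.Coprime m n → f (m * n) = f m * f n

/-- The polynomials `F i` are multiplicatively independent over `ℤ`:
no nonzero integer tuple `c` makes `∏ i, (F i) ^ (c i)` identically constant in `ℚ(T)`. -/
def MultIndep {m : ℕ} (F : Fin m → Polynomial ℤ) : Prop :=
  ¬ ∃ c : Fin m → ℤ, c ≠ 0 ∧ ∃ r : ℚ,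
      (∏ i, (algebraMap (Polynomial ℚ) (RatFunc ℚ) ((F i).map (Int.castRingHom ℚ))) ^ (c i))
        = algebraMap ℚ (RatFunc ℚ) r

/-- `β` is the last invariant factor of the exponent matrix of the family `F`
(for some factorization of the `F i` into pairwise non-associated primitive irreducibles,
via a Smith normal form of the exponent matrix). -/
def IsLastInvFactor {m : ℕ} (F : Fin m → Polynomial ℤ) (β : ℤ) : Prop :=
  ∃ (M : ℕ) (G : Fin M → Polynomial ℤ) (c : Fin m → ℤ) (μ : Fin M → Fin m → ℕ),
    (∀ j, Irreducible (G j)) ∧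
    (∀ j, (G j).IsPrimitive) ∧
    (∀ j j', j ≠ j' → ¬ Associated (G j) (G j')) ∧
    (∀ i, F i = Polynomial.C (c i) * ∏ j, G j ^ μ j i) ∧
    (∀ j, ∃ i, 0 < μ j i) ∧
    ∃ (P : Matrix (Fin M) (Fin M) ℤ) (Q : Matrix (Fin m) (Fin m) ℤ),
      IsUnit P.det ∧ IsUnit Q.det ∧
      (∀ (s : Fin M) (t : Fin m), (s : ℕ) ≠ (t : ℕ) →
        (P * (Matrix.of fun u v => (μ u v : ℤ)) * Q) s t = 0) ∧
      (∀ (s s' : Fin M) (t t' : Fin m), (s : ℕ) = (t : ℕ) → (s' : ℕ) = (t' : ℕ) →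
        (s : ℕ) + 1 = (s' : ℕ) →
        (P * (Matrix.of fun u v => (μ u v : ℤ)) * Q) s t ∣
          (P * (Matrix.of fun u v => (μ u v : ℤ)) * Q) s' t') ∧
      (∀ (s : Fin M) (t : Fin m), (s : ℕ) = (t : ℕ) → (s : ℕ) + 1 = min M m →
        β = (P * (Matrix.of fun u v => (μ u v : ℤ)) * Q) s t)

/-- Invariant Factor Hypothesis `IFH(F; B₀)` for the modulus `q`. -/
def IFH {m : ℕ} (F : Fin m → Polynomial ℤ) (B₀ : ℝ) (q : ℕ) : Prop :=
  ∀ β : ℤ, IsLastInvFactor F β →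
    ∀ ℓ : ℕ, ℓ.Prime → ℓ ∣ q → B₀ < (ℓ : ℝ) → Int.gcd ((ℓ : ℤ) - 1) β = 1

/-- `alphaRatio q P`: the proportion of units `u` mod `q` with `P(u)` a unit mod `q`. -/
def alphaRatio (q : ℕ) (P : Polynomial ℤ) : ℝ :=
  (Nat.card {u : (ZMod q)ˣ // IsUnit (Polynomial.aeval ((u : ZMod q)) P)} : ℝ)
    / (Nat.totient q : ℝ)

/-- `q` is `k`-admissible with respect to the family of products `Wprod v`. -/
def KAdmissible (Wprod : ℕ → Polynomial ℤ) (k q : ℕ) : Prop :=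
  (∃ u : (ZMod q)ˣ, IsUnit (Polynomial.aeval ((u : ZMod q)) (Wprod k))) ∧
  ∀ v, 1 ≤ v → v < k → ¬ ∃ u : (ZMod q)ˣ, IsUnit (Polynomial.aeval ((u : ZMod q)) (Wprod v))

/-- Narkiewicz's set `Q(k; f_1, …, f_K)`. -/
def NarkSet {K : ℕ} (k : ℕ) (f : Fin K → ℕ → ℤ) (W : Fin K → ℕ → Polynomial ℤ) : Set ℕ :=
  {q | KAdmissible (fun v => ∏ i, W i v) k q ∧
    ∀ χ : Fin K → DirichletCharacter ℂ q, χ ≠ (fun _ => 1) →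
      (∀ u : (ZMod q)ˣ, IsUnit (Polynomial.aeval ((u : ZMod q)) (∏ i, W i k)) →
          (∏ i, (χ i) (Polynomial.aeval ((u : ZMod q)) (W i k))) = 1) →
      ∃ p : ℕ, p.Prime ∧
        (∑' j : ℕ, (∏ i, (χ i) ((f i (p ^ j) : ZMod q))) *
            ((((p : ℝ) ^ (-(j : ℝ) / (k : ℝ))) : ℝ) : ℂ)) = 0}

/-- `Pj j n`: the `j`-th largest prime factor of `n` counted with multiplicity,
equal to `1` if `Ω(n) < j`. -/
def Pj (j n : ℕ) : ℕ := (n.primeFactorsList.reverse).getD (j - 1) 1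

/-- `nPart k n` is `n_k`, the largest positive integer whose `k`-th power is a
unitary divisor of `n`. -/
def nPart (k n : ℕ) : ℕ :=
  ∏ p ∈ n.primeFactors, if k ∣ n.factorization p then p ^ (n.factorization p / k) else 1

/-- A polynomial is squarefull in `ℤ[T]` iff every complex root has multiplicity at least 2. -/
def SquarefullPoly (F : Polynomial ℤ) : Prop :=
  ∀ z : ℂ, (F.map (Int.castRingHom ℂ)).IsRoot z →
    2 ≤ (F.map (Int.castRingHom ℂ)).rootMultiplicity z

/-- `n` is convenient (with respect to exponent `k`, threshold `y` and length `J`). -/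
def Convenient (k : ℕ) (y : ℝ) (J : ℕ) (n : ℕ) : Prop :=
  ∃ (m : ℕ) (P : Fin J → ℕ), 0 < m ∧ (∀ t, (P t).Prime) ∧
    (∀ s t : Fin J, s < t → P t < P s) ∧
    (∀ t, y < (P t : ℝ) ∧ Pj 1 m < P t) ∧
    n = m * (∏ t, P t) ^ k

/-- The solution count `Ṽ_{N,K}(q; (w_i))`. -/
def VNK {K N : ℕ} (F : Fin K → Fin N → Polynomial ℤ) (q : ℕ) (w : Fin K → ZMod q) : ℕ :=
  Nat.card {v : Fin N → (ZMod q)ˣ //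
    ∀ i, (∏ j, Polynomial.aeval ((v j : ZMod q)) (F i j)) = w i}

/-- `α*_N(q) = ∏_j α̃_j(q)`. -/
def alphaStarN {K N : ℕ} (F : Fin K → Fin N → Polynomial ℤ) (q : ℕ) : ℝ :=
  ∏ j, alphaRatio q (∏ i, F i j)

/-- `n` is `r`-full: every prime dividing `n` divides it to the `r`-th power. -/
def IsRFull (r n : ℕ) : Prop := ∀ p : ℕ, p.Prime → p ∣ n → p ^ r ∣ n

/-- The `k`-free part of `n`. -/
def kfreePart (k n : ℕ) : ℕ :=
  ∏ p ∈ n.primeFactors, if n.factorization p < k then p ^ n.factorization p else 1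

theorem X_pow_sub_C_irreducible_of_primitiveRoot {K : Type*} [Field K] {d : ℕ} (hd : 0 < d)
    {ζ : K} (hζ : IsPrimitiveRoot ζ d) {t : K} (ht0 : t ≠ 0)
    (ht : ∀ m, m ∣ d → m ≠ 1 → ∀ s : K, s ^ m ≠ t) : Irreducible (X ^ d - C t : K[X]) := by
  have : NeZero d := ⟨hd.ne'⟩
  obtain ⟨θ, hθ⟩ := IsAlgClosed.exists_pow_nat_eq (algebraMap K (AlgebraicClosure K) t) hd
  have hθ0 : θ ≠ 0 := by
    rintro rfl
    rw [zero_pow hd.ne'] at hθ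
    exact ht0 ((map_eq_zero _).1 hθ.symm)
  have hmon : (X ^ d - C t : K[X]).Monic := monic_X_pow_sub_C t hd.ne'
  have hroot : aeval θ (X ^ d - C t : K[X]) = 0 := by simp [hθ]
  have hint : IsIntegral K θ := ⟨_, hmon, hroot⟩
  have hdvd := minpoly.dvd K θ hroot
  set k := (minpoly K θ).natDegree with hk
  have hkpos : 0 < k := minpoly.natDegree_pos hint
  have key : ∃ s : K, algebraMap K _ s = θ ^ k := by
    have hζ' : IsPrimitiveRoot (algebraMap K (AlgebraicClosure K) ζ) d :=
      hζ.map_of_injective (algebraMap K _).injective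
    have hr : ∀ r ∈ (minpoly K θ).aroots (AlgebraicClosure K),
        ∃ i : ℕ, r = algebraMap K _ (ζ ^ i) * θ := by
      intro r hr
      have h1 : aeval r (X ^ d - C t : K[X]) = 0 := by
        obtain ⟨g, hg⟩ := hdvd
        rw [hg, map_mul, (mem_aroots.1 hr).2, zero_mul]
      have h2 : (r / θ) ^ d = 1 := by
        rw [div_pow, hθ]
        simp only [map_sub, map_pow, aeval_X, aeval_C, sub_eq_zero] at h1
        rw [h1, div_self]
        simpa using ht0
      obtain ⟨i, -, hi⟩ := hζ'.eq_pow_of_pow_eq_one h2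
      exact ⟨i, by rw [map_pow, hi]; field_simp⟩
    have gen : ∀ S : Multiset (AlgebraicClosure K),
        (∀ r ∈ S, ∃ i : ℕ, r = algebraMap K _ (ζ ^ i) * θ) →
        ∃ i : ℕ, S.prod = algebraMap K _ (ζ ^ i) * θ ^ (Multiset.card S) := by
      intro S
      induction S using Multiset.induction with
      | empty => intro _; exact ⟨0, by simp⟩
      | cons a S ih =>
        intro h
        obtain ⟨i, hi⟩ := ih fun r hr => h r (Multiset.mem_cons_of_mem hr)
        obtain ⟨j, hj⟩ := h a (Multiset.mem_cons_self a S)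
        refine ⟨j + i, ?_⟩
        rw [Multiset.prod_cons, hi, hj, Multiset.card_cons, pow_add, pow_succ, map_mul]
        ring
    obtain ⟨i, hi⟩ := gen _ hr
    have hsplit : ((minpoly K θ).map (algebraMap K (AlgebraicClosure K))).Splits :=
      IsAlgClosed.splits _
    have hc := hsplit.coeff_zero_eq_prod_roots_of_monic ((minpoly.monic hint).map _)
    have hcard : Multiset.card ((minpoly K θ).aroots (AlgebraicClosure K)) = k := by
      rw [aroots, ← hsplit.natDegree_eq_card_roots, natDegree_map]
    rw [hcard] at hi
    rw [natDegree_map, coeff_map, ← aroots, hi, ← hk] at hc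
    have hζ0 : ζ ≠ 0 := hζ.ne_zero hd.ne'
    refine ⟨(-1) ^ k * (ζ ^ i)⁻¹ * (minpoly K θ).coeff 0, ?_⟩
    have hz : algebraMap K (AlgebraicClosure K) ζ ≠ 0 := by simpa using hζ0
    have h1 : ((-1 : AlgebraicClosure K) ^ k) * (-1) ^ k = 1 := by
      rw [← mul_pow]; simp
    simp only [map_mul, map_pow, map_neg, map_one, map_inv₀, hc]
    field_simp
    linear_combination h1
  obtain ⟨s, hs⟩ := key
  have hg : ∃ s' : K, algebraMap K _ s' = θ ^ (Nat.gcd k d) := by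
    have h1 : θ ^ (Nat.gcd k d) = (θ ^ k) ^ (Nat.gcdA k d) * (θ ^ d) ^ (Nat.gcdB k d) := by
      rw [← zpow_natCast, Nat.gcd_eq_gcd_ab, zpow_add₀ hθ0, zpow_mul, zpow_mul]
      simp
    refine ⟨s ^ (Nat.gcdA k d) * t ^ (Nat.gcdB k d), ?_⟩
    rw [h1, hθ, ← hs, map_mul, map_zpow₀, map_zpow₀]
  obtain ⟨s', hs'⟩ := hg
  have hgpos : 0 < Nat.gcd k d := Nat.gcd_pos_of_pos_left _ hkpos
  have hle : k ≤ Nat.gcd k d := by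
    have h1 : aeval θ (X ^ (Nat.gcd k d) - C s' : K[X]) = 0 := by simp [hs']
    have h2 := natDegree_le_of_dvd (minpoly.dvd K θ h1) (monic_X_pow_sub_C s' hgpos.ne').ne_zero
    rwa [natDegree_X_pow_sub_C] at h2
  have hkd : k ∣ d := by
    have : Nat.gcd k d = k := le_antisymm (Nat.gcd_le_left _ hkpos) hle
    rw [← this]; exact Nat.gcd_dvd_right _ _
  obtain ⟨e, he⟩ := hkd
  have he1 : e = 1 := by
    by_contra hne
    refine ht e ⟨k, by rw [he, mul_comm]⟩ hne s ?_
    apply (algebraMap K (AlgebraicClosure K)).injective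
    rw [map_pow, hs, ← pow_mul, ← he, hθ]
  have hkd : k = d := by rw [he, he1, mul_one]
  have : minpoly K θ = X ^ d - C t := by
    refine (eq_of_monic_of_dvd_of_natDegree_le (minpoly.monic hint) hmon hdvd ?_).symm
    rw [natDegree_X_pow_sub_C, ← hk, hkd]
  rw [← this]
  exact minpoly.irreducible hint

/-- The twisted circulant matrix attached to `h`, with twist `gy / gx`. -/
def twistedCirculant {R : Type*} [CommRing R] {d : ℕ} [NeZero d] (gx gy : R) (h : Fin d → R) :
    Matrix (Fin d) (Fin d) R :=
  Matrix.of fun i j => (if i ≤ j then gx else gy) * h (j - i)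

theorem twistedCirculant_sum_mul_pow {R S : Type*} [CommRing R] [CommRing S] {d : ℕ} [NeZero d]
    (ψ : R →+* S) {gx gy : R} (h : Fin d → R) {θ : S} (hθ : ψ gx * θ ^ d = ψ gy) (i : Fin d) :
    ∑ j, ψ (twistedCirculant gx gy h i j) * θ ^ (j : ℕ) =
      ψ gx * θ ^ (i : ℕ) * ∑ b, ψ (h b) * θ ^ (b : ℕ) := by
  rw [Finset.mul_sum, ← (Equiv.subRight i).sum_comp (fun b => ψ gx * θ ^ (i : ℕ) * (ψ (h b) * θ ^ (b : ℕ)))]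
  refine Finset.sum_congr rfl fun j _ => ?_
  simp only [twistedCirculant, Matrix.of_apply, Equiv.subRight_apply, map_mul]
  split_ifs with hij
  · rw [Fin.sub_val_of_le hij]
    have : θ ^ (j : ℕ) = θ ^ (i : ℕ) * θ ^ ((j : ℕ) - i) := by
      rw [← pow_add, Nat.add_sub_cancel' hij]
    rw [this]; ring
  · have h1 : ((j - i : Fin d) : ℕ) = d + j - i := Fin.coe_sub_iff_lt.mpr (not_le.mp hij)
    have h2 : θ ^ (i : ℕ) * θ ^ ((j - i : Fin d) : ℕ) = θ ^ d * θ ^ (j : ℕ) := by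
      rw [h1, ← pow_add, ← pow_add]
      congr 1
      have := i.isLt
      omega
    rw [← hθ]
    linear_combination (-(ψ gx * ψ (h (j - i)))) * h2

theorem natDegree_det_le_of_forall_le {R : Type*} [CommRing R] {d : ℕ}
    (M : Matrix (Fin d) (Fin d) R[X]) (B : ℕ) (hB : ∀ i j, (M i j).natDegree ≤ B) :
    M.det.natDegree ≤ d * B := by
  rw [Matrix.det_apply]
  refine natDegree_sum_le_of_forall_le _ _ fun σ _ => ?_
  refine (natDegree_smul_le _ _).trans ((natDegree_prod_le _ _).trans ?_)
  refine (Finset.sum_le_card_nsmul _ _ B fun i _ => hB _ _).trans ?_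
  simp

/-- Substituting `X ^ Q` for the inner variable and `X` for the outer one. -/
def expandEval (𝕂 : Type*) [Field 𝕂] (Q : ℕ) : 𝕂[X][X] →+* 𝕂[X] :=
  eval₂RingHom (expand 𝕂 Q : 𝕂[X] →+* 𝕂[X]) X

theorem expandEval_coeff {𝕂 : Type*} [Field 𝕂] {Q : ℕ} (hQ : 0 < Q) (P : 𝕂[X][X])
    (hP : P.natDegree < Q) {i : ℕ} (hi : i < Q) (k : ℕ) :
    (expandEval 𝕂 Q P).coeff (i + Q * k) = (P.coeff i).coeff k := by
  simp only [expandEval, coe_eval₂RingHom, eval₂_eq_sum_range, finsetSum_coeff]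
  rw [Finset.sum_eq_single i]
  · rw [coeff_mul_X_pow', if_pos (by omega)]
    simp only [RingHom.coe_coe, coeff_expand hQ]
    rw [if_pos ⟨k, by omega⟩]
    congr 1
    rw [Nat.add_sub_cancel_left, Nat.mul_div_cancel_left _ hQ]
  · intro j hj hji
    rw [Finset.mem_range] at hj
    rw [coeff_mul_X_pow']
    split_ifs with hle
    · simp only [RingHom.coe_coe, coeff_expand hQ]
      rw [if_neg]
      rintro ⟨u, hu⟩
      have h1 : i + Q * k = j + Q * u := by omega
      have h2 := congrArg (· % Q) h1
      simp only [Nat.add_mul_mod_self_left] at h2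
      rw [Nat.mod_eq_of_lt hi, Nat.mod_eq_of_lt (by omega)] at h2
      exact hji h2.symm
    · rfl
  · intro hi'
    have : P.natDegree < i := by simpa using hi'
    simp [coeff_eq_zero_of_natDegree_lt this]

theorem expandEval_eq_zero {𝕂 : Type*} [Field 𝕂] {Q : ℕ} (hQ : 0 < Q) {P : 𝕂[X][X]}
    (hP : P.natDegree < Q) (h : expandEval 𝕂 Q P = 0) : P = 0 := by
  ext i k
  by_cases hi : i < Q
  · rw [← expandEval_coeff hQ P hP hi k, h]; simp
  · rw [coeff_eq_zero_of_natDegree_lt (hP.trans_le (not_lt.mp hi))]; simp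

theorem rootMultiplicity_pow' {R : Type*} [CommRing R] [IsDomain R] {p : R[X]} (hp : p ≠ 0) (x : R)
    (n : ℕ) : (p ^ n).rootMultiplicity x = n * p.rootMultiplicity x := by
  induction n with
  | zero => simp
  | succ n ih =>
    rw [pow_succ, rootMultiplicity_mul (mul_ne_zero (pow_ne_zero _ hp) hp), ih]; ring

theorem not_pow_eq_ratio {𝕂 : Type*} [Field 𝕂] {g : 𝕂[X]} (hg : g ≠ 0) {m : ℕ} {α : 𝕂}
    (hα : ¬ m ∣ g.rootMultiplicity α) (s : FractionRing 𝕂[X][X]) :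
    s ^ m * algebraMap 𝕂[X][X] _ (g.map C) ≠ algebraMap 𝕂[X][X] _ (C g) := by
  intro hs
  obtain ⟨u, v, hv, rfl⟩ := IsFractionRing.div_surjective (A := 𝕂[X][X]) s
  have hv0 : v ≠ 0 := nonZeroDivisors.ne_zero hv
  have hvm : algebraMap 𝕂[X][X] (FractionRing 𝕂[X][X]) v ≠ 0 := by
    simpa using hv0
  rw [div_pow, div_mul_eq_mul_div, div_eq_iff (pow_ne_zero _ hvm)] at hs
  have hs' : u ^ m * g.map C = C g * v ^ m := by
    apply IsFractionRing.injective 𝕂[X][X] (FractionRing 𝕂[X][X])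
    simpa using hs
  have hgm : g.map (C : 𝕂 →+* 𝕂[X]) ≠ 0 := (Polynomial.map_ne_zero_iff C_injective).mpr hg
  have hCg : (C g : 𝕂[X][X]) ≠ 0 := by simpa using hg
  have hu0 : u ^ m ≠ 0 := by
    intro h0
    rw [h0, zero_mul] at hs'
    exact mul_ne_zero hCg (pow_ne_zero _ hv0) hs'.symm
  have h1 := congrArg (rootMultiplicity (C α)) hs'
  rw [rootMultiplicity_mul (mul_ne_zero hu0 hgm),
    rootMultiplicity_mul (mul_ne_zero hCg (pow_ne_zero _ hv0)), rootMultiplicity_C, zero_add,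
    ← eq_rootMultiplicity_map C_injective, rootMultiplicity_pow' hv0] at h1
  rcases Nat.eq_zero_or_pos m with rfl | hm
  · have h2 : rootMultiplicity (C α) (1 : 𝕂[X][X]) = 0 := by rw [← C_1, rootMultiplicity_C]
    rw [pow_zero, h2, zero_mul, zero_add] at h1
    exact hα (by rw [h1])
  · rw [rootMultiplicity_pow' (by rintro rfl; simp [hm.ne'] at hu0)] at h1
    exact hα ((Nat.dvd_add_right (dvd_mul_right m _)).mp (h1 ▸ dvd_mul_right m _))

theorem stepanov_independence {𝕂 : Type*} [Field 𝕂] {d Q c : ℕ} [NeZero d] {g : 𝕂[X]} (hg : g ≠ 0)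
    (hgQ : g ^ Q = expand 𝕂 Q g) (hdc : d * c + 1 = Q) {ζ : 𝕂} (hζ : IsPrimitiveRoot ζ d)
    (hmult : ∀ m, m ∣ d → m ≠ 1 → ∃ α, ¬ m ∣ g.rootMultiplicity α) {A : ℕ} (h : Fin d → 𝕂[X][X])
    (hA : ∀ b, (h b).natDegree ≤ A) (hQ : d * (A + g.natDegree) < Q)
    (hsum : ∑ b, expandEval 𝕂 Q (h b) * g ^ (c * (b : ℕ)) = 0) : ∀ b, h b = 0 := by
  have hQ0 : 0 < Q := by omega
  set gx : 𝕂[X][X] := g.map C with hgx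
  set gy : 𝕂[X][X] := C g with hgy
  have hgx0 : gx ≠ 0 := (Polynomial.map_ne_zero_iff C_injective).mpr hg
  have hΦx : expandEval 𝕂 Q gx = g := by
    simp [expandEval, hgx, eval₂_eq_sum_range]
    conv_rhs => rw [g.as_sum_range_C_mul_X_pow]
  have hΦy : expandEval 𝕂 Q gy = expand 𝕂 Q g := by simp [expandEval, hgy]
  have hdet : (twistedCirculant gx gy h).det = 0 := by
    apply expandEval_eq_zero hQ0
    · refine lt_of_le_of_lt (natDegree_det_le_of_forall_le _ (A + g.natDegree) fun i j => ?_) hQ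
      simp only [twistedCirculant, Matrix.of_apply]
      refine natDegree_mul_le.trans ?_
      have := hA (j - i)
      split_ifs
      · rw [hgx, natDegree_map_eq_of_injective C_injective]; omega
      · rw [hgy, natDegree_C]; omega
    · rw [RingHom.map_det]
      apply Matrix.exists_mulVec_eq_zero_iff.mp
      refine ⟨fun j => (g ^ c) ^ (j : ℕ), ?_, ?_⟩
      · intro h0
        have := congrFun h0 0
        exact pow_ne_zero _ (pow_ne_zero _ hg) this
      · ext1 i
        have h1 := twistedCirculant_sum_mul_pow (expandEval 𝕂 Q) (gx := gx) (gy := gy) h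
          (θ := g ^ c) (by
            rw [hΦx, hΦy, ← hgQ, ← hdc, ← pow_mul, pow_succ, mul_comm c d, mul_comm]) i
        simp only [← pow_mul] at h1
        rw [hsum, mul_zero] at h1
        simpa [Matrix.mulVec, dotProduct, ← pow_mul] using h1
  obtain ⟨v, hv0, hv⟩ := Matrix.exists_vecMul_eq_zero_iff.mpr hdet
  let K₀ := FractionRing 𝕂[X][X]
  let ι : 𝕂[X][X] →+* K₀ := algebraMap _ _
  have hι : Function.Injective ι := IsFractionRing.injective _ _
  have hgxι : ι gx ≠ 0 := by
    rw [Ne, ← map_zero ι]; exact fun h0 => hgx0 (hι h0)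
  have hgyι : ι gy ≠ 0 := by
    rw [Ne, ← map_zero ι]; exact fun h0 => hg (C_injective (by simpa [hgy] using hι h0))
  let t : K₀ := ι gy / ι gx
  have ht0 : t ≠ 0 := div_ne_zero hgyι hgxι
  have hd : 0 < d := Nat.pos_of_ne_zero (NeZero.ne d)
  have hζ' : IsPrimitiveRoot (((ι.comp C).comp C) ζ) d :=
    hζ.map_of_injective (hι.comp (C_injective.comp C_injective))
  have hirr : Irreducible (X ^ d - C t : K₀[X]) := by
    refine X_pow_sub_C_irreducible_of_primitiveRoot hd hζ' ht0 fun m hm hm1 s hs => ?_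
    obtain ⟨α, hα⟩ := hmult m hm hm1
    refine not_pow_eq_ratio hg hα s ?_
    rw [hs]
    exact div_mul_cancel₀ _ hgxι
  have : Fact (Irreducible (X ^ d - C t : K₀[X])) := ⟨hirr⟩
  let P : K₀[X] := X ^ d - C t
  let E := AdjoinRoot P
  let θ : E := AdjoinRoot.root P
  let ψ : 𝕂[X][X] →+* E := (AdjoinRoot.of P).comp ι
  have hψ : Function.Injective ψ := (AdjoinRoot.of P).injective.comp hι
  have hθ : ψ gx * θ ^ d = ψ gy := by
    have h1 : θ ^ d = AdjoinRoot.of P t := by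
      have := AdjoinRoot.eval₂_root P
      simp only [P, eval₂_sub, eval₂_X_pow, eval₂_C, sub_eq_zero] at this
      exact this
    rw [h1]
    simp only [ψ, RingHom.comp_apply, ← map_mul, t]
    rw [mul_div_cancel₀ _ hgxι]
  have hbasis : ∀ u : Fin d → 𝕂[X][X], ∑ b, ψ (u b) * θ ^ (b : ℕ) = 0 → u = 0 := by
    intro u hu
    have h1 : AdjoinRoot.mk P (∑ b : Fin d, C (ι (u b)) * X ^ (b : ℕ)) = 0 := by
      rw [← hu]
      simp only [map_sum, map_mul, map_pow, AdjoinRoot.mk_X, AdjoinRoot.mk_C]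
      rfl
    rw [AdjoinRoot.mk_eq_zero] at h1
    have h2 : (∑ b : Fin d, C (ι (u b)) * X ^ (b : ℕ) : K₀[X]) = 0 := by
      by_contra h0
      have h3 := degree_le_of_dvd h1 h0
      rw [degree_X_pow_sub_C hd] at h3
      refine absurd h3 (not_le.mpr ?_)
      refine lt_of_le_of_lt (degree_sum_le _ _) ?_
      rw [Finset.sup_lt_iff (WithBot.bot_lt_coe _)]
      intro b _
      exact lt_of_le_of_lt (degree_C_mul_X_pow_le _ _) (by exact_mod_cast b.isLt)
    ext1 b
    apply hι
    have h3 := congrArg (fun p => coeff p (b : ℕ)) h2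
    simp only [finsetSum_coeff, coeff_C_mul_X_pow, coeff_zero] at h3
    rw [Finset.sum_eq_single b] at h3
    · simpa using h3
    · intro j _ hj
      rw [if_neg]
      intro h; exact hj (Fin.ext h.symm)
    · simp
  have hprod : (∑ i, ψ (v i) * θ ^ (i : ℕ)) * (ψ gx * ∑ b, ψ (h b) * θ ^ (b : ℕ)) = 0 := by
    calc _ = ∑ i, ψ (v i) * (ψ gx * θ ^ (i : ℕ) * ∑ b, ψ (h b) * θ ^ (b : ℕ)) := by
          rw [Finset.sum_mul]; exact Finset.sum_congr rfl fun i _ => by ring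
      _ = ∑ i, ψ (v i) * ∑ j, ψ (twistedCirculant gx gy h i j) * θ ^ (j : ℕ) := by
          simp only [twistedCirculant_sum_mul_pow ψ h hθ]
      _ = ∑ j, ψ ((Matrix.vecMul v (twistedCirculant gx gy h)) j) * θ ^ (j : ℕ) := by
          have h1 : ∀ j, ψ ((Matrix.vecMul v (twistedCirculant gx gy h)) j) * θ ^ (j : ℕ) =
              ∑ i, ψ (v i) * (ψ (twistedCirculant gx gy h i j) * θ ^ (j : ℕ)) := fun j => by
            rw [Matrix.vecMul, dotProduct, map_sum, Finset.sum_mul]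
            exact Finset.sum_congr rfl fun i _ => by rw [map_mul, mul_assoc]
          rw [Finset.sum_congr rfl fun j _ => h1 j, Finset.sum_comm]
          exact Finset.sum_congr rfl fun i _ => Finset.mul_sum _ _ _
      _ = 0 := by rw [hv]; simp
  rcases mul_eq_zero.mp hprod with h1 | h1
  · exact absurd (hbasis v h1) hv0
  · rcases mul_eq_zero.mp h1 with h2 | h2
    · exact absurd (hψ (h2.trans (map_zero ψ).symm)) hgx0
    · exact congrFun (hbasis h h2)

theorem dvd_choose_mul_of_lt_prime_pow {p n k u : ℕ} (hp : p.Prime) (hk0 : 0 < k)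
    (hk : k < p ^ n) : p ∣ (p ^ n * u).choose k := by
  rcases Nat.eq_zero_or_pos u with rfl | hu
  · rw [mul_zero, Nat.choose_eq_zero_of_lt hk0]; exact dvd_zero _
  obtain ⟨k, rfl⟩ := Nat.exists_eq_succ_of_ne_zero hk0.ne'
  obtain ⟨N, hN⟩ := Nat.exists_eq_succ_of_ne_zero
    (Nat.mul_pos (pow_pos hp.pos n) hu).ne'
  have h1 : (p ^ n * u) * N.choose k = (p ^ n * u).choose (k + 1) * (k + 1) := by
    rw [hN]; exact Nat.add_one_mul_choose_eq N k
  by_contra hnd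
  have h2 : (p ^ n).Coprime ((p ^ n * u).choose (k + 1)) :=
    Nat.Coprime.pow_left _ ((Nat.Prime.coprime_iff_not_dvd hp).mpr hnd)
  have h3 : p ^ n ∣ k + 1 := by
    refine h2.dvd_of_dvd_mul_left (h1 ▸ ?_)
    rw [mul_assoc]; exact dvd_mul_right _ _
  exact absurd (Nat.le_of_dvd (Nat.succ_pos k) h3) (not_le.mpr hk)

theorem hasseDeriv_expand_eq_zero {𝕂 : Type*} [Field 𝕂] {p n k : ℕ} (hp : p.Prime) [CharP 𝕂 p]
    (hk0 : 0 < k) (hk : k < p ^ n) (f : 𝕂[X]) : hasseDeriv k (expand 𝕂 (p ^ n) f) = 0 := by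
  ext i
  rw [hasseDeriv_coeff, coeff_expand (pow_pos hp.pos n)]
  split_ifs with h
  · obtain ⟨u, hu⟩ := h
    rw [hu, (CharP.cast_eq_zero_iff 𝕂 p _).mpr (dvd_choose_mul_of_lt_prime_pow hp hk0 hk)]
    simp
  · simp

theorem hasseDeriv_mul_expand {𝕂 : Type*} [Field 𝕂] {p n k : ℕ} (hp : p.Prime) [CharP 𝕂 p]
    (hk : k < p ^ n) (f h : 𝕂[X]) :
    hasseDeriv k (h * expand 𝕂 (p ^ n) f) = hasseDeriv k h * expand 𝕂 (p ^ n) f := by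
  rw [hasseDeriv_mul, Finset.sum_eq_single (k, 0)]
  · simp
  · rintro ⟨i, j⟩ hij hne
    rw [Finset.HasAntidiagonal.mem_antidiagonal] at hij
    simp only at hij
    rw [hasseDeriv_expand_eq_zero hp _ (by omega), mul_zero]
    rcases Nat.eq_zero_or_pos j with rfl | hj
    · exact absurd (by simp [← hij]) hne
    · exact hj
  · simp

theorem pow_sub_dvd_hasseDeriv_pow {R : Type*} [CommRing R] (g : R[X]) (n : ℕ) :
    ∀ l, g ^ (n - l) ∣ hasseDeriv l (g ^ n) := by
  induction n with
  | zero => simp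
  | succ n ih =>
    intro l
    rw [pow_succ, hasseDeriv_mul]
    refine Finset.dvd_sum ?_
    rintro ⟨i, j⟩ hij
    rw [Finset.HasAntidiagonal.mem_antidiagonal] at hij
    simp only at hij ⊢
    rcases Nat.eq_zero_or_pos j with rfl | hj
    · obtain rfl : i = l := by simpa using hij
      rw [hasseDeriv_zero]
      refine (pow_dvd_pow g (show n + 1 - i ≤ n - i + 1 by omega)).trans ?_
      rw [pow_succ]
      exact mul_dvd_mul (ih i) dvd_rfl
    · exact ((pow_dvd_pow g (by omega)).trans (ih i)).mul_right _

theorem exists_hasseDeriv_mul_pow {𝕂 : Type*} [Field 𝕂] {g : 𝕂[X]} (hg : g ≠ 0) {n k : ℕ}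
    (hk : k ≤ n) : ∃ D : 𝕂[X] →ₗ[𝕂] 𝕂[X],
      (∀ r, hasseDeriv k (r * g ^ n) = g ^ (n - k) * D r) ∧
      ∀ r, (D r).natDegree ≤ r.natDegree + k * g.natDegree := by
  choose u hu using pow_sub_dvd_hasseDeriv_pow g n
  let D : 𝕂[X] →ₗ[𝕂] 𝕂[X] := ∑ ij ∈ Finset.HasAntidiagonal.antidiagonal k,
    (LinearMap.mulRight 𝕂 (g ^ ij.1 * u ij.2)).comp (hasseDeriv ij.1)
  have hD : ∀ r, hasseDeriv k (r * g ^ n) = g ^ (n - k) * D r := by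
    intro r
    rw [hasseDeriv_mul, LinearMap.sum_apply, Finset.mul_sum]
    refine Finset.sum_congr rfl ?_
    rintro ⟨i, j⟩ hij
    rw [Finset.HasAntidiagonal.mem_antidiagonal] at hij
    simp only at hij
    simp only [LinearMap.comp_apply, LinearMap.mulRight_apply, hu j]
    have : n - j = n - k + i := by omega
    rw [this, pow_add]; ring
  refine ⟨D, hD, fun r => ?_⟩
  by_cases h0 : D r = 0
  · rw [h0]; simp
  have h1 := natDegree_hasseDeriv_le (r * g ^ n) k
  rw [hD, natDegree_mul (pow_ne_zero _ hg) h0, natDegree_pow] at h1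
  have h2 : (r * g ^ n).natDegree ≤ r.natDegree + n * g.natDegree :=
    natDegree_mul_le.trans (by rw [natDegree_pow])
  have h3 : n * g.natDegree = (n - k) * g.natDegree + k * g.natDegree := by
    rw [← add_mul, Nat.sub_add_cancel hk]
  omega

theorem card_mul_le_natDegree_of_hasseDeriv {𝕂 : Type*} [Field 𝕂] {R : 𝕂[X]} (hR : R ≠ 0)
    (Z : Finset 𝕂) (M : ℕ) (h : ∀ x ∈ Z, ∀ k < M, (hasseDeriv k R).eval x = 0) :
    Z.card * M ≤ R.natDegree := by
  have h1 : ∏ x ∈ Z, (X - C x) ^ M ∣ R := by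
    refine Finset.prod_dvd_of_coprime ?_ fun x hx => ?_
    · intro x _ y _ hxy
      exact (isCoprime_X_sub_C_of_isUnit_sub (sub_ne_zero.mpr hxy).isUnit).pow
    · rw [X_sub_C_pow_dvd_iff, X_pow_dvd_iff]
      intro k hk
      have := h x hx k hk
      rwa [← taylor_coeff] at this
  have h2 := natDegree_le_of_dvd h1 hR
  rwa [natDegree_prod_of_monic _ _ fun x _ => (monic_X_sub_C x).pow M, Finset.sum_congr rfl
    fun x _ => by rw [natDegree_pow, natDegree_X_sub_C, mul_one], Finset.sum_const,
    smul_eq_mul] at h2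

theorem expandEval_map_C {𝕂 : Type*} [Field 𝕂] (Q : ℕ) (f : 𝕂[X]) :
    expandEval 𝕂 Q (f.map C) = f := by
  simp only [expandEval, coe_eval₂RingHom, eval₂_map]
  conv_rhs => rw [← eval₂_C_X (p := f)]
  congr 1
  ext; simp

theorem expandEval_C {𝕂 : Type*} [Field 𝕂] (Q : ℕ) (f : 𝕂[X]) :
    expandEval 𝕂 Q (C f) = expand 𝕂 Q f := by
  simp [expandEval]

theorem stepanov_aux {𝕂 : Type*} [Field 𝕂] {p n : ℕ} (hp : p.Prime) [CharP 𝕂 p] {d c : ℕ}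
    [NeZero d] {g : 𝕂[X]} (hg : g ≠ 0) (hgQ : g ^ (p ^ n) = expand 𝕂 (p ^ n) g)
    (hdc : d * c + 1 = p ^ n) {ζ : 𝕂} (hζ : IsPrimitiveRoot ζ d)
    (hmult : ∀ m, m ∣ d → m ≠ 1 → ∃ α, ¬ m ∣ g.rootMultiplicity α) {A J M : ℕ}
    (hA : d * (A + g.natDegree) < p ^ n) (hMQ : M ≤ p ^ n)
    (hcount : M * (A + M * g.natDegree + J) < J * d * A) (a : 𝕂) (Z : Finset 𝕂)
    (hZ : ∀ x ∈ Z, x ^ (p ^ n) = x ∧ g.eval x ^ c = a) :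
    Z.card * M ≤ M * g.natDegree + A + p ^ n * g.natDegree + J * p ^ n := by
  set Q := p ^ n with hQdef
  set e := g.natDegree with he
  have hd : 0 < d := Nat.pos_of_ne_zero (NeZero.ne d)
  have hex : ∀ (k : Fin M) (b : Fin d), ∃ D : 𝕂[X] →ₗ[𝕂] 𝕂[X],
      (∀ r, hasseDeriv k (r * g ^ (M + c * b)) = g ^ (M + c * b - k) * D r) ∧
      ∀ r, (D r).natDegree ≤ r.natDegree + k * e := fun k b =>
    exists_hasseDeriv_mul_pow hg (by have := k.isLt; omega)
  choose D hD hDdeg using hex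
  let V := Fin J × Fin d → degreeLT 𝕂 A
  let B := A + M * e + J
  let T : Fin M → V →ₗ[𝕂] 𝕂[X] := fun k => ∑ jb : Fin J × Fin d,
    (LinearMap.mulRight 𝕂 (C (a ^ (jb.2 : ℕ)) * X ^ (jb.1 : ℕ))).comp
      ((D k jb.2).comp ((degreeLT 𝕂 A).subtype.comp (LinearMap.proj jb)))
  have hTa : ∀ k (r : V), T k r = ∑ jb : Fin J × Fin d,
      D k jb.2 (r jb) * (C (a ^ (jb.2 : ℕ)) * X ^ (jb.1 : ℕ)) := by
    intro k r
    simp only [T, LinearMap.sum_apply]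
    rfl
  let φ : V →ₗ[𝕂] (Fin M × Fin B → 𝕂) := LinearMap.pi fun ks => (lcoeff 𝕂 ks.2).comp (T ks.1)
  have hker : LinearMap.ker φ ≠ ⊥ := by
    apply LinearMap.ker_ne_bot_of_finrank_lt
    have h1 : Module.finrank 𝕂 V = J * d * A := by
      rw [Module.finrank_pi_fintype]
      simp [(degreeLTEquiv 𝕂 A).finrank_eq]
    rw [h1]
    simpa [Module.finrank_fintype_fun_eq_card, B] using hcount
  obtain ⟨r, hr, hr0⟩ := (Submodule.ne_bot_iff _).mp hker
  have hrdeg : ∀ jb, (r jb : 𝕂[X]).natDegree ≤ A := fun jb =>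
    natDegree_le_of_degree_le (mem_degreeLT.mp (r jb).2).le
  have hApos : 0 < A := by
    rcases Nat.eq_zero_or_pos A with h | h
    · rw [h, mul_zero] at hcount; omega
    · exact h
  have hrdeg' : ∀ jb, (r jb : 𝕂[X]).natDegree < A := fun jb => by
    by_cases h0 : (r jb : 𝕂[X]) = 0
    · rw [h0]; simpa using hApos
    · exact (natDegree_lt_iff_degree_lt h0).mpr (mem_degreeLT.mp (r jb).2)
  have hT : ∀ k, T k r = 0 := by
    intro k
    have hdeg : (T k r).natDegree < B := by
      rw [hTa]
      refine lt_of_le_of_lt (natDegree_sum_le_of_forall_le (n := B - 1) _ _ fun jb _ => ?_) ?_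
      · refine natDegree_mul_le.trans ?_
        have h1 := hDdeg k jb.2 (r jb)
        have h2 := hrdeg' jb
        have h3 : (C (a ^ (jb.2 : ℕ)) * X ^ (jb.1 : ℕ) : 𝕂[X]).natDegree ≤ jb.1 :=
          natDegree_C_mul_X_pow_le _ _
        have h4 := jb.1.isLt
        have h5 : (k : ℕ) * e ≤ M * e := Nat.mul_le_mul_right _ k.isLt.le
        omega
      · omega
    ext s
    by_cases hs : s < B
    · exact congrFun (LinearMap.mem_ker.mp hr) (k, ⟨s, hs⟩)
    · rw [coeff_eq_zero_of_natDegree_lt (by omega), coeff_zero]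
  let h : Fin d → 𝕂[X][X] := fun b => ∑ j : Fin J, (r (j, b) : 𝕂[X]).map C * C (X ^ (j : ℕ))
  have hh : ∀ b, expandEval 𝕂 Q (h b) = ∑ j : Fin J, (r (j, b) : 𝕂[X]) * expand 𝕂 Q (X ^ (j : ℕ)) := by
    intro b
    simp only [h, map_sum, map_mul]
    refine Finset.sum_congr rfl fun j _ => ?_
    rw [expandEval_map_C, expandEval_C]
  let R := g ^ M * ∑ b, expandEval 𝕂 Q (h b) * g ^ (c * (b : ℕ))
  have hR0 : R ≠ 0 := by
    refine mul_ne_zero (pow_ne_zero _ hg) fun hs => hr0 ?_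
    have hz := stepanov_independence hg hgQ hdc hζ hmult h (A := A) (fun b => ?_) hA hs
    · funext jb
      apply Subtype.ext
      ext i
      have h1 := congrArg (fun P => (coeff P i).coeff (jb.1 : ℕ)) (hz jb.2)
      simp only [h, finsetSum_coeff, coeff_mul_C, coeff_map, coeff_C_mul, coeff_X_pow, coeff_zero] at h1
      rw [Finset.sum_eq_single jb.1] at h1
      · rw [if_pos rfl, mul_one] at h1
        exact h1
      · intro j _ hj
        rw [if_neg (fun h => hj (Fin.ext h.symm)), mul_zero]
      · simp
    · refine natDegree_sum_le_of_forall_le _ _ fun j _ => natDegree_mul_le.trans ?_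
      rw [natDegree_C, add_zero]
      exact natDegree_map_le.trans (hrdeg _)
  have hRsum : R = ∑ jb : Fin J × Fin d, (r jb : 𝕂[X]) * g ^ (M + c * (jb.2 : ℕ)) *
      expand 𝕂 Q (X ^ (jb.1 : ℕ)) := by
    simp only [R, hh, Fintype.sum_prod_type, Finset.mul_sum, Finset.sum_mul]
    rw [Finset.sum_comm]
    refine Finset.sum_congr rfl fun j _ => Finset.sum_congr rfl fun b _ => ?_
    rw [pow_add]; ring
  have hbound := card_mul_le_natDegree_of_hasseDeriv hR0 Z M fun x hx k hk => by
    obtain ⟨hxQ, hxa⟩ := hZ x hx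
    have hxQ' : x ^ (p ^ n) = x := hxQ
    have hTx := congrArg (eval x) (hT ⟨k, hk⟩)
    rw [hTa, eval_finsetSum, eval_zero] at hTx
    have : (hasseDeriv k R).eval x = g.eval x ^ (M - k) * ∑ jb : Fin J × Fin d,
        (D ⟨k, hk⟩ jb.2 (r jb) * (C (a ^ (jb.2 : ℕ)) * X ^ (jb.1 : ℕ))).eval x := by
      rw [hRsum, map_sum, eval_finsetSum, Finset.mul_sum]
      refine Finset.sum_congr rfl fun jb _ => ?_
      rw [hasseDeriv_mul_expand hp (lt_of_lt_of_le hk hMQ), hD ⟨k, hk⟩]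
      simp only [eval_mul, eval_pow, eval_C, eval_X, expand_eval, hxQ', ← hxa]
      have : M + c * (jb.2 : ℕ) - k = (M - k) + c * jb.2 := by omega
      rw [this, pow_add, pow_mul]; ring
    rw [this, hTx, mul_zero]
  refine hbound.trans ?_
  rw [hRsum]
  refine natDegree_sum_le_of_forall_le _ _ fun jb _ => ?_
  refine natDegree_mul_le.trans ?_
  have h1 : ((r jb : 𝕂[X]) * g ^ (M + c * (jb.2 : ℕ))).natDegree ≤ A + (M + c * jb.2) * e :=
    natDegree_mul_le.trans (add_le_add (hrdeg jb) (natDegree_pow_le))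
  have h2 : (expand 𝕂 Q (X ^ (jb.1 : ℕ))).natDegree ≤ J * Q := by
    rw [natDegree_expand, natDegree_X_pow]
    exact Nat.mul_le_mul_right _ jb.1.isLt.le
  have h3 : c * (jb.2 : ℕ) ≤ Q := by
    have := Nat.mul_le_mul_left c jb.2.isLt.le
    rw [mul_comm c d] at this
    omega
  have h4 : (M + c * jb.2) * e ≤ M * e + Q * e := by
    rw [add_mul]; exact Nat.add_le_add_left (Nat.mul_le_mul_right _ h3) _
  omega

theorem card_le_of_forall_pow_eq {𝕂 : Type*} [Field 𝕂] {Q : ℕ} (hQ : 1 < Q) (Z : Finset 𝕂)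
    (hZ : ∀ x ∈ Z, x ^ Q = x) : Z.card ≤ Q := by
  have h1 : (X ^ Q - X : 𝕂[X]) ≠ 0 := FiniteField.X_pow_card_sub_X_ne_zero 𝕂 hQ
  refine (card_le_degree_of_subset_roots (p := X ^ Q - X) (Z := Z) fun x hx => ?_).trans
    (FiniteField.X_pow_card_sub_X_natDegree_eq 𝕂 hQ).le
  rw [mem_roots h1]
  simp [hZ x hx]

theorem stepanov_count_arith {d e m A C₁ : ℕ} (hd : 0 < d) (hC₁ : C₁ = 4 * d * (d * e + 1))
    (hm : 4 * d + 2 * (d * e) + 2 ≤ m) (hA2 : m * m < 2 * d * A + 2 * d) :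
    d * m * (A + d * m * e + (m + C₁)) < (m + C₁) * d * A := by
  have hC0 : 0 < C₁ := by rw [hC₁]; positivity
  have h1 : m * (d * m * e + m + C₁) < C₁ * A := by
    have h2 : 4 * d * m + 4 * d ≤ m * m := by
      have : (4 * d + 2) * m ≤ m * m := Nat.mul_le_mul_right _ (by omega)
      have h' : 4 * d ≤ 2 * m := by omega
      linarith [add_mul (4 * d) 2 m]
    have h3 : 2 * d * (m * (d * m * e + m + C₁)) < 2 * d * (C₁ * A) := by
      have h4 : C₁ * (4 * d * m + 4 * d) ≤ C₁ * (m * m) := Nat.mul_le_mul_left _ h2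
      have h5 : C₁ * (m * m) < C₁ * (2 * d * A + 2 * d) := Nat.mul_lt_mul_of_pos_left hA2 hC0
      have h6 : 4 * d * (m * (d * m * e + m)) = C₁ * (m * m) := by rw [hC₁]; ring
      linarith
    exact Nat.lt_of_mul_lt_mul_left h3
  have h2 : m * (A + d * m * e + (m + C₁)) < (m + C₁) * A := by linarith
  calc d * m * (A + d * m * e + (m + C₁)) = d * (m * (A + d * m * e + (m + C₁))) := by ring
    _ < d * ((m + C₁) * A) := Nat.mul_lt_mul_of_pos_left h2 hd
    _ = _ := by ring

theorem stepanov_final_arith {d e m A C₁ z Q : ℕ} (hd : 0 < d) (hm2 : Q ≤ m * m + 2 * m)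
    (hm0 : 0 < m) (hA1 : 2 * d * A ≤ m * m)
    (key : z * (d * m) ≤ d * m * e + A + Q * e + (m + C₁) * Q) :
    z * d ≤ Q + (d * e + 1 + 3 * (e + C₁)) * m := by
  refine Nat.le_of_mul_le_mul_right ?_ hm0
  have h2 : (e + C₁) * Q ≤ (e + C₁) * (m * m + 2 * m) := Nat.mul_le_mul_left _ hm2
  have h3 : (e + C₁) * m ≤ (e + C₁) * (m * m) := Nat.mul_le_mul_left _ (Nat.le_mul_self m)
  have h4 : d * e * m ≤ d * e * (m * m) := Nat.mul_le_mul_left _ (Nat.le_mul_self m)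
  have h5 : 2 * A ≤ 2 * d * A := Nat.mul_le_mul_right _ (by omega)
  linarith

theorem stepanov_bound {𝕂 : Type*} [Field 𝕂] {p : ℕ} (hp : p.Prime) [CharP 𝕂 p] {d : ℕ}
    [NeZero d] {g : 𝕂[X]} (hg : g ≠ 0) (hgQ : ∀ n, g ^ (p ^ n) = expand 𝕂 (p ^ n) g)
    {ζ : 𝕂} (hζ : IsPrimitiveRoot ζ d)
    (hmult : ∀ m, m ∣ d → m ≠ 1 → ∃ α, ¬ m ∣ g.rootMultiplicity α) :
    ∃ C : ℕ, ∀ n c, 0 < n → d * c + 1 = p ^ n → ∀ (a : 𝕂) (Z : Finset 𝕂),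
      (∀ x ∈ Z, x ^ (p ^ n) = x ∧ g.eval x ^ c = a) →
      Z.card * d ≤ p ^ n + C * Nat.sqrt (p ^ n) := by
  have hd : 0 < d := Nat.pos_of_ne_zero (NeZero.ne d)
  obtain ⟨e, he⟩ : ∃ e, e = g.natDegree := ⟨_, rfl⟩
  obtain ⟨C₁, hC₁⟩ : ∃ C₁, C₁ = 4 * d * (d * e + 1) := ⟨_, rfl⟩
  obtain ⟨m₀, hm₀⟩ : ∃ m₀, m₀ = 4 * d + 2 * (d * e) + 2 := ⟨_, rfl⟩
  refine ⟨d * e + 1 + 3 * (e + C₁) + (m₀ + 2) * d, fun n c hn hdc a Z hZ => ?_⟩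
  obtain ⟨Q, hQ⟩ : ∃ Q, Q = p ^ n := ⟨_, rfl⟩
  have hQ1 : 1 < Q := hQ ▸ Nat.one_lt_pow hn.ne' hp.one_lt
  obtain ⟨m, hm⟩ : ∃ m, m = Nat.sqrt Q := ⟨_, rfl⟩
  have hm1 : m * m ≤ Q := by rw [hm]; exact Nat.sqrt_le _
  have hm2 : Q ≤ m * m + 2 * m := by
    have := Nat.sqrt_le_add Q
    rw [← hm] at this
    omega
  rw [← hQ, ← hm, add_mul]
  by_cases hmm : m < m₀
  · have hZc : Z.card ≤ Q := card_le_of_forall_pow_eq hQ1 Z fun x hx => hQ ▸ (hZ x hx).1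
    have h1 : Q ≤ (m₀ + 2) * m := by
      have := Nat.mul_le_mul_right m hmm.le
      rw [add_mul]; omega
    have : Z.card * d ≤ (m₀ + 2) * m * d := Nat.mul_le_mul_right _ (hZc.trans h1)
    have h2 : (m₀ + 2) * m * d = (m₀ + 2) * d * m := by ring
    omega
  · push Not at hmm
    obtain ⟨A, hA⟩ : ∃ A, A = m * m / (2 * d) := ⟨_, rfl⟩
    have hA1 : 2 * d * A ≤ m * m := by rw [hA]; exact Nat.mul_div_le _ _
    have hA2 : m * m < 2 * d * A + 2 * d := by
      rw [hA]; exact Nat.lt_mul_div_succ _ (by omega)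
    have hmm' : m ≤ m * m := Nat.le_mul_self m
    have key := stepanov_aux hp hg (hgQ n) hdc hζ hmult (A := A) (J := m + C₁) (M := d * m)
      (by
        rw [← he, ← hQ, mul_add]
        rw [mul_assoc] at hA1
        omega)
      (by
        rw [← hQ]
        exact (Nat.mul_le_mul_right m (show d ≤ m by omega)).trans hm1)
      (by rw [← he]; exact stepanov_count_arith hd hC₁ (hm₀ ▸ hmm) hA2) a Z hZ
    rw [← he, ← hQ] at key
    have := stepanov_final_arith hd hm2 (by omega) hA1 key
    omega

theorem abs_sub_le_of_forall_le_of_sum_ge {ι : Type*} (T : Finset ι) (N : ι → ℝ) {d : ℕ}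
    (hT : T.card ≤ d) {Q B e : ℝ} (hQ : 0 ≤ Q) (hB : 0 ≤ B) (he : 0 ≤ e)
    (hN : ∀ b ∈ T, N b * d ≤ Q + B) (hsum : Q - e ≤ ∑ b ∈ T, N b) {b : ι} (hb : b ∈ T) :
    |N b - Q / d| ≤ e + B := by
  have hd0 : 0 < d := lt_of_lt_of_le (Finset.card_pos.mpr ⟨b, hb⟩) hT
  have hd : (0 : ℝ) < d := by exact_mod_cast hd0
  have hd1 : (1 : ℝ) ≤ d := by exact_mod_cast hd0
  have h1 : ∀ b ∈ T, N b ≤ (Q + B) / d := fun b hb => by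
    rw [le_div_iff₀ hd]; exact hN b hb
  have hBd : B / d ≤ B := div_le_self hB hd1
  rw [abs_le]
  constructor
  · rw [← Finset.add_sum_erase T N hb] at hsum
    have h2 : ∑ b ∈ T.erase b, N b ≤ ∑ _b ∈ T.erase b, (Q + B) / d :=
      Finset.sum_le_sum fun x hx => h1 x (Finset.mem_of_mem_erase hx)
    rw [Finset.sum_const, Finset.card_erase_of_mem hb, nsmul_eq_mul] at h2
    have h3 : ((T.card - 1 : ℕ) : ℝ) * ((Q + B) / d) ≤ (d - 1) * ((Q + B) / d) := by
      refine mul_le_mul_of_nonneg_right ?_ (by positivity)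
      have : ((T.card - 1 : ℕ) : ℝ) + 1 ≤ d := by
        exact_mod_cast (by have := Finset.card_pos.mpr ⟨b, hb⟩; omega : T.card - 1 + 1 ≤ d)
      linarith
    have h4 : (d - 1 : ℝ) * ((Q + B) / d) = Q + B - Q / d - B / d := by
      field_simp
      ring
    have h5 : 0 ≤ B / d := by positivity
    linarith
  · have := h1 b hb
    rw [add_div] at this
    linarith

theorem card_pow_eq_one_le {F : Type*} [Field F] [Fintype F] {d : ℕ} (hd : 0 < d) :
    (Finset.univ.filter fun b : F => b ^ d = 1).card ≤ d := by
  have h : (Finset.univ.filter fun b : F => b ^ d = 1) ⊆ (nthRoots d (1 : F)).toFinset := by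
    intro b hb
    simpa [mem_nthRoots hd] using hb
  exact (Finset.card_le_card h).trans ((Multiset.toFinset_card_le _).trans (card_nthRoots d 1))

theorem sum_mulChar_pow_eq_one {F : Type*} [Field F] [Fintype F] {d k : ℕ}
    (hdk : d * k = Fintype.card F - 1) {ψ : MulChar F ℂ} (hψ : ψ ^ k ≠ 1) :
    ∑ b ∈ Finset.univ.filter (fun b : F => b ^ d = 1), ψ b = 0 := by
  obtain ⟨z, hz⟩ := MulChar.ne_one_iff.mp hψ
  set b₀ : F := (z : F) ^ k with hb₀
  have hb0 : b₀ ≠ 0 := pow_ne_zero _ z.ne_zero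
  have hb₀d : b₀ ^ d = 1 := by
    rw [hb₀, ← pow_mul, mul_comm, hdk]
    exact FiniteField.pow_card_sub_one_eq_one _ z.ne_zero
  have hψb : ψ b₀ ≠ 1 := by
    rwa [hb₀, map_pow, ← MulChar.pow_apply_coe]
  set S := ∑ b ∈ Finset.univ.filter (fun b : F => b ^ d = 1), ψ b with hS
  have h : ψ b₀ * S = S := by
    rw [hS, Finset.mul_sum]
    refine Finset.sum_bij' (fun b _ => b₀ * b) (fun b _ => b₀⁻¹ * b) ?_ ?_ ?_ ?_ ?_
    · intro b hb
      simp only [Finset.mem_filter, Finset.mem_univ, true_and] at hb ⊢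
      rw [mul_pow, hb₀d, hb, one_mul]
    · intro b hb
      simp only [Finset.mem_filter, Finset.mem_univ, true_and] at hb ⊢
      rw [mul_pow, inv_pow, hb₀d, hb, inv_one, one_mul]
    · intro b _; exact inv_mul_cancel_left₀ hb0 b
    · intro b _; exact mul_inv_cancel_left₀ hb0 b
    · intro b _; rw [map_mul]
  have h2 : (ψ b₀ - 1) * S = 0 := by rw [sub_mul, h, one_mul, sub_self]
  rcases mul_eq_zero.mp h2 with h3 | h3
  · exact absurd (sub_eq_zero.mp h3) hψb
  · exact h3

theorem charSum_extension_bound {p : ℕ} [Fact p.Prime] {d k : ℕ} (hdk : d * k = p - 1)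
    {ψ : MulChar (ZMod p) ℂ} (hψ : ψ ^ k ≠ 1) {g : (ZMod p)[X]} (hg : g ≠ 0)
    (hmult : ∀ m, m ∣ d → m ≠ 1 → ∃ α : AlgebraicClosure (ZMod p),
      ¬ m ∣ (g.map (algebraMap (ZMod p) (AlgebraicClosure (ZMod p)))).rootMultiplicity α) :
    ∃ C : ℝ, ∀ n, 0 < n → ∀ (E : Type) [Field E] [Fintype E] [Algebra (ZMod p) E],
      Fintype.card E = p ^ n →
      ‖∑ x : E, (ψ ^ k) (Algebra.norm (ZMod p) (aeval x g))‖ ≤ C * Real.sqrt ((p : ℝ) ^ n) := by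
  have hp : p.Prime := Fact.out
  have hp1 : 0 < p - 1 := by have := hp.two_le; omega
  have hd : 0 < d := Nat.pos_of_ne_zero (by rintro rfl; rw [zero_mul] at hdk; omega)
  have hk : 0 < k := Nat.pos_of_ne_zero (by rintro rfl; rw [mul_zero] at hdk; omega)
  have : NeZero d := ⟨hd.ne'⟩
  let 𝕂 := AlgebraicClosure (ZMod p)
  have hdK : ((d : ℕ) : ZMod p) ≠ 0 := by
    rw [Ne, CharP.cast_eq_zero_iff (ZMod p) p]
    intro h
    have h1 := Nat.le_of_dvd hd h
    have h2 := Nat.le_mul_of_pos_right d hk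
    omega
  have : NeZero ((d : ℕ) : ZMod p) := ⟨hdK⟩
  have : NeZero ((d : ℕ) : 𝕂) := NeZero.of_injective (algebraMap (ZMod p) 𝕂).injective
  obtain ⟨ζ, hζ⟩ := HasEnoughRootsOfUnity.exists_primitiveRoot 𝕂 d
  let gK : 𝕂[X] := g.map (algebraMap (ZMod p) 𝕂)
  have hgK : gK ≠ 0 := (Polynomial.map_ne_zero_iff (algebraMap (ZMod p) 𝕂).injective).mpr hg
  have hexp : ∀ n, g ^ (p ^ n) = expand (ZMod p) (p ^ n) g := by
    intro n
    induction n with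
    | zero => simp
    | succ n ih => rw [pow_succ, pow_mul, ih, mul_comm, expand_mul, ZMod.expand_card]
  have hgQ : ∀ n, gK ^ (p ^ n) = expand 𝕂 (p ^ n) gK := by
    intro n
    rw [← Polynomial.map_pow, hexp, map_expand]
  obtain ⟨C, hC⟩ := stepanov_bound hp hgK hgQ hζ hmult
  refine ⟨d * (g.natDegree + C), fun n hn E _ _ _ hE => ?_⟩
  have hQR : (1 : ℝ) ≤ Real.sqrt ((p : ℝ) ^ n) := by
    rw [Real.one_le_sqrt]
    exact one_le_pow₀ (by exact_mod_cast hp.one_lt.le)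
  let T := Finset.univ.filter (fun b : ZMod p => b ^ d = 1)
  have hTcard : T.card ≤ d := by convert card_pow_eq_one_le (F := ZMod p) hd
  let fib : ZMod p → Finset E := fun b =>
    Finset.univ.filter fun x => Algebra.norm (ZMod p) (aeval x g) ^ k = b
  have hdvd : p - 1 ∣ p ^ n - 1 := by simpa using Nat.sub_dvd_pow_sub_pow p 1 n
  obtain ⟨c', hc'⟩ := hdvd
  have hpn : 0 < p ^ n := pow_pos hp.pos n
  let σ : E →ₐ[ZMod p] 𝕂 := IsAlgClosed.lift
  have hup : ∀ b ∈ T, ((fib b).card : ℝ) * d ≤ (p : ℝ) ^ n + C * Real.sqrt ((p : ℝ) ^ n) := by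
    intro b _
    have h1 := hC n (k * c') hn (by
      rw [← mul_assoc, hdk, ← hc']; omega) (algebraMap (ZMod p) 𝕂 b) ((fib b).map ⟨σ, σ.injective⟩) (by
      intro y hy
      obtain ⟨x, hx, rfl⟩ := Finset.mem_map.mp hy
      simp only [fib, Finset.mem_filter, Finset.mem_univ, true_and] at hx
      constructor
      · show σ x ^ _ = σ x
        rw [← map_pow, ← hE, FiniteField.pow_card]
      · show eval (σ x) gK ^ _ = _
        rw [← hx, eval_map, ← aeval_def, aeval_algHom_apply, map_pow, ← σ.commutes,
          FiniteField.algebraMap_norm_eq_pow, Nat.card_eq_fintype_card, hE, Nat.card_eq_fintype_card,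
          ZMod.card, hc', Nat.mul_div_cancel_left _ hp1, map_pow, ← pow_mul, mul_comm c'])
    rw [Finset.card_map] at h1
    have h2 : ((fib b).card : ℝ) * d ≤ (p : ℝ) ^ n + C * (Nat.sqrt (p ^ n) : ℝ) := by
      exact_mod_cast h1
    refine h2.trans ?_
    gcongr
    have := Real.nat_sqrt_le_real_sqrt (a := p ^ n)
    simpa using this
  have hzero : ((fib 0).card : ℝ) ≤ g.natDegree := by
    have hgE : g.map (algebraMap (ZMod p) E) ≠ 0 :=
      (Polynomial.map_ne_zero_iff (algebraMap (ZMod p) E).injective).mpr hg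
    have : (fib 0).card ≤ (g.map (algebraMap (ZMod p) E)).natDegree := by
      refine card_le_degree_of_subset_roots fun x hx => ?_
      simp only [fib, Finset.mem_val, Finset.mem_filter, Finset.mem_univ, true_and,
        pow_eq_zero_iff hk.ne', Algebra.norm_eq_zero_iff] at hx
      rw [mem_roots hgE, IsRoot, eval_map, ← aeval_def, hx]
    rw [natDegree_map] at this
    exact_mod_cast this
  have hfib : ∀ b, b ∉ T → b ≠ 0 → fib b = ∅ := by
    intro b hb hb0
    rw [Finset.eq_empty_iff_forall_notMem]
    intro x hx
    simp only [fib, T, Finset.mem_filter, Finset.mem_univ, true_and] at hx hb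
    apply hb
    have : Algebra.norm (ZMod p) (aeval x g) ≠ 0 := by
      intro h0; rw [h0, zero_pow hk.ne'] at hx; exact hb0 hx.symm
    rw [← hx, ← pow_mul, mul_comm, hdk]
    exact ZMod.pow_card_sub_one_eq_one this
  have h0T : (0 : ZMod p) ∉ T := by simp [T, hd.ne']
  have hsplit : ∀ f : ZMod p → ℂ, ∑ b, f b * ((fib b).card : ℂ) =
      f 0 * ((fib 0).card : ℂ) + ∑ b ∈ T, f b * ((fib b).card : ℂ) := by
    intro f
    rw [← Finset.sum_insert (f := fun b => f b * ((fib b).card : ℂ)) h0T]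
    symm
    refine Finset.sum_subset (Finset.subset_univ _) fun b _ hb => ?_
    rw [Finset.mem_insert, not_or] at hb
    rw [hfib b hb.2 hb.1]; simp
  have hfibsum : ∀ f : ZMod p → ℂ, ∑ x : E, f (Algebra.norm (ZMod p) (aeval x g) ^ k) =
      ∑ b, f b * ((fib b).card : ℂ) := by
    intro f
    rw [← Finset.sum_fiberwise_of_maps_to (s := Finset.univ) (t := Finset.univ)
      (g := fun x : E => Algebra.norm (ZMod p) (aeval x g) ^ k) (fun _ _ => Finset.mem_univ _)]
    refine Finset.sum_congr rfl fun b _ => ?_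
    rw [Finset.sum_congr rfl (g := fun _ => f b) fun x hx => by rw [(Finset.mem_filter.mp hx).2]]
    rw [Finset.sum_const, nsmul_eq_mul, mul_comm]
  have htot : (p : ℝ) ^ n - g.natDegree ≤ ∑ b ∈ T, ((fib b).card : ℝ) := by
    have h1 := (hfibsum fun _ => 1).symm.trans (by simp : _ = (Fintype.card E : ℂ))
    rw [hsplit, hE] at h1
    have h2 : ((fib 0).card : ℝ) + ∑ b ∈ T, ((fib b).card : ℝ) = (p : ℝ) ^ n := by
      have : (((fib 0).card + ∑ b ∈ T, (fib b).card : ℕ) : ℂ) = ((p ^ n : ℕ) : ℂ) := by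
        rw [← h1]; push_cast; simp
      exact_mod_cast this
    linarith
  have hdev : ∀ b ∈ T, |((fib b).card : ℝ) - (p : ℝ) ^ n / d| ≤
      g.natDegree + C * Real.sqrt ((p : ℝ) ^ n) := fun b hb =>
    abs_sub_le_of_forall_le_of_sum_ge T (fun b => ((fib b).card : ℝ)) hTcard
      (by positivity) (by positivity) (by positivity) hup htot hb
  have hS : ∑ x : E, (ψ ^ k) (Algebra.norm (ZMod p) (aeval x g)) =
      ∑ b ∈ T, ψ b * (((fib b).card : ℝ) - (p : ℝ) ^ n / d : ℝ) := by
    rw [Finset.sum_congr rfl (g := fun x : E => ψ (Algebra.norm (ZMod p) (aeval x g) ^ k))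
      fun x _ => by rw [MulChar.pow_apply' _ hk.ne', map_pow], hfibsum, hsplit, MulChar.map_zero, zero_mul,
      zero_add]
    have h1 : ∑ b ∈ T, ψ b = 0 := by
      convert sum_mulChar_pow_eq_one (F := ZMod p) (by rw [ZMod.card]; exact hdk) hψ
    have h2 : ∀ b, ψ b * (((fib b).card : ℝ) - (p : ℝ) ^ n / d : ℝ) =
        ψ b * ((fib b).card : ℂ) - ψ b * ((p : ℂ) ^ n / d) := by
      intro b; push_cast; ring
    rw [Finset.sum_congr rfl fun b _ => h2 b, Finset.sum_sub_distrib, ← Finset.sum_mul, h1,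
      zero_mul, sub_zero]
  rw [hS]
  refine (norm_sum_le _ _).trans ?_
  have hterm : ∀ b ∈ T, ‖ψ b * (((fib b).card : ℝ) - (p : ℝ) ^ n / d : ℝ)‖ ≤
      g.natDegree + C * Real.sqrt ((p : ℝ) ^ n) := by
    intro b hb
    rw [norm_mul, Complex.norm_real, Real.norm_eq_abs]
    refine (mul_le_of_le_one_left (abs_nonneg _) ?_).trans (hdev b hb)
    exact DirichletCharacter.norm_le_one ψ b
  refine (Finset.sum_le_card_nsmul _ _ _ hterm).trans ?_
  rw [nsmul_eq_mul, mul_assoc]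
  have hTd : (T.card : ℝ) ≤ d := by exact_mod_cast hTcard
  refine mul_le_mul hTd ?_ (by positivity) (by positivity)
  rw [add_mul]
  have : (g.natDegree : ℝ) ≤ g.natDegree * Real.sqrt ((p : ℝ) ^ n) :=
    le_mul_of_one_le_right (by positivity) hQR
  linarith

/-- The monic polynomials of degree `n` over a finite field. -/
def monicsOfDegree (F : Type*) [Field F] [Fintype F] (n : ℕ) : Finset F[X] :=
  Finset.univ.image fun v : Fin n → F => X ^ n + ∑ i, C (v i) * X ^ (i : ℕ)

theorem mem_monicsOfDegree {F : Type*} [Field F] [Fintype F] {n : ℕ} {h : F[X]} :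
    h ∈ monicsOfDegree F n ↔ h.Monic ∧ h.natDegree = n := by
  simp only [monicsOfDegree, Finset.mem_image, Finset.mem_univ, true_and]
  constructor
  · rintro ⟨v, rfl⟩
    have hlt := degree_sum_fin_lt v
    have hm : (X ^ n + ∑ i, C (v i) * X ^ (i : ℕ) : F[X]).Monic := monic_X_pow_add hlt
    refine ⟨hm, ?_⟩
    rw [natDegree_eq_of_degree_eq_some]
    rw [degree_add_eq_left_of_degree_lt (by rwa [degree_X_pow]), degree_X_pow]
  · rintro ⟨hm, rfl⟩
    refine ⟨fun i => h.coeff i, ?_⟩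
    conv_rhs => rw [hm.as_sum]
    rw [Finset.sum_range]

theorem sum_monicsOfDegree_zero {F : Type*} [Field F] [Fintype F] (lam : F[X] → ℂ) :
    ∑ h ∈ monicsOfDegree F 0, lam h = lam 1 := by
  have : monicsOfDegree F 0 = {1} := by
    ext h
    rw [mem_monicsOfDegree, Finset.mem_singleton]
    refine ⟨fun ⟨h1, h2⟩ => h1.natDegree_eq_zero.mp h2, ?_⟩
    rintro rfl
    exact ⟨monic_one, natDegree_one⟩
  rw [this, Finset.sum_singleton]

theorem sum_monicsOfDegree_one {F : Type*} [Field F] [Fintype F] (lam : F[X] → ℂ) :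
    ∑ h ∈ monicsOfDegree F 1, lam h = ∑ x : F, lam (X - C x) := by
  symm
  refine Finset.sum_nbij (fun x => X - C x) ?_ ?_ ?_ fun _ _ => rfl
  · intro x _
    exact mem_monicsOfDegree.mpr ⟨monic_X_sub_C x, natDegree_X_sub_C x⟩
  · intro x _ y _ hxy
    simpa using hxy
  · intro h hh
    obtain ⟨h1, h2⟩ := mem_monicsOfDegree.mp hh
    refine ⟨-h.coeff 0, by simp, ?_⟩
    have := h1.eq_X_add_C h2
    simp only [map_neg, sub_neg_eq_add]
    exact this.symm

theorem sum_monicsOfDegree_filter_dvd {F : Type*} [Field F] [Fintype F] {lam : F[X] → ℂ}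
    (hmul : ∀ f g : F[X], f.Monic → g.Monic → lam (f * g) = lam f * lam g)
    {P : F[X]} (hP : P.Monic) {n : ℕ} (hn : P.natDegree ≤ n) :
    ∑ h ∈ (monicsOfDegree F n).filter (P ∣ ·), lam h =
      lam P * ∑ h ∈ monicsOfDegree F (n - P.natDegree), lam h := by
  rw [Finset.mul_sum]
  symm
  refine Finset.sum_nbij (fun h => P * h) ?_ ?_ ?_ ?_
  · intro h hh
    obtain ⟨h1, h2⟩ := mem_monicsOfDegree.mp hh
    rw [Finset.mem_filter, mem_monicsOfDegree]
    refine ⟨⟨hP.mul h1, ?_⟩, dvd_mul_right _ _⟩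
    rw [hP.natDegree_mul h1, h2]; omega
  · intro h _ h' _ hh
    exact mul_left_cancel₀ hP.ne_zero hh
  · intro f hf
    rw [Finset.coe_filter, Set.mem_ofPred_eq, mem_monicsOfDegree] at hf
    obtain ⟨⟨h1, h2⟩, h, rfl⟩ := hf
    have hh : h.Monic := hP.of_mul_monic_left h1
    refine ⟨h, ?_, rfl⟩
    rw [Finset.mem_coe, mem_monicsOfDegree]
    refine ⟨hh, ?_⟩
    rw [hP.natDegree_mul hh] at h2
    omega
  · intro h hh
    exact (hmul P h hP (mem_monicsOfDegree.mp hh).1).symm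

/-- The monic irreducible polynomials of degree `n` over a finite field. -/
def monicIrreduciblesOfDegree (F : Type*) [Field F] [Fintype F] (n : ℕ) : Finset F[X] :=
  (monicsOfDegree F n).filter Irreducible

theorem mem_monicIrreduciblesOfDegree {F : Type*} [Field F] [Fintype F] {n : ℕ} {h : F[X]} :
    h ∈ monicIrreduciblesOfDegree F n ↔ h.Monic ∧ h.natDegree = n ∧ Irreducible h := by
  rw [monicIrreduciblesOfDegree, Finset.mem_filter, mem_monicsOfDegree, and_assoc]

theorem natDegree_eq_sum_prime_powers {F : Type*} [Field F] [Fintype F] {h : F[X]}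
    (hm : h.Monic) :
    h.natDegree = ∑ δ ∈ Finset.Icc 1 h.natDegree, ∑ P ∈ monicIrreduciblesOfDegree F δ,
      ∑ j ∈ Finset.Icc 1 h.natDegree, if P ^ j ∣ h then δ else 0 := by
  have hh := hm.ne_zero
  set n := h.natDegree with hn
  have hdeg : n = ((UniqueFactorizationMonoid.normalizedFactors h).map natDegree).sum := by
    have h1 : (UniqueFactorizationMonoid.normalizedFactors h).prod = h := by
      rw [UniqueFactorizationMonoid.prod_normalizedFactors_eq hh, hm.normalize_eq_self]
    rw [← natDegree_multiset_prod _ (UniqueFactorizationMonoid.zero_notMem_normalizedFactors h),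
      h1]
  set M := UniqueFactorizationMonoid.normalizedFactors h with hM
  have hmemM : ∀ P ∈ M, P.Monic ∧ Irreducible P ∧ P ∣ h := by
    intro P hP
    have hirr := UniqueFactorizationMonoid.irreducible_of_normalized_factor P hP
    refine ⟨?_, hirr, UniqueFactorizationMonoid.dvd_of_mem_normalizedFactors hP⟩
    have := UniqueFactorizationMonoid.normalize_normalized_factor P hP
    rw [← this]
    exact monic_normalize hirr.ne_zero
  have hinner : ∀ δ, 1 ≤ δ → ∀ P ∈ monicIrreduciblesOfDegree F δ,
      (∑ j ∈ Finset.Icc 1 n, if P ^ j ∣ h then δ else 0) = M.count P * δ := by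
    intro δ hδ P hP
    obtain ⟨hPm, hPd, hPi⟩ := mem_monicIrreduciblesOfDegree.mp hP
    have hcount : ∀ j, P ^ j ∣ h ↔ j ≤ M.count P := by
      intro j
      rw [pow_dvd_iff_le_emultiplicity,
        UniqueFactorizationMonoid.emultiplicity_eq_count_normalizedFactors hPi hh,
        hPm.normalize_eq_self, Nat.cast_le]
    have hle : M.count P ≤ n := by
      have := natDegree_le_of_dvd ((hcount _).mpr le_rfl) hh
      rw [natDegree_pow, hPd] at this
      nlinarith
    rw [← Finset.sum_filter, Finset.sum_const, smul_eq_mul]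
    congr 1
    have : (Finset.Icc 1 n).filter (fun j => P ^ j ∣ h) = Finset.Icc 1 (M.count P) := by
      ext j
      simp only [Finset.mem_filter, Finset.mem_Icc, hcount]
      omega
    rw [this, Nat.card_Icc]; omega
  rw [Finset.sum_congr rfl fun δ hδ => Finset.sum_congr rfl
    (hinner δ (Finset.mem_Icc.mp hδ).1), Finset.sum_sigma', hdeg, Finset.sum_multiset_map_count]
  symm
  refine (Finset.sum_subset_zero_on_sdiff (s₁ := (M.toFinset.image
    fun P => (⟨P.natDegree, P⟩ : (_ : ℕ) × F[X]))) ?_ ?_ (fun _ _ => rfl)).symm.trans ?_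
  · intro a ha
    obtain ⟨P, hP, rfl⟩ := Finset.mem_image.mp ha
    obtain ⟨h1, h2, h3⟩ := hmemM P (Multiset.mem_toFinset.mp hP)
    rw [Finset.mem_sigma, Finset.mem_Icc, mem_monicIrreduciblesOfDegree]
    refine ⟨⟨h2.natDegree_pos, ?_⟩, h1, rfl, h2⟩
    have := natDegree_le_of_dvd h3 hh
    rw [← Finset.sum_multiset_map_count, ← hdeg]
    exact this
  · rintro ⟨δ, P⟩ hx
    rw [Finset.mem_sdiff, Finset.mem_sigma] at hx
    obtain ⟨⟨h1, h2⟩, h3⟩ := hx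
    simp only at h1 h2
    obtain ⟨hPm, hPd, hPi⟩ := mem_monicIrreduciblesOfDegree.mp h2
    have : P ∉ M := by
      intro hP
      apply h3
      refine Finset.mem_image.mpr ⟨P, Multiset.mem_toFinset.mpr hP, ?_⟩
      rw [hPd]
    simp [Multiset.count_eq_zero_of_notMem this]
  · rw [Finset.sum_image]
    · rfl
    · intro a _ b _ hab
      simp only [Sigma.mk.injEq] at hab
      exact eq_of_heq hab.2

/-- Newton's identities for the coefficients of the Euler product of a completely
multiplicative function on monic polynomials. -/
theorem newton_monicsOfDegree {F : Type*} [Field F] [Fintype F] {lam : F[X] → ℂ}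
    (hone : lam 1 = 1)
    (hmul : ∀ f g : F[X], f.Monic → g.Monic → lam (f * g) = lam f * lam g) (n : ℕ) :
    (n : ℂ) * ∑ h ∈ monicsOfDegree F n, lam h =
      ∑ k ∈ Finset.Icc 1 n, (∑ δ ∈ k.divisors, ∑ P ∈ monicIrreduciblesOfDegree F δ,
        (δ : ℂ) * lam P ^ (k / δ)) * ∑ h ∈ monicsOfDegree F (n - k), lam h := by
  have hpow : ∀ P : F[X], P.Monic → ∀ j, lam (P ^ j) = lam P ^ j := by
    intro P hP j
    induction j with
    | zero => simp [hone]
    | succ j ih => rw [pow_succ, hmul _ _ (hP.pow j) hP, ih, pow_succ]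
  set a : ℕ → ℂ := fun n => ∑ h ∈ monicsOfDegree F n, lam h with ha
  change (n : ℂ) * a n = ∑ k ∈ Finset.Icc 1 n, _ * a (n - k)
  have hL : (n : ℂ) * a n = ∑ δ ∈ Finset.Icc 1 n, ∑ P ∈ monicIrreduciblesOfDegree F δ,
      ∑ j ∈ Finset.Icc 1 n, if δ * j ≤ n then (δ : ℂ) * lam P ^ j * a (n - δ * j) else 0 := by
    have h1 : (n : ℂ) * a n = ∑ h ∈ monicsOfDegree F n, ∑ δ ∈ Finset.Icc 1 n,
        ∑ P ∈ monicIrreduciblesOfDegree F δ, ∑ j ∈ Finset.Icc 1 n,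
          if P ^ j ∣ h then (δ : ℂ) * lam h else 0 := by
      rw [ha, Finset.mul_sum]
      refine Finset.sum_congr rfl fun h hh => ?_
      obtain ⟨hm, hd⟩ := mem_monicsOfDegree.mp hh
      have := natDegree_eq_sum_prime_powers hm
      rw [hd] at this
      conv_lhs => rw [this]
      push_cast
      simp_rw [Finset.sum_mul, ite_mul, zero_mul]
    rw [h1, Finset.sum_comm]
    refine Finset.sum_congr rfl fun δ hδ => ?_
    rw [Finset.sum_comm]
    refine Finset.sum_congr rfl fun P hP => ?_
    obtain ⟨hPm, hPd, hPi⟩ := mem_monicIrreduciblesOfDegree.mp hP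
    rw [Finset.sum_comm]
    refine Finset.sum_congr rfl fun j hj => ?_
    rw [← Finset.sum_filter, ← Finset.mul_sum]
    have hdeg : (P ^ j).natDegree = δ * j := by rw [natDegree_pow, hPd, mul_comm]
    split_ifs with hle
    · have := sum_monicsOfDegree_filter_dvd hmul (hPm.pow j) (n := n) (by rw [hdeg]; exact hle)
      rw [this, hpow P hPm, hdeg, mul_assoc]
    · rw [Finset.filter_false_of_mem, Finset.sum_empty, mul_zero]
      intro h hh hdvd
      obtain ⟨hm, hd⟩ := mem_monicsOfDegree.mp hh
      have := natDegree_le_of_dvd hdvd hm.ne_zero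
      omega
  rw [hL]
  have hR : ∀ k ∈ Finset.Icc 1 n, (∑ δ ∈ k.divisors, ∑ P ∈ monicIrreduciblesOfDegree F δ,
        (δ : ℂ) * lam P ^ (k / δ)) * a (n - k) = ∑ δ ∈ Finset.Icc 1 n, if δ ∣ k then
        ∑ P ∈ monicIrreduciblesOfDegree F δ, (δ : ℂ) * lam P ^ (k / δ) * a (n - k) else 0 := by
    intro k hk
    rw [Finset.mem_Icc] at hk
    rw [← Finset.sum_filter]
    have : (Finset.Icc 1 n).filter (· ∣ k) = k.divisors := by
      ext δ
      simp only [Finset.mem_filter, Finset.mem_Icc, Nat.mem_divisors]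
      constructor
      · rintro ⟨h1, h2⟩; exact ⟨h2, by omega⟩
      · rintro ⟨h1, h2⟩
        exact ⟨⟨Nat.pos_of_dvd_of_pos h1 (by omega), (Nat.le_of_dvd (by omega) h1).trans hk.2⟩,
          h1⟩
    rw [this, Finset.sum_mul]
    exact Finset.sum_congr rfl fun δ _ => Finset.sum_mul _ _ _
  rw [Finset.sum_congr rfl hR, Finset.sum_comm]
  refine Finset.sum_congr rfl fun δ hδ => ?_
  rw [Finset.mem_Icc] at hδ
  have hpull : ∀ j : ℕ, (∑ P ∈ monicIrreduciblesOfDegree F δ,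
      if δ * j ≤ n then (δ : ℂ) * lam P ^ j * a (n - δ * j) else 0) = if δ * j ≤ n then
        ∑ P ∈ monicIrreduciblesOfDegree F δ, (δ : ℂ) * lam P ^ j * a (n - δ * j) else 0 := by
    intro j
    split_ifs <;> simp
  rw [Finset.sum_comm, Finset.sum_congr rfl fun j _ => hpull j, ← Finset.sum_filter,
    ← Finset.sum_filter]
  refine Finset.sum_nbij' (fun j => δ * j) (fun k => k / δ) ?_ ?_ ?_ ?_ ?_
  · intro j hj
    simp only [Finset.mem_filter, Finset.mem_Icc] at hj ⊢
    exact ⟨⟨Nat.mul_pos hδ.1 hj.1.1, hj.2⟩, dvd_mul_right _ _⟩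
  · intro k hk
    simp only [Finset.mem_filter, Finset.mem_Icc] at hk ⊢
    obtain ⟨hk, c, rfl⟩ := hk
    rw [Nat.mul_div_cancel_left _ hδ.1]
    refine ⟨⟨Nat.pos_of_ne_zero ?_, ?_⟩, hk.2⟩
    · rintro rfl; simp at hk
    · exact (Nat.le_mul_of_pos_left _ hδ.1).trans hk.2
  · intro j _
    exact Nat.mul_div_cancel_left _ hδ.1
  · intro k hk
    simp only [Finset.mem_filter] at hk
    exact Nat.mul_div_cancel' hk.2
  · intro j _
    refine Finset.sum_congr rfl fun P _ => ?_
    rw [Nat.mul_div_cancel_left _ hδ.1]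

theorem norm_aeval_eq_resultant_pow {F E : Type*} [Field F] [Fintype F] [Field E] [Fintype E]
    [Algebra F E] (g : F[X]) (x : E) :
    Algebra.norm F (aeval x g) =
      resultant (minpoly F x) g ^ (Module.finrank F E / (minpoly F x).natDegree) := by
  have hx : IsIntegral F x := Algebra.IsIntegral.isIntegral x
  set L := IntermediateField.adjoin F {x} with hL
  set pb := IntermediateField.adjoin.powerBasis hx with hpb
  have hgen : algebraMap L E pb.gen = x := by
    rw [hpb, IntermediateField.adjoin.powerBasis_gen]
    exact IntermediateField.AdjoinSimple.algebraMap_gen F x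
  have hmin : minpoly F pb.gen = minpoly F x := by
    have := minpoly.algebraMap_eq (A := F) (algebraMap L E).injective pb.gen
    rw [← this]
    exact congrArg _ hgen
  have hy : aeval x g = algebraMap L E (aeval pb.gen g) := by
    rw [← aeval_algebraMap_apply, hgen]
  have hfin : Module.finrank F L = (minpoly F x).natDegree :=
    IntermediateField.adjoin.finrank hx
  have hdvd : Module.finrank F E / (minpoly F x).natDegree = Module.finrank L E := by
    rw [← hfin, ← Module.finrank_mul_finrank F L E, Nat.mul_div_cancel_left _ Module.finrank_pos]
  rw [hdvd, hy, ← Algebra.norm_norm (S := L), Algebra.norm_algebraMap, map_pow]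
  congr 1
  apply (algebraMap F (AlgebraicClosure F)).injective
  rw [Algebra.norm_eq_prod_embeddings, ← resultant_map_map,
    ← natDegree_map (algebraMap F (AlgebraicClosure F)),
    resultant_eq_prod_eval _ _ _ natDegree_map_le (IsAlgClosed.splits _),
    ((minpoly.monic hx).map _).leadingCoeff, one_pow, one_mul]
  have hsep : ((minpoly F x).map (algebraMap F (AlgebraicClosure F))).Separable :=
    (PerfectField.separable_of_irreducible (minpoly.irreducible hx)).map
  rw [Fintype.prod_equiv pb.liftEquiv' (fun σ : L →ₐ[F] AlgebraicClosure F => σ (aeval pb.gen g))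
    (fun b => aeval (b : AlgebraicClosure F) g)]
  · rw [Finset.prod_mem_multiset (f := fun b : { y // y ∈ (minpoly F pb.gen).aroots (AlgebraicClosure F)} =>
      aeval (b : AlgebraicClosure F) g) (g := fun b => aeval b g) (hfg := fun _ => rfl),
      Finset.prod_eq_multiset_prod, Multiset.toFinset_val, hmin, Multiset.dedup_eq_self.mpr]
    · simp only [aroots_def, eval_map_algebraMap]
    · exact nodup_roots hsep
  · intro σ
    rw [PowerBasis.liftEquiv'_apply_coe, aeval_algHom_apply]

theorem card_filter_minpoly_eq {F E : Type*} [Field F] [Fintype F] [Field E] [Fintype E]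
    [Algebra F E] {P : F[X]} (hm : P.Monic) (hi : Irreducible P)
    (hd : P.natDegree ∣ Module.finrank F E) :
    (Finset.univ.filter fun x : E => minpoly F x = P).card = P.natDegree := by
  have hsplit : (P.map (algebraMap F E)).Splits := by
    have h1 := (hi.natDegree_dvd_iff_dvd_X_pow_card_pow_sub_X).mp hd
    have h2 : Nat.card F ^ Module.finrank F E = Fintype.card E := by
      rw [Nat.card_eq_fintype_card]
      exact (Module.card_eq_pow_finrank (K := F) (V := E)).symm
    rw [h2] at h1
    refine Splits.of_dvd (g := X ^ Fintype.card E - X) ?_ ?_ ?_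
    · simpa using (FiniteField.isSplittingField_sub E F).splits
    · exact FiniteField.X_pow_card_sub_X_ne_zero E Fintype.one_lt_card
    · simpa using Polynomial.map_dvd (algebraMap F E) h1
  have hsep : P.Separable := PerfectField.separable_of_irreducible hi
  have : (Finset.univ.filter fun x : E => minpoly F x = P) = (P.aroots E).toFinset := by
    ext x
    rw [Finset.mem_filter, Multiset.mem_toFinset, mem_aroots]
    constructor
    · rintro ⟨-, rfl⟩
      exact ⟨hm.ne_zero, minpoly.aeval F x⟩
    · rintro ⟨-, h⟩
      exact ⟨Finset.mem_univ _, (minpoly.eq_of_irreducible_of_monic hi h hm).symm⟩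
  rw [this, Multiset.toFinset_card_of_nodup (nodup_roots hsep.map),
    ← hsplit.natDegree_eq_card_roots, natDegree_map]

theorem sum_minpoly_eq {F E : Type*} [Field F] [Fintype F] [Field E] [Fintype E]
    [Algebra F E] (f : F[X] → ℂ) :
    ∑ x : E, f (minpoly F x) = ∑ δ ∈ (Module.finrank F E).divisors,
      ∑ P ∈ monicIrreduciblesOfDegree F δ, (δ : ℂ) * f P := by
  have hmaps : ∀ x ∈ (Finset.univ : Finset E), (⟨(minpoly F x).natDegree, minpoly F x⟩ :
      (_ : ℕ) × F[X]) ∈ (Module.finrank F E).divisors.sigma (monicIrreduciblesOfDegree F) := by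
    intro x _
    have hx : IsIntegral F x := Algebra.IsIntegral.isIntegral x
    rw [Finset.mem_sigma, Nat.mem_divisors, mem_monicIrreduciblesOfDegree]
    exact ⟨⟨minpoly.degree_dvd hx, Module.finrank_pos.ne'⟩, minpoly.monic hx, rfl,
      minpoly.irreducible hx⟩
  rw [Finset.sum_sigma', ← Finset.sum_fiberwise_of_maps_to hmaps]
  refine Finset.sum_congr rfl fun a h => ?_
  obtain ⟨δ, P⟩ := a
  rw [Finset.mem_sigma, Nat.mem_divisors] at h
  obtain ⟨⟨hd, -⟩, hP⟩ := h
  simp only at hd hP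
  obtain ⟨hm, rfl, hi⟩ := mem_monicIrreduciblesOfDegree.mp hP
  have hfil : (Finset.univ.filter fun x : E => (⟨(minpoly F x).natDegree, minpoly F x⟩ :
      (_ : ℕ) × F[X]) = ⟨P.natDegree, P⟩) = Finset.univ.filter fun x : E => minpoly F x = P := by
    ext x
    simp only [Finset.mem_filter, Finset.mem_univ, true_and, Sigma.mk.injEq, heq_eq_eq]
    exact ⟨fun h => h.2, fun h => ⟨by rw [h], h⟩⟩
  rw [hfil, Finset.sum_congr rfl (g := fun _ => f P)
    fun x hx => by rw [(Finset.mem_filter.mp hx).2], Finset.sum_const,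
    card_filter_minpoly_eq hm hi hd, nsmul_eq_mul]

theorem resultant_eq_prod_aroots {F : Type*} [Field F] {g h : F[X]} (hg : g.Monic) :
    algebraMap F (AlgebraicClosure F) (resultant g h) =
      ((g.aroots (AlgebraicClosure F)).map fun β => aeval β h).prod := by
  rw [← resultant_map_map, ← natDegree_map (algebraMap F (AlgebraicClosure F)),
    resultant_eq_prod_eval _ _ _ natDegree_map_le (IsAlgClosed.splits _),
    (hg.map _).leadingCoeff, one_pow, one_mul]
  simp only [aroots_def, eval_map_algebraMap]

theorem sum_resultant_eq_zero {F : Type*} [Field F] [Fintype F] {χ : MulChar F ℂ} {g Q h₀ : F[X]}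
    (hg : g.Monic) (hQ : Q ≠ 0)
    (hroots : ∀ β ∈ g.aroots (AlgebraicClosure F), aeval β Q = 0) (hcop : IsCoprime h₀ Q)
    (hχ : χ (resultant g h₀) ≠ 1) {n : ℕ} (hn : Q.natDegree ≤ n) :
    ∑ h ∈ monicsOfDegree F n, χ (resultant h g) = 0 := by
  set φ : F[X] → F[X] := fun h => h - h % Q + (h₀ * h) % Q with hφ
  have hφmem : ∀ h ∈ monicsOfDegree F n, φ h ∈ monicsOfDegree F n := by
    intro h hh
    obtain ⟨hm, hd⟩ := mem_monicsOfDegree.mp hh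
    have hQn : Q.degree ≤ n := degree_le_of_natDegree_le hn
    have hlt : ((h₀ * h) % Q - h % Q).degree < h.degree := by
      have h1 : ∀ u : F[X], (u % Q).degree < h.degree := fun u =>
        (EuclideanDomain.mod_lt u hQ).trans_le (by rwa [degree_eq_natDegree hm.ne_zero, hd])
      exact (degree_sub_le _ _).trans_lt (max_lt (h1 _) (h1 _))
    have heq : φ h = h + ((h₀ * h) % Q - h % Q) := by simp only [hφ]; ring
    rw [heq, mem_monicsOfDegree]
    exact ⟨hm.add_of_left hlt, by rw [natDegree_add_eq_left_of_degree_lt hlt, hd]⟩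
  have hmod : ∀ h, Q ∣ φ h - h₀ * h := by
    intro h
    refine ⟨h / Q - (h₀ * h) / Q, ?_⟩
    simp only [hφ]
    linear_combination -(EuclideanDomain.div_add_mod h Q) +
      EuclideanDomain.div_add_mod (h₀ * h) Q
  have hinj : Set.InjOn φ (monicsOfDegree F n : Set F[X]) := by
    intro h _ h' _ hh
    have h2 : Q ∣ h₀ * (h - h') := by
      have := dvd_sub (hmod h') (hmod h)
      rw [← hh] at this
      convert this using 1
      ring
    have h3 : Q ∣ h - h' := hcop.symm.dvd_of_dvd_mul_left h2
    have h1 : (h₀ * h) % Q = (h₀ * h') % Q := mod_eq_of_dvd_sub (by rwa [← mul_sub])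
    have h4 : h % Q = h' % Q := mod_eq_of_dvd_sub h3
    simp only [hφ] at hh
    rw [h1, h4] at hh
    linear_combination hh
  have heval : ∀ h, ∀ β ∈ g.aroots (AlgebraicClosure F),
      aeval β (φ h) = aeval β h₀ * aeval β h := by
    intro h β hβ
    have h1 : ∀ u : F[X], aeval β (u % Q) = aeval β u := by
      intro u
      conv_rhs => rw [← EuclideanDomain.div_add_mod u Q]
      rw [map_add, map_mul, hroots β hβ, zero_mul, zero_add]
    simp only [hφ, map_add, map_sub, h1, map_mul]
    ring
  have hres : ∀ h ∈ monicsOfDegree F n,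
      resultant (φ h) g = resultant g h₀ * resultant h g := by
    intro h hh
    apply (algebraMap F (AlgebraicClosure F)).injective
    rw [resultant_comm (φ h), resultant_comm h, (mem_monicsOfDegree.mp hh).2,
      (mem_monicsOfDegree.mp (hφmem h hh)).2]
    have e1 : resultant g (φ h) g.natDegree n = resultant g (φ h) := by
      rw [(mem_monicsOfDegree.mp (hφmem h hh)).2]
    have e2 : resultant g h g.natDegree n = resultant g h := by
      rw [(mem_monicsOfDegree.mp hh).2]
    rw [e1, e2, map_mul, map_mul, map_mul, resultant_eq_prod_aroots hg,
      resultant_eq_prod_aroots hg, resultant_eq_prod_aroots hg,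
      Multiset.map_congr rfl (heval h), Multiset.prod_map_mul]
    ring
  have himage : (monicsOfDegree F n).image φ = monicsOfDegree F n :=
    Finset.eq_of_subset_of_card_le (Finset.image_subset_iff.mpr hφmem)
      (Finset.card_image_of_injOn hinj).ge
  have hkey : ∑ h ∈ monicsOfDegree F n, χ (resultant h g) =
      χ (resultant g h₀) * ∑ h ∈ monicsOfDegree F n, χ (resultant h g) := by
    conv_lhs => rw [← himage, Finset.sum_image hinj]
    rw [Finset.mul_sum]
    exact Finset.sum_congr rfl fun h hh => by rw [hres h hh, map_mul]
  have : (χ (resultant g h₀) - 1) * ∑ h ∈ monicsOfDegree F n, χ (resultant h g) = 0 := by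
    linear_combination -hkey
  exact (mul_eq_zero.mp this).resolve_left (sub_ne_zero.mpr hχ)

/-- If the power sums attached to a polynomial `∑ aₙ Tⁿ` with `a₀ = 1` by Newton's identities
grow at most like `Qᵏ`, then all its inverse roots have modulus at most `Q`. -/
theorem norm_coeff_one_le_of_newton {a s : ℕ → ℂ} {r : ℕ} {Q A : ℝ} (hQ : 0 < Q) (ha0 : a 0 = 1)
    (har : ∀ n, r ≤ n → a n = 0)
    (hnewton : ∀ n : ℕ, (n : ℂ) * a n = ∑ k ∈ Finset.Icc 1 n, s k * a (n - k))
    (hs : ∀ k, 0 < k → ‖s k‖ ≤ A * Q ^ k) : ‖a 1‖ ≤ r * Q := by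
  have hA : 0 ≤ A := by
    have := (norm_nonneg _).trans (hs 1 one_pos)
    rw [pow_one] at this
    exact nonneg_of_mul_nonneg_left this hQ
  set s' : ℕ → ℂ := fun k => if k = 0 then 0 else s k with hs'
  have hs'b : ∀ k, ‖s' k‖ ≤ A * Q ^ k := by
    intro k
    simp only [hs']
    split_ifs with h
    · rw [norm_zero]; positivity
    · exact hs k (Nat.pos_of_ne_zero h)
  have hnewton' : ∀ n : ℕ, (n : ℂ) * a n =
      ∑ kl ∈ Finset.HasAntidiagonal.antidiagonal n, s' kl.1 * a kl.2 := by
    intro n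
    rw [hnewton, Finset.Nat.sum_antidiagonal_eq_sum_range_succ fun k l => s' k * a l,
      Finset.sum_range_succ']
    simp only [hs', if_true, zero_mul, add_zero, Nat.succ_ne_zero, if_false]
    rw [Finset.sum_bij (fun k _ => k - 1)]
    · intro k hk; rw [Finset.mem_Icc] at hk; rw [Finset.mem_range]; omega
    · intro k hk l hl h; rw [Finset.mem_Icc] at hk hl; omega
    · intro b hb
      rw [Finset.mem_range] at hb
      exact ⟨b + 1, Finset.mem_Icc.mpr ⟨by omega, by omega⟩, by omega⟩
    · intro k hk
      rw [Finset.mem_Icc] at hk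
      rw [Nat.sub_add_cancel hk.1]
  set L : ℂ[X] := ∑ i ∈ Finset.range r, C (a i) * X ^ i with hL
  have hcoeff : ∀ n, L.coeff n = a n := by
    intro n
    rw [hL, finsetSum_coeff]
    simp only [coeff_C_mul_X_pow]
    rw [Finset.sum_ite_eq]
    split_ifs with h
    · rfl
    · rw [Finset.mem_range, not_lt] at h
      exact (har n h).symm
  have hL0 : L.eval 0 = 1 := by rw [← coeff_zero_eq_eval_zero, hcoeff, ha0]
  have hLne : L ≠ 0 := by
    rintro h
    rw [h] at hL0
    simp at hL0
  have hdeg : L.natDegree ≤ r := by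
    rw [natDegree_le_iff_coeff_eq_zero]
    intro n hn
    rw [hcoeff, har n hn.le]
  have heval : ∀ T : ℂ, L.eval T = ∑' n, a n * T ^ n := by
    intro T
    rw [tsum_eq_sum (s := Finset.range r), hL, eval_finsetSum]
    · simp
    · intro n hn
      rw [Finset.mem_range, not_lt] at hn
      rw [har n hn, zero_mul]
  have hdeval : ∀ T : ℂ, T * L.derivative.eval T = ∑' n : ℕ, (n * a n) * T ^ n := by
    intro T
    rw [tsum_eq_sum (s := Finset.range r), hL, derivative_sum, eval_finsetSum, Finset.mul_sum]
    · refine Finset.sum_congr rfl fun n _ => ?_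
      rw [derivative_C_mul_X_pow]
      rcases n with _ | n
      · simp
      · simp [pow_succ]; ring
    · intro n hn
      rw [Finset.mem_range, not_lt] at hn
      rw [har n hn, mul_zero, zero_mul]
  have hasum : ∀ T : ℂ, Summable fun n => ‖a n * T ^ n‖ := by
    intro T
    refine summable_of_ne_finset_zero (s := Finset.range r) fun n hn => ?_
    rw [Finset.mem_range, not_lt] at hn
    rw [har n hn, zero_mul, norm_zero]
  have hterm : ∀ (T : ℂ) (ρ : ℝ), ‖T‖ ≤ ρ → ∀ k, ‖s' k * T ^ k‖ ≤ A * (Q * ρ) ^ k := by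
    intro T ρ hT k
    rw [norm_mul, norm_pow, mul_pow, ← mul_assoc]
    exact mul_le_mul (hs'b k) (pow_le_pow_left₀ (norm_nonneg _) hT k) (by positivity)
      (by positivity)
  have hroot : ∀ z ∈ L.roots, 1 / Q ≤ ‖z‖ := by
    intro z hz
    by_contra! hlt
    obtain ⟨ρ, hzρ, hρ⟩ := exists_between hlt
    have hρ0 : 0 ≤ ρ := (norm_nonneg z).trans hzρ.le
    have hgeo : Summable fun k : ℕ => A * (Q * ρ) ^ k := by
      refine (summable_geometric_of_lt_one (by positivity) ?_).mul_left A
      rw [lt_div_iff₀ hQ] at hρ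
      linarith [mul_comm Q ρ]
    set B := ∑' k : ℕ, A * (Q * ρ) ^ k with hB
    have hbound : ∀ T : ℂ, ‖T‖ ≤ ρ → ‖T * L.derivative.eval T‖ ≤ B * ‖L.eval T‖ := by
      intro T hT
      have hsum : Summable fun k => ‖s' k * T ^ k‖ :=
        Summable.of_nonneg_of_le (fun _ => norm_nonneg _) (hterm T ρ hT) hgeo
      have heq : T * L.derivative.eval T = (∑' k, s' k * T ^ k) * L.eval T := by
        rw [heval, tsum_mul_tsum_eq_tsum_sum_antidiagonal_of_summable_norm hsum (hasum T), hdeval]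
        refine tsum_congr fun n => ?_
        rw [hnewton', Finset.sum_mul]
        refine Finset.sum_congr rfl fun kl hkl => ?_
        rw [Finset.HasAntidiagonal.mem_antidiagonal] at hkl
        rw [← hkl, pow_add]
        ring
      rw [heq, norm_mul]
      refine mul_le_mul_of_nonneg_right ?_ (norm_nonneg _)
      exact (norm_tsum_le_tsum_norm hsum).trans (hsum.tsum_le_tsum (hterm T ρ hT) hgeo)
    have hz0 : z ≠ 0 := by
      rintro rfl
      rw [mem_roots hLne, IsRoot.def, hL0] at hz
      exact one_ne_zero hz
    set m := L.rootMultiplicity z with hm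
    have hmpos : 0 < m := (rootMultiplicity_pos hLne).mpr ((mem_roots hLne).mp hz)
    obtain ⟨M, hM, hMz⟩ := exists_eq_pow_rootMultiplicity_mul_and_not_dvd L hLne z
    rw [← hm] at hM
    rw [dvd_iff_isRoot, IsRoot.def] at hMz
    obtain ⟨m', hm'⟩ : ∃ m', m = m' + 1 := ⟨m - 1, by omega⟩
    have hder : L.derivative = (X - C z) ^ m' * (C (m : ℂ) * M + (X - C z) * M.derivative) := by
      rw [hM, hm', derivative_mul, derivative_pow]
      simp only [derivative_sub, derivative_X, derivative_C, sub_zero, mul_one,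
        Nat.add_sub_cancel]
      push_cast
      ring
    have hineq : ∀ T : ℂ, ‖T‖ ≤ ρ → T ≠ z →
        ‖T * (m * M.eval T + (T - z) * M.derivative.eval T)‖ ≤ B * (‖T - z‖ * ‖M.eval T‖) := by
      intro T hT hTz
      have h1 := hbound T hT
      have h2 : 0 < ‖(T - z) ^ m'‖ := norm_pos_iff.mpr (pow_ne_zero _ (sub_ne_zero.mpr hTz))
      rw [hder] at h1
      conv_rhs at h1 => rw [hM, hm']
      simp only [eval_mul, eval_pow, eval_sub, eval_X, eval_C, eval_add, pow_succ, norm_mul]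
        at h1 ⊢
      refine le_of_mul_le_mul_left ?_ h2
      linarith
    have hlim1 : Filter.Tendsto
        (fun T : ℂ => ‖T * (m * M.eval T + (T - z) * M.derivative.eval T)‖)
        (nhdsWithin z {z}ᶜ) (nhds ‖z * (m * M.eval z + (z - z) * M.derivative.eval z)‖) := by
      refine Continuous.continuousWithinAt ?_
      have h1 := M.continuous
      have h2 := M.derivative.continuous
      fun_prop
    have hlim2 : Filter.Tendsto (fun T : ℂ => B * (‖T - z‖ * ‖M.eval T‖))
        (nhdsWithin z {z}ᶜ) (nhds (B * (‖z - z‖ * ‖M.eval z‖))) := by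
      refine Continuous.continuousWithinAt ?_
      have h1 := M.continuous
      fun_prop
    have hev : ∀ᶠ T in nhdsWithin z {z}ᶜ,
        ‖T * (m * M.eval T + (T - z) * M.derivative.eval T)‖ ≤ B * (‖T - z‖ * ‖M.eval T‖) := by
      have h1 : ∀ᶠ T : ℂ in nhds z, ‖T‖ < ρ :=
        continuous_norm.continuousAt.eventually_lt continuousAt_const hzρ
      filter_upwards [self_mem_nhdsWithin, nhdsWithin_le_nhds h1] with T hT1 hT2
      exact hineq T hT2.le hT1
    have hfin := le_of_tendsto_of_tendsto hlim1 hlim2 hev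
    rw [sub_self, norm_zero, zero_mul, zero_mul, mul_zero, add_zero] at hfin
    have : z * (m * M.eval z) = 0 := norm_le_zero_iff.mp hfin
    rcases mul_eq_zero.mp this with h | h
    · exact hz0 h
    · rcases mul_eq_zero.mp h with h | h
      · exact hmpos.ne' (by exact_mod_cast h)
      · exact hMz h
  have hlog := (IsAlgClosed.splits L).eval_derivative_div_eval_of_ne_zero (x := 0)
    (by rw [hL0]; exact one_ne_zero)
  rw [hL0, div_one, ← coeff_zero_eq_eval_zero, coeff_derivative, zero_add, hcoeff] at hlog
  simp only [Nat.cast_zero, zero_add, mul_one] at hlog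
  rw [hlog]
  refine (norm_multiset_sum_le _).trans ?_
  rw [Multiset.map_map]
  have hle : ∀ y ∈ L.roots.map (norm ∘ fun z => 1 / ((0 : ℂ) - z)), y ≤ Q := by
    intro y hy
    obtain ⟨z, hz, rfl⟩ := Multiset.mem_map.mp hy
    simp only [Function.comp, zero_sub, norm_div, norm_one, norm_neg]
    rw [div_le_comm₀ ?_ hQ]
    · exact hroot z hz
    · exact (by positivity : 0 < 1 / Q).trans_le (hroot z hz)
  refine (Multiset.sum_le_card_nsmul _ _ hle).trans ?_
  rw [Multiset.card_map, nsmul_eq_mul]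
  refine mul_le_mul_of_nonneg_right ?_ hQ.le
  exact_mod_cast (card_roots' L).trans hdeg

theorem exists_mulChar_resultant_ne_one {p : ℕ} [Fact p.Prime] {χ : MulChar (ZMod p) ℂ}
    {g Q : (ZMod p)[X]} (hQ : Q ≠ 0)
    (hbound : ∃ C : ℝ, ∀ n, 0 < n → ∀ (E : Type) [Field E] [Fintype E] [Algebra (ZMod p) E],
      Fintype.card E = p ^ n →
        ‖∑ x : E, χ (Algebra.norm (ZMod p) (aeval x g))‖ ≤ C * Real.sqrt ((p : ℝ) ^ n)) :
    ∃ h₀ : (ZMod p)[X], IsCoprime h₀ Q ∧ χ (resultant g h₀) ≠ 1 := by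
  by_contra! hall
  obtain ⟨C, hC⟩ := hbound
  have hp := (Fact.out : p.Prime)
  set r := Q.natDegree with hr
  obtain ⟨n, hn⟩ := exists_nat_gt ((2 * r + |C| + 1) ^ 2)
  have hn0 : 0 < n := by
    have : (0 : ℝ) < n := lt_of_le_of_lt (by positivity) hn
    exact_mod_cast this
  have : Fintype (GaloisField p n) := Fintype.ofFinite _
  have hcard : Fintype.card (GaloisField p n) = p ^ n := by
    rw [← Nat.card_eq_fintype_card, GaloisField.card p n hn0.ne']
  have hfr : Module.finrank (ZMod p) (GaloisField p n) = n := GaloisField.finrank p hn0.ne'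
  set ε := χ ((-1) ^ (g.natDegree * n)) with hε
  have hgood : ∀ x : GaloisField p n, aeval x Q ≠ 0 →
      χ (Algebra.norm (ZMod p) (aeval x g)) = ε := by
    intro x hx
    have hint : IsIntegral (ZMod p) x := Algebra.IsIntegral.isIntegral x
    have hirr := minpoly.irreducible hint
    have hcop : IsCoprime (minpoly (ZMod p) x) Q :=
      hirr.coprime_iff_not_dvd.mpr fun h => hx ((minpoly.dvd_iff).mp h)
    have hdvd : (minpoly (ZMod p) x).natDegree ∣ n := by
      have h := minpoly.degree_dvd hint
      rwa [hfr] at h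
    rw [norm_aeval_eq_resultant_pow, map_pow, resultant_comm, map_mul, hall _ hcop, mul_one,
      ← map_pow, ← pow_mul, hfr, hε]
    congr 2
    rw [mul_comm (minpoly (ZMod p) x).natDegree, mul_assoc, Nat.mul_div_cancel' hdvd]
  have hεn : ‖ε‖ = 1 := by
    have h1 : ε ^ 2 = 1 := by
      rw [hε, ← map_pow, ← pow_mul, mul_comm, pow_mul, neg_one_sq, one_pow, map_one]
    have h2 : ‖ε‖ ^ 2 = 1 := by rw [← norm_pow, h1, norm_one]
    exact (pow_eq_one_iff_of_nonneg (norm_nonneg _) two_ne_zero).mp h2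
  set S := (Finset.univ.filter fun x : GaloisField p n => aeval x Q = 0) with hS
  have hScard : S.card ≤ r := by
    have hsub : S ⊆ (Q.aroots (GaloisField p n)).toFinset := by
      intro x hx
      rw [Multiset.mem_toFinset, mem_aroots]
      exact ⟨hQ, (Finset.mem_filter.mp hx).2⟩
    refine (Finset.card_le_card hsub).trans ((Multiset.toFinset_card_le _).trans ?_)
    exact (card_roots' _).trans natDegree_map_le
  have hdiff : (p : ℂ) ^ n * ε = ∑ x : GaloisField p n, χ (Algebra.norm (ZMod p) (aeval x g)) +
      ∑ x ∈ S, (ε - χ (Algebra.norm (ZMod p) (aeval x g))) := by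
    have h1 : ∑ x ∈ S, (ε - χ (Algebra.norm (ZMod p) (aeval x g))) =
        ∑ x : GaloisField p n, (ε - χ (Algebra.norm (ZMod p) (aeval x g))) := by
      refine Finset.sum_subset (Finset.subset_univ _) fun x _ hx => ?_
      rw [hgood x fun h => hx (Finset.mem_filter.mpr ⟨Finset.mem_univ _, h⟩), sub_self]
    rw [h1, Finset.sum_sub_distrib, Finset.sum_const, Finset.card_univ, hcard, nsmul_eq_mul]
    push_cast
    ring
  have hle : (p : ℝ) ^ n ≤ C * Real.sqrt ((p : ℝ) ^ n) + 2 * r := by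
    have h1 : ‖(p : ℂ) ^ n * ε‖ = (p : ℝ) ^ n := by
      rw [norm_mul, hεn, mul_one, norm_pow, Complex.norm_natCast]
    refine h1.ge.trans ?_
    rw [hdiff]
    refine (norm_add_le _ _).trans (add_le_add (hC n hn0 _ hcard) ?_)
    refine (norm_sum_le_of_le S (fun x _ => (norm_sub_le _ _).trans
      (add_le_add hεn.le (DirichletCharacter.norm_le_one χ _)))).trans ?_
    rw [Finset.sum_const, nsmul_eq_mul]
    have : (S.card : ℝ) ≤ r := by exact_mod_cast hScard
    linarith
  set y := Real.sqrt ((p : ℝ) ^ n) with hy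
  have hy2 : y * y = (p : ℝ) ^ n := Real.mul_self_sqrt (by positivity)
  have hlt : (n : ℝ) < (p : ℝ) ^ n := by exact_mod_cast Nat.lt_pow_self hp.one_lt
  have hylt : 2 * (r : ℝ) + |C| + 1 < y := by
    rw [hy]
    refine Real.lt_sqrt_of_sq_lt (hn.trans hlt)
  have hr0 : (0 : ℝ) ≤ r := Nat.cast_nonneg r
  nlinarith [abs_nonneg C, le_abs_self C]

/-- A bound for the extensions of a character sum over all finite extensions implies the Weil
bound. -/
theorem norm_sum_mulChar_le_of_extension_bound {p : ℕ} [Fact p.Prime] {χ : MulChar (ZMod p) ℂ}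
    {g Q : (ZMod p)[X]} (hg : g.Monic) (hQ : Q ≠ 0)
    (hroots : ∀ β ∈ g.aroots (AlgebraicClosure (ZMod p)), aeval β Q = 0)
    (hbound : ∃ C : ℝ, ∀ n, 0 < n → ∀ (E : Type) [Field E] [Fintype E] [Algebra (ZMod p) E],
      Fintype.card E = p ^ n →
        ‖∑ x : E, χ (Algebra.norm (ZMod p) (aeval x g))‖ ≤ C * Real.sqrt ((p : ℝ) ^ n)) :
    ‖∑ x : ZMod p, χ (g.eval x)‖ ≤ Q.natDegree * Real.sqrt p := by
  have hp := (Fact.out : p.Prime)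
  obtain ⟨h₀, hcop, hne⟩ := exists_mulChar_resultant_ne_one hQ hbound
  obtain ⟨C, hC⟩ := hbound
  set lam : (ZMod p)[X] → ℂ := fun h => χ (resultant h g) with hlam
  have hone : lam 1 = 1 := by simp [hlam]
  have hmul : ∀ f h : (ZMod p)[X], f.Monic → h.Monic → lam (f * h) = lam f * lam h := by
    intro f h hf hh
    simp only [hlam]
    rw [hf.natDegree_mul hh, resultant_mul_left _ _ _ _ le_rfl, map_mul]
  have hlin : ∀ x, lam (X - Polynomial.C x) = χ (g.eval x) := by
    intro x
    simp only [hlam]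
    rw [natDegree_X_sub_C, resultant_X_sub_C_left _ _ _ le_rfl]
  have ha1 := sum_monicsOfDegree_one lam
  rw [Finset.sum_congr rfl fun x _ => hlin x] at ha1
  have hfin : (Finset.univ.sum fun x : ZMod p => χ (g.eval x)) = ∑ h ∈ monicsOfDegree (ZMod p) 1, lam h := ha1.symm
  rw [hfin]
  refine norm_coeff_one_le_of_newton (a := fun n => ∑ h ∈ monicsOfDegree (ZMod p) n, lam h)
    (A := C) (Real.sqrt_pos.mpr (by exact_mod_cast hp.pos))
    ((sum_monicsOfDegree_zero lam).trans hone)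
    (fun n hn => sum_resultant_eq_zero hg hQ hroots hcop hne hn)
    (newton_monicsOfDegree hone hmul) ?_
  intro k hk
  have : Fintype (GaloisField p k) := Fintype.ofFinite _
  have hcard : Fintype.card (GaloisField p k) = p ^ k := by
    rw [← Nat.card_eq_fintype_card, GaloisField.card p k hk.ne']
  have hfr : Module.finrank (ZMod p) (GaloisField p k) = k := GaloisField.finrank p hk.ne'
  have h1 := hC k hk (GaloisField p k) hcard
  have h2 : ∑ x : GaloisField p k, χ (Algebra.norm (ZMod p) (aeval x g)) =
      ∑ δ ∈ k.divisors, ∑ P ∈ monicIrreduciblesOfDegree (ZMod p) δ,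
        (δ : ℂ) * lam P ^ (k / δ) := by
    rw [Finset.sum_congr rfl (g := fun x : GaloisField p k =>
      (fun P : (ZMod p)[X] => lam P ^ (k / P.natDegree)) (minpoly (ZMod p) x))]
    · rw [sum_minpoly_eq fun P : (ZMod p)[X] => lam P ^ (k / P.natDegree), hfr]
      refine Finset.sum_congr rfl fun δ _ => Finset.sum_congr rfl fun P hP => ?_
      rw [(mem_monicIrreduciblesOfDegree.mp hP).2.1]
    · intro x _
      rw [norm_aeval_eq_resultant_pow, map_pow, hfr]
  rw [h2] at h1
  refine h1.trans (le_of_eq ?_)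
  rw [Real.sqrt_eq_rpow, Real.sqrt_eq_rpow, ← Real.rpow_natCast, ← Real.rpow_natCast,
    ← Real.rpow_mul (by positivity), ← Real.rpow_mul (by positivity), mul_comm (k : ℝ)]

theorem exists_mulChar_generator (p : ℕ) [Fact p.Prime] :
    ∃ ψ : MulChar (ZMod p) ℂ, ∀ χ : MulChar (ZMod p) ℂ, χ ∈ Subgroup.zpowers ψ := by
  obtain ⟨e⟩ := MulChar.mulEquiv_units (ZMod p) ℂ
  have : IsCyclic (MulChar (ZMod p) ℂ) := isCyclic_of_surjective e.symm e.symm.surjective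
  exact IsCyclic.exists_generator

theorem rootMultiplicity_prod_of_ne_zero {R ι : Type*} [CommRing R] [IsDomain R] (s : Finset ι)
    {f : ι → R[X]} (hf : ∀ i ∈ s, f i ≠ 0) (x : R) :
    (∏ i ∈ s, f i).rootMultiplicity x = ∑ i ∈ s, (f i).rootMultiplicity x := by
  rw [← count_roots, roots_prod _ _ (Finset.prod_ne_zero_iff.mpr hf), Multiset.count_bind]
  simp only [count_roots]
  rfl

/-- The Weil bound for mixed products of multiplicative characters at polynomials. -/
theorem weil_bound {p : ℕ} [Fact p.Prime] {ι : Type*} [Fintype ι] {P : ι → (ZMod p)[X]}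
    (hm : ∀ j, (P j).Monic) (hd : ∀ j, 0 < (P j).natDegree) (hsq : Squarefree (∏ j, P j))
    {χ : ι → MulChar (ZMod p) ℂ} (hχ : ∃ j, χ j ≠ 1) :
    ‖∑ x : ZMod p, ∏ j, χ j ((P j).eval x)‖ ≤ (∏ j, P j).natDegree * Real.sqrt p := by
  have hp := (Fact.out : p.Prime)
  obtain ⟨ψ, hψ⟩ := exists_mulChar_generator p
  have hψp : ψ ^ (p - 1) = 1 := by
    have := MulChar.pow_card_eq_one ψ
    rwa [ZMod.card_units_eq_totient, Nat.totient_prime hp] at this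
  have hp1 : 0 < p - 1 := Nat.sub_pos_of_lt hp.one_lt
  have hexp : ∀ j, ∃ m : ℕ, 0 < m ∧ χ j = ψ ^ m := by
    intro j
    obtain ⟨m, hm⟩ := (mem_powers_iff_mem_zpowers (x := ψ)).mpr (hψ (χ j))
    refine ⟨m + (p - 1), by omega, ?_⟩
    rw [pow_add, hψp, mul_one]
    exact hm.symm
  choose m hmpos hmχ using hexp
  set k := Nat.gcd (p - 1) (Finset.univ.gcd m) with hk
  have hkpos : 0 < k := Nat.gcd_pos_of_pos_left _ hp1
  obtain ⟨d, hdk⟩ : k ∣ p - 1 := Nat.gcd_dvd_left _ _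
  have hkm : ∀ j, k ∣ m j := fun j =>
    (Nat.gcd_dvd_right _ _).trans (Finset.gcd_dvd (Finset.mem_univ j))
  choose n hn using hkm
  have hnpos : ∀ j, 0 < n j := fun j => Nat.pos_of_ne_zero fun h => by
    have := hmpos j
    rw [hn j, h, mul_zero] at this
    exact this.false
  have hχn : ∀ j, χ j = (ψ ^ k) ^ n j := fun j => by rw [hmχ, hn, pow_mul]
  have hψk : ψ ^ k ≠ 1 := by
    intro h
    obtain ⟨j, hj⟩ := hχ
    exact hj (by rw [hχn, h, one_pow])
  set g := ∏ j, P j ^ n j with hg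
  have hgm : g.Monic := monic_prod_of_monic _ _ fun j _ => (hm j).pow _
  set Q := ∏ j, P j with hQ
  have hQm : Q.Monic := monic_prod_of_monic _ _ fun j _ => hm j
  have hsum : ∀ x : ZMod p, ∏ j, χ j ((P j).eval x) = (ψ ^ k) (g.eval x) := by
    intro x
    rw [hg, eval_prod, map_prod]
    refine Finset.prod_congr rfl fun j _ => ?_
    rw [eval_pow, map_pow, hχn, MulChar.pow_apply' _ (hnpos j).ne']
  rw [Finset.sum_congr rfl fun x _ => hsum x]
  have hroots : ∀ β ∈ g.aroots (AlgebraicClosure (ZMod p)), aeval β Q = 0 := by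
    intro β hβ
    rw [mem_aroots, hg, map_prod, Finset.prod_eq_zero_iff] at hβ
    obtain ⟨-, j, -, hj⟩ := hβ
    rw [map_pow] at hj
    rw [hQ, map_prod]
    exact Finset.prod_eq_zero (Finset.mem_univ j) (pow_eq_zero_iff (hnpos j).ne' |>.mp hj)
  refine norm_sum_mulChar_le_of_extension_bound hgm hQm.ne_zero hroots ?_
  refine charSum_extension_bound (by rw [mul_comm]; exact hdk.symm) hψk hgm.ne_zero ?_
  intro t htd ht1
  obtain ⟨j, hj⟩ : ∃ j, ¬ t ∣ n j := by
    by_contra! hall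
    have h1 : k * t ∣ k := Nat.dvd_gcd (hdk ▸ mul_dvd_mul_left k htd)
      (Finset.dvd_gcd fun j _ => (hn j) ▸ mul_dvd_mul_left k (hall j))
    have h2 : k * t ∣ k * 1 := by rwa [mul_one]
    exact ht1 (Nat.dvd_one.mp ((Nat.mul_dvd_mul_iff_left hkpos).mp h2))
  set φ := algebraMap (ZMod p) (AlgebraicClosure (ZMod p)) with hφ
  obtain ⟨α, hα⟩ := IsAlgClosed.exists_root ((P j).map φ) (by
    rw [degree_map]
    exact (natDegree_pos_iff_degree_pos.mp (hd j)).ne')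
  refine ⟨α, ?_⟩
  have hne : ∀ i, (P i).map φ ≠ 0 := fun i => ((hm i).map φ).ne_zero
  have hcountQ : ∑ i, ((P i).map φ).roots.count α ≤ 1 := by
    have hsep : (Q.map φ).Separable := (PerfectField.separable_iff_squarefree.mpr hsq).map
    have h1 := Multiset.nodup_iff_count_le_one.mp (nodup_roots hsep) α
    rw [hQ, Polynomial.map_prod, count_roots,
      rootMultiplicity_prod_of_ne_zero _ fun i _ => hne i] at h1
    simpa only [count_roots] using h1
  have hcountg : (g.map φ).rootMultiplicity α = ∑ i, n i * ((P i).map φ).roots.count α := by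
    rw [hg, Polynomial.map_prod, rootMultiplicity_prod_of_ne_zero _ fun i _ => by
      rw [Polynomial.map_pow]; exact pow_ne_zero _ (hne i)]
    refine Finset.sum_congr rfl fun i _ => ?_
    rw [Polynomial.map_pow, rootMultiplicity_pow' (hne i), count_roots]
  have hcj : 1 ≤ ((P j).map φ).roots.count α :=
    Multiset.one_le_count_iff_mem.mpr ((mem_roots (hne j)).mpr hα)
  rw [← Finset.add_sum_erase _ _ (Finset.mem_univ j)] at hcountQ hcountg
  have hrest : ∀ i ∈ Finset.univ.erase j, ((P i).map φ).roots.count α = 0 := by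
    have : ∑ i ∈ Finset.univ.erase j, ((P i).map φ).roots.count α = 0 := by omega
    exact Finset.sum_eq_zero_iff.mp this
  rw [hcountg, Finset.sum_eq_zero fun i hi => by rw [hrest i hi, mul_zero], add_zero,
    show ((P j).map φ).roots.count α = 1 by omega, mul_one]
  exact hj

/-- Equivalence of integer matrices under unimodular row and column operations. -/
def UnimodEquiv {a b : ℕ} (A B : Matrix (Fin a) (Fin b) ℤ) : Prop :=
  ∃ (P : Matrix (Fin a) (Fin a) ℤ) (Q : Matrix (Fin b) (Fin b) ℤ),
    IsUnit P.det ∧ IsUnit Q.det ∧ P * A * Q = B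

namespace UnimodEquiv

variable {a b : ℕ} {A B D : Matrix (Fin a) (Fin b) ℤ}

theorem refl (A : Matrix (Fin a) (Fin b) ℤ) : UnimodEquiv A A :=
  ⟨1, 1, by simp, by simp, by simp⟩

theorem trans (h : UnimodEquiv A B) (h' : UnimodEquiv B D) : UnimodEquiv A D := by
  obtain ⟨P, Q, hP, hQ, rfl⟩ := h
  obtain ⟨P', Q', hP', hQ', rfl⟩ := h'
  exact ⟨P' * P, Q * Q', by rw [Matrix.det_mul]; exact hP'.mul hP,
    by rw [Matrix.det_mul]; exact hQ.mul hQ', by simp only [Matrix.mul_assoc]⟩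

theorem transpose (h : UnimodEquiv A B) : UnimodEquiv A.transpose B.transpose := by
  obtain ⟨P, Q, hP, hQ, rfl⟩ := h
  exact ⟨Q.transpose, P.transpose, by simpa, by simpa,
    by simp only [Matrix.transpose_mul, Matrix.mul_assoc]⟩

theorem mul_left (A : Matrix (Fin a) (Fin b) ℤ) {P : Matrix (Fin a) (Fin a) ℤ}
    (hP : IsUnit P.det) : UnimodEquiv A (P * A) :=
  ⟨P, 1, hP, by simp, by simp⟩

theorem mul_right (A : Matrix (Fin a) (Fin b) ℤ) {Q : Matrix (Fin b) (Fin b) ℤ}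
    (hQ : IsUnit Q.det) : UnimodEquiv A (A * Q) :=
  ⟨1, Q, by simp, hQ, by simp⟩

theorem submatrix_row (A : Matrix (Fin a) (Fin b) ℤ) (σ : Equiv.Perm (Fin a)) :
    UnimodEquiv A (A.submatrix σ id) := by
  have h : A.submatrix σ id = (1 : Matrix (Fin a) (Fin a) ℤ).submatrix σ id * A := by
    ext i j
    simp [Matrix.mul_apply, Matrix.one_apply]
  rw [h]
  apply mul_left
  rw [Matrix.det_permute]
  simp

theorem submatrix_col (A : Matrix (Fin a) (Fin b) ℤ) (σ : Equiv.Perm (Fin b)) :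
    UnimodEquiv A (A.submatrix id σ) := by
  simpa using (submatrix_row A.transpose σ).transpose

theorem dvd_zero_row_of_minimal {a b : ℕ} {A : Matrix (Fin (a + 1)) (Fin (b + 1)) ℤ}
    (h0 : A 0 0 ≠ 0) (hmin : ∀ B, UnimodEquiv A B → B 0 0 ≠ 0 → (A 0 0).natAbs ≤ (B 0 0).natAbs)
    (j : Fin (b + 1)) : A 0 0 ∣ A 0 j := by
  by_cases hj : j = 0
  · rw [hj]
  by_contra hdvd
  set B := A * Matrix.transvection 0 j (-(A 0 j / A 0 0)) with hB
  have hAB : UnimodEquiv A B := mul_right _ (by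
    rw [Matrix.det_transvection_of_ne _ _ (Ne.symm hj)]; exact isUnit_one)
  have hAB' := hAB.trans (submatrix_col B (Equiv.swap 0 j))
  have hB0 : (B.submatrix id (Equiv.swap 0 j)) 0 0 = A 0 j % A 0 0 := by
    simp only [Matrix.submatrix_apply, id, Equiv.swap_apply_left, hB,
      Matrix.mul_transvection_apply_same]
    rw [Int.emod_def]; ring
  have hne : A 0 j % A 0 0 ≠ 0 := fun h => hdvd (Int.dvd_of_emod_eq_zero h)
  have := hmin _ hAB' (by rwa [hB0])
  rw [hB0] at this
  have h1 := Int.emod_nonneg (A 0 j) h0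
  have h2 := Int.emod_lt_abs (A 0 j) h0
  rw [Int.abs_eq_natAbs] at h2
  omega

theorem dvd_of_minimal {a b : ℕ} {A : Matrix (Fin (a + 1)) (Fin (b + 1)) ℤ}
    (h0 : A 0 0 ≠ 0) (hmin : ∀ B, UnimodEquiv A B → B 0 0 ≠ 0 → (A 0 0).natAbs ≤ (B 0 0).natAbs)
    (i : Fin (a + 1)) (j : Fin (b + 1)) : A 0 0 ∣ A i j := by
  by_cases hi : i = 0
  · rw [hi]; exact dvd_zero_row_of_minimal h0 hmin j
  have hcol : A 0 0 ∣ A i 0 := by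
    have := dvd_zero_row_of_minimal (A := A.transpose) (by simpa using h0) (fun B hB hB0 => by
      have h := hmin B.transpose (by simpa using hB.transpose) (by simpa using hB0)
      simpa using h) i
    simpa using this
  obtain ⟨c, hc⟩ := hcol
  set B := Matrix.transvection i 0 (-c) * A with hB
  have hAB : UnimodEquiv A B := mul_left _ (by
    rw [Matrix.det_transvection_of_ne _ _ hi]; exact isUnit_one)
  set B' := Matrix.transvection 0 i (1 : ℤ) * B with hB'
  have hAB' : UnimodEquiv A B' := hAB.trans (mul_left _ (by
    rw [Matrix.det_transvection_of_ne _ _ (Ne.symm hi)]; exact isUnit_one))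
  have hB0 : ∀ k, B 0 k = A 0 k := fun k => by
    rw [hB, Matrix.transvection_mul_apply_of_ne _ _ _ _ (Ne.symm hi)]
  have hBi : ∀ k, B i k = A i k - c * A 0 k := fun k => by
    rw [hB, Matrix.transvection_mul_apply_same]; ring
  have hB'0 : ∀ k, B' 0 k = A 0 k + (A i k - c * A 0 k) := fun k => by
    rw [hB', Matrix.transvection_mul_apply_same, hB0, hBi]; ring
  have h00 : B' 0 0 = A 0 0 := by rw [hB'0, hc]; ring
  have h1 := dvd_zero_row_of_minimal (A := B') (by rwa [h00]) (fun E hE hE0 => by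
    rw [h00]; exact hmin E (hAB'.trans hE) hE0) j
  rw [h00, hB'0] at h1
  have h2 := dvd_zero_row_of_minimal h0 hmin j
  have : A i j = (A 0 j + (A i j - c * A 0 j)) - A 0 j + c * A 0 j := by ring
  rw [this]
  exact dvd_add (dvd_sub h1 h2) (h2.mul_left c)

theorem exists_forall_dvd {a b : ℕ} (A : Matrix (Fin (a + 1)) (Fin (b + 1)) ℤ) :
    ∃ B, UnimodEquiv A B ∧ ∀ i j, B 0 0 ∣ B i j := by
  by_cases hA : A = 0
  · exact ⟨A, refl A, by simp [hA]⟩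
  obtain ⟨i, j, hij⟩ : ∃ i j, A i j ≠ 0 := by
    by_contra! h
    exact hA (by ext i j; exact h i j)
  have hex : ∃ n : ℕ, ∃ B, UnimodEquiv A B ∧ B 0 0 ≠ 0 ∧ (B 0 0).natAbs = n :=
    ⟨_, (A.submatrix (Equiv.swap 0 i) id).submatrix id (Equiv.swap 0 j),
      (submatrix_row A _).trans (submatrix_col _ _), by simpa using hij, rfl⟩
  obtain ⟨B, hAB, hB0, hBn⟩ := Nat.find_spec hex
  refine ⟨B, hAB, dvd_of_minimal hB0 fun E hE hE0 => ?_⟩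
  rw [hBn]
  exact Nat.find_min' hex ⟨E, hAB.trans hE, hE0, rfl⟩

theorem exists_clear_column {a b : ℕ} {A : Matrix (Fin (a + 1)) (Fin (b + 1)) ℤ}
    (hA : ∀ i j, A 0 0 ∣ A i j) :
    ∃ B, UnimodEquiv A B ∧ (∀ j, B 0 j = A 0 j) ∧ (∀ i j, B 0 0 ∣ B i j) ∧
      ∀ i, i ≠ 0 → ∃ c, ∀ j, B i j = A i j - c * A 0 j ∧ B i 0 = 0 := by
  choose c hc using fun i => hA i 0
  set P : Matrix (Fin (a + 1)) (Fin (a + 1)) ℤ :=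
    fun i k => if i = k then 1 else if k = 0 then -c i else 0 with hP
  have hdet : P.det = 1 := by
    rw [Matrix.det_of_isLowerTriangular]
    · simp [hP]
    · intro i k hik
      have hik' : i < k := hik
      have : k ≠ 0 := by rintro rfl; simp at hik'
      simp [hP, hik'.ne, this]
  have h0 : ∀ j, (P * A) 0 j = A 0 j := fun j => by
    rw [Matrix.mul_apply, Fin.sum_univ_succ]
    simp [hP, Fin.succ_ne_zero, (Fin.succ_ne_zero _).symm]
  have hi : ∀ i, i ≠ 0 → ∀ j, (P * A) i j = A i j - c i * A 0 j := fun i hi j => by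
    rw [Matrix.mul_apply, Fin.sum_univ_succ]
    obtain ⟨i', rfl⟩ := Fin.exists_succ_eq.2 hi
    simp [hP, Fin.succ_ne_zero]
    ring
  refine ⟨P * A, mul_left _ (by rw [hdet]; exact isUnit_one), h0, fun i j => ?_, fun i hne =>
    ⟨c i, fun j => ⟨hi i hne j, ?_⟩⟩⟩
  · rw [h0]
    by_cases hne : i = 0
    · rw [hne, h0]; exact hA 0 j
    · rw [hi i hne]
      exact dvd_sub (hA i j) ((hA 0 j).mul_left _)
  · rw [hi i hne, hc i]; ring

theorem exists_clear {a b : ℕ} (A : Matrix (Fin (a + 1)) (Fin (b + 1)) ℤ) :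
    ∃ B, UnimodEquiv A B ∧ (∀ i j, B 0 0 ∣ B i j) ∧ (∀ i, i ≠ 0 → B i 0 = 0) ∧
      ∀ j, j ≠ 0 → B 0 j = 0 := by
  obtain ⟨B, hAB, hB⟩ := exists_forall_dvd A
  obtain ⟨E, hBE, -, hE, hEc⟩ := exists_clear_column hB
  have hE0 : ∀ i, i ≠ 0 → E i 0 = 0 := fun i hi => by
    obtain ⟨c, hc⟩ := hEc i hi
    exact (hc 0).2
  obtain ⟨H, hEH, hH0, hH, hHc⟩ := exists_clear_column (A := E.transpose)
    (fun i j => by simpa using hE j i)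
  refine ⟨H.transpose, (hAB.trans hBE).trans (by simpa using hEH.transpose), fun i j => hH j i,
    fun i hi => ?_, fun j hj => ?_⟩
  · rw [Matrix.transpose_apply, hH0, Matrix.transpose_apply, hE0 i hi]
  · obtain ⟨c, hc⟩ := hHc j hj
    exact (hc 0).2

end UnimodEquiv

/-- The block matrix with diagonal blocks `d` and `A`. -/
def consBlock {a b : ℕ} (d : ℤ) (A : Matrix (Fin a) (Fin b) ℤ) :
    Matrix (Fin (a + 1)) (Fin (b + 1)) ℤ :=
  fun i j => Fin.cases (Fin.cases d (fun _ => 0) j) (fun i' => Fin.cases 0 (fun j' => A i' j') j) i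

section consBlock

variable {a b c : ℕ} (d e : ℤ) (A : Matrix (Fin a) (Fin b) ℤ)

@[simp] theorem consBlock_zero_zero : consBlock d A 0 0 = d := rfl
@[simp] theorem consBlock_zero_succ (j : Fin b) : consBlock d A 0 j.succ = 0 := rfl
@[simp] theorem consBlock_succ_zero (i : Fin a) : consBlock d A i.succ 0 = 0 := rfl
@[simp] theorem consBlock_succ_succ (i : Fin a) (j : Fin b) :
    consBlock d A i.succ j.succ = A i j := rfl

theorem consBlock_mul (B : Matrix (Fin b) (Fin c) ℤ) :
    consBlock d A * consBlock e B = consBlock (d * e) (A * B) := by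
  ext i j
  refine Fin.cases ?_ (fun i => ?_) i <;> refine Fin.cases ?_ (fun j => ?_) j <;>
    simp [Matrix.mul_apply, Fin.sum_univ_succ]

theorem det_consBlock (A : Matrix (Fin a) (Fin a) ℤ) : (consBlock d A).det = d * A.det := by
  rw [Matrix.det_succ_column_zero, Fin.sum_univ_succ]
  have : (consBlock d A).submatrix Fin.succ Fin.succ = A := by ext; simp
  simp [this]

end consBlock

/-- Smith normal form over `ℤ`, with the divisibility chain. -/
theorem exists_smith_form : ∀ {a b : ℕ} (A : Matrix (Fin a) (Fin b) ℤ),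
    ∃ B, UnimodEquiv A B ∧ (∀ (s : Fin a) (t : Fin b), (s : ℕ) ≠ t → B s t = 0) ∧
      ∀ (s s' : Fin a) (t t' : Fin b), (s : ℕ) = t → (s' : ℕ) = t' → (s : ℕ) ≤ s' →
        B s t ∣ B s' t'
  | 0, _, A => ⟨A, .refl A, fun s => s.elim0, fun s => s.elim0⟩
  | _ + 1, 0, A => ⟨A, .refl A, fun _ t => t.elim0, fun _ _ t => t.elim0⟩
  | a + 1, b + 1, A => by
    obtain ⟨E, hAE, hdvd, hcol, hrow⟩ := UnimodEquiv.exists_clear A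
    set E' : Matrix (Fin a) (Fin b) ℤ := E.submatrix Fin.succ Fin.succ with hE'
    have hEE' : E = consBlock (E 0 0) E' := by
      ext i j
      refine Fin.cases ?_ (fun i => ?_) i <;> refine Fin.cases ?_ (fun j => ?_) j
      · simp
      · simpa using hrow _ (Fin.succ_ne_zero j)
      · simpa using hcol _ (Fin.succ_ne_zero i)
      · simp [hE']
    obtain ⟨B, ⟨P, Q, hP, hQ, hPQ⟩, hoff, hchain⟩ := exists_smith_form E'
    have hBdvd : ∀ i j, E 0 0 ∣ B i j := fun i j => by
      rw [← hPQ, Matrix.mul_apply]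
      refine Finset.dvd_sum fun k _ => Dvd.dvd.mul_right ?_ _
      rw [Matrix.mul_apply]
      exact Finset.dvd_sum fun l _ => Dvd.dvd.mul_left (hdvd _ _) _
    refine ⟨consBlock (E 0 0) B, hAE.trans ⟨consBlock 1 P, consBlock 1 Q, by simpa [det_consBlock],
      by simpa [det_consBlock], ?_⟩, fun s t => ?_, fun s s' t t' => ?_⟩
    · rw [hEE', consBlock_mul, consBlock_mul, hPQ]; simp
    · refine Fin.cases ?_ (fun s => ?_) s <;> refine Fin.cases ?_ (fun t => ?_) t
      · simp
      · simp
      · simp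
      · simpa using hoff s t
    · refine Fin.cases ?_ (fun s => ?_) s <;> refine Fin.cases ?_ (fun t => ?_) t
      · intro _ _ _
        refine Fin.cases ?_ (fun s' => ?_) s' <;> refine Fin.cases ?_ (fun t' => ?_) t'
        · simp
        · simp
        · simp
        · simpa using hBdvd s' t'
      · simp
      · simp
      · refine Fin.cases ?_ (fun s' => ?_) s' <;> refine Fin.cases ?_ (fun t' => ?_) t'
        · simp
        · simp
        · simp
        · simpa using hchain s s' t t'

/-- The monomial map attached to an integer matrix. -/
def monomialMap {A : Type*} [CommGroup A] {a b : ℕ} (M : Matrix (Fin a) (Fin b) ℤ) (x : Fin b → A) :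
    Fin a → A := fun s => ∏ i, x i ^ M s i

section monomialMap

variable {A : Type*} [CommGroup A] {a b c : ℕ}

theorem monomialMap_mul (M : Matrix (Fin a) (Fin b) ℤ) (N : Matrix (Fin b) (Fin c) ℤ)
    (x : Fin c → A) : monomialMap (M * N) x = monomialMap M (monomialMap N x) := by
  funext s
  simp only [monomialMap, Matrix.mul_apply, ← Finset.prod_zpow, ← zpow_mul]
  rw [Finset.prod_comm]
  refine Finset.prod_congr rfl fun i _ => ?_
  have h : ∀ t : Finset (Fin b), x i ^ ∑ j ∈ t, M s j * N j i = ∏ j ∈ t, x i ^ (N j i * M s j) :=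
    fun t => by
      induction t using Finset.induction_on with
      | empty => simp
      | insert j t hj ih => rw [Finset.prod_insert hj, Finset.sum_insert hj, zpow_add, ih,
          mul_comm (N j i)]
  exact h _

theorem monomialMap_one (x : Fin a → A) : monomialMap 1 x = x := by
  funext s
  simp [monomialMap, Matrix.one_apply]

theorem monomialMap_one_right (M : Matrix (Fin a) (Fin b) ℤ) :
    monomialMap M (1 : Fin b → A) = 1 := by
  funext s
  simp [monomialMap]

theorem monomialMap_injective {Q : Matrix (Fin a) (Fin a) ℤ} (hQ : IsUnit Q.det) :
    Function.Injective (monomialMap (A := A) Q) := by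
  intro x y h
  have := congrArg (monomialMap Q⁻¹) h
  rwa [← monomialMap_mul, ← monomialMap_mul, Matrix.nonsing_inv_mul _ hQ, monomialMap_one,
    monomialMap_one] at this

/-- In Smith coordinates the kernel of a monomial map is a product of torsion subgroups. -/
theorem zpow_eq_one_of_monomialMap_eq_one {μ : Matrix (Fin a) (Fin b) ℤ}
    {P : Matrix (Fin a) (Fin a) ℤ} {Q : Matrix (Fin b) (Fin b) ℤ} (hQ : IsUnit Q.det)
    {d : Fin b → ℤ} (hd : ∀ t, ∃ s, ∀ t', (P * μ * Q) s t' = if t' = t then d t else 0)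
    {x : Fin b → A} (hx : monomialMap μ x = 1) (t : Fin b) :
    monomialMap Q⁻¹ x t ^ d t = 1 := by
  have h : monomialMap (P * μ * Q) (monomialMap Q⁻¹ x) = 1 := by
    rw [← monomialMap_mul, Matrix.mul_assoc, Matrix.mul_nonsing_inv _ hQ, Matrix.mul_one,
      monomialMap_mul, hx, monomialMap_one_right]
  obtain ⟨s, hs⟩ := hd t
  have := congrFun h s
  rw [monomialMap] at this
  simpa [hs, apply_ite (fun n : ℤ => monomialMap Q⁻¹ x _ ^ n)] using this

theorem natAbs_pow_eq_one_of_zpow {x : A} {n : ℤ} (h : x ^ n = 1) : x ^ n.natAbs = 1 := by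
  rcases Int.natAbs_eq n with hn | hn
  · rw [hn, zpow_natCast] at h; exact h
  · rw [hn, zpow_neg, zpow_natCast, inv_eq_one] at h; exact h

theorem card_monomialMap_eq_one_le [Finite A] [IsCyclic A] {μ : Matrix (Fin a) (Fin b) ℤ}
    {P : Matrix (Fin a) (Fin a) ℤ} {Q : Matrix (Fin b) (Fin b) ℤ} (hQ : IsUnit Q.det)
    {d : Fin b → ℤ} (hd0 : ∀ t, d t ≠ 0)
    (hd : ∀ t, ∃ s, ∀ t', (P * μ * Q) s t' = if t' = t then d t else 0) :
    Nat.card {x : Fin b → A // monomialMap μ x = 1} ≤ ∏ t, (d t).natAbs := by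
  have : Fintype A := Fintype.ofFinite A
  have hQ' : IsUnit (Q⁻¹).det := Matrix.isUnit_nonsing_inv_det Q hQ
  let f : {x : Fin b → A // monomialMap μ x = 1} →
      ∀ t : Fin b, {y : A // y ^ (d t).natAbs = 1} := fun x t =>
    ⟨monomialMap Q⁻¹ x.1 t, natAbs_pow_eq_one_of_zpow
      (zpow_eq_one_of_monomialMap_eq_one hQ hd x.2 t)⟩
  have hf : Function.Injective f := fun x y h => Subtype.ext (monomialMap_injective hQ'
    (funext fun t => congrArg Subtype.val (congrFun h t)))
  refine (Nat.card_le_card_of_injective f hf).trans ?_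
  rw [Nat.card_pi]
  refine Finset.prod_le_prod' fun t _ => ?_
  rw [Nat.card_eq_fintype_card, Fintype.card_subtype]
  exact IsCyclic.card_pow_eq_one_le (Int.natAbs_pos.2 (hd0 t))

theorem eq_one_of_monomialMap_eq_one [Finite A] {μ : Matrix (Fin a) (Fin b) ℤ}
    {P : Matrix (Fin a) (Fin a) ℤ} {Q : Matrix (Fin b) (Fin b) ℤ} (hQ : IsUnit Q.det)
    {d : Fin b → ℤ} (hcop : ∀ t, (Nat.card A).Coprime (d t).natAbs)
    (hd : ∀ t, ∃ s, ∀ t', (P * μ * Q) s t' = if t' = t then d t else 0)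
    {x : Fin b → A} (hx : monomialMap μ x = 1) : x = 1 := by
  refine monomialMap_injective (Matrix.isUnit_nonsing_inv_det Q hQ) ?_
  rw [monomialMap_one_right]
  funext t
  have h := natAbs_pow_eq_one_of_zpow (zpow_eq_one_of_monomialMap_eq_one hQ hd hx t)
  have h1 := orderOf_dvd_of_pow_eq_one h
  have h2 := orderOf_dvd_natCard (monomialMap Q⁻¹ x t)
  exact orderOf_eq_one_iff.1 (Nat.eq_one_of_dvd_coprimes (hcop t) h2 h1)

end monomialMap

/-- A factorization of a family of integer polynomials into pairwise non-associated irreducibles of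
positive degree. -/
structure FactorData {m : ℕ} (F : Fin m → ℤ[X]) where
  M : ℕ
  P : Fin M → ℤ[X]
  c : Fin m → ℤ
  μ : Fin M → Fin m → ℕ
  irreducible : ∀ s, Irreducible (P s)
  natDegree_pos : ∀ s, 0 < (P s).natDegree
  not_associated : ∀ s s', s ≠ s' → ¬ Associated (P s) (P s')
  c_ne_zero : ∀ i, c i ≠ 0
  eq_prod : ∀ i, F i = Polynomial.C (c i) * ∏ s, P s ^ μ s i
  used : ∀ s, ∃ i, 0 < μ s i

theorem exists_eq_C_mul_prod {f : ℤ[X]} (hf : f ≠ 0) {S : Finset ℤ[X]}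
    (hS : ∀ p ∈ UniqueFactorizationMonoid.normalizedFactors f, 0 < p.natDegree → p ∈ S) :
    ∃ c : ℤ, c ≠ 0 ∧ f = Polynomial.C c *
      ∏ p ∈ S with 0 < p.natDegree, p ^ (UniqueFactorizationMonoid.normalizedFactors f).count p := by
  set m := UniqueFactorizationMonoid.normalizedFactors f with hm
  obtain ⟨u, hu⟩ := UniqueFactorizationMonoid.prod_normalizedFactors hf
  obtain ⟨v, hv, hv'⟩ := Polynomial.isUnit_iff.1 u.isUnit
  have hprod : m.prod = ∏ p ∈ S ∪ m.toFinset, p ^ m.count p :=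
    Finset.prod_multiset_count_of_subset _ _ Finset.subset_union_right
  have hsplit := Finset.prod_filter_mul_prod_filter_not (S ∪ m.toFinset)
    (fun p => 0 < p.natDegree) (fun p => p ^ m.count p)
  have hset : (S ∪ m.toFinset).filter (fun p => 0 < p.natDegree) =
      S.filter (fun p => 0 < p.natDegree) := by
    ext p
    simp only [Finset.mem_filter, Finset.mem_union, Multiset.mem_toFinset]
    constructor
    · rintro ⟨h | h, h'⟩
      · exact ⟨h, h'⟩
      · exact ⟨hS p h h', h'⟩
    · rintro ⟨h, h'⟩
      exact ⟨Or.inl h, h'⟩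
  have hconst : ∏ p ∈ (S ∪ m.toFinset).filter (fun p => ¬ 0 < p.natDegree), p ^ m.count p =
      Polynomial.C (∏ p ∈ (S ∪ m.toFinset).filter (fun p => ¬ 0 < p.natDegree),
        p.coeff 0 ^ m.count p) := by
    rw [map_prod]
    refine Finset.prod_congr rfl fun p hp => ?_
    rw [Polynomial.C_pow, ← Polynomial.eq_C_of_natDegree_eq_zero]
    have := (Finset.mem_filter.1 hp).2
    omega
  have key : f = Polynomial.C ((∏ p ∈ (S ∪ m.toFinset).filter (fun p => ¬ 0 < p.natDegree),
        p.coeff 0 ^ m.count p) * v) * ∏ p ∈ S with 0 < p.natDegree, p ^ m.count p := by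
    rw [← hu, ← hv', hprod, ← hsplit, hset, hconst, Polynomial.C_mul]
    ring
  refine ⟨_, fun h0 => hf ?_, key⟩
  rw [key, h0]; simp

theorem nonempty_factorData {m : ℕ} {F : Fin m → ℤ[X]} (hF : ∀ i, F i ≠ 0) :
    Nonempty (FactorData F) := by
  set S : Finset ℤ[X] := (Finset.univ.biUnion fun i =>
    (UniqueFactorizationMonoid.normalizedFactors (F i)).toFinset).filter
      (fun p => 0 < p.natDegree) with hS
  have hmem : ∀ p ∈ S, 0 < p.natDegree ∧
      ∃ i, p ∈ UniqueFactorizationMonoid.normalizedFactors (F i) := fun p hp => by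
    simp only [hS, Finset.mem_filter, Finset.mem_biUnion, Finset.mem_univ, true_and,
      Multiset.mem_toFinset] at hp
    exact hp.symm
  choose c hc0 hc using fun i => exists_eq_C_mul_prod (hF i) (S := S) fun p hp hpd => by
    simp only [hS, Finset.mem_filter, Finset.mem_biUnion, Finset.mem_univ, true_and,
      Multiset.mem_toFinset]
    exact ⟨⟨i, hp⟩, hpd⟩
  have hSS : S.filter (fun p => 0 < p.natDegree) = S :=
    Finset.filter_true_of_mem fun p hp => (hmem p hp).1
  let e := S.equivFin.symm
  refine ⟨⟨S.card, fun s => e s, c,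
    fun s i => (UniqueFactorizationMonoid.normalizedFactors (F i)).count (e s : ℤ[X]),
    fun s => ?_, fun s => (hmem _ (e s).2).1, fun s s' hss h => hss ?_, hc0, fun i => ?_, fun s => ?_⟩⟩
  · obtain ⟨i, hi⟩ := (hmem _ (e s).2).2
    exact UniqueFactorizationMonoid.irreducible_of_normalized_factor _ hi
  · obtain ⟨i, hi⟩ := (hmem _ (e s).2).2
    obtain ⟨i', hi'⟩ := (hmem _ (e s').2).2
    exact e.injective (Subtype.ext (h.eq_of_normalized
      (UniqueFactorizationMonoid.normalize_normalized_factor _ hi)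
      (UniqueFactorizationMonoid.normalize_normalized_factor _ hi')))
  · rw [hSS] at hc
    rw [e.prod_comp (fun p : S => (p : ℤ[X]) ^
      (UniqueFactorizationMonoid.normalizedFactors (F i)).count (p : ℤ[X])),
      Finset.prod_coe_sort S (fun p : ℤ[X] => p ^
      (UniqueFactorizationMonoid.normalizedFactors (F i)).count p)]
    exact hc i
  · obtain ⟨i, hi⟩ := (hmem _ (e s).2).2
    exact ⟨i, Multiset.count_pos.2 hi⟩

/-- The exponent matrix of a factorization. -/
def FactorData.expMatrix {m : ℕ} {F : Fin m → ℤ[X]} (D : FactorData F) :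
    Matrix (Fin D.M) (Fin m) ℤ := Matrix.of fun u v => (D.μ u v : ℤ)

theorem FactorData.eq_zero_of_mulVec {m : ℕ} {F : Fin m → ℤ[X]} (D : FactorData F)
    (hF : MultIndep F) {e : Fin m → ℤ} (he : D.expMatrix.mulVec e = 0) : e = 0 := by
  by_contra hne
  refine hF ⟨e, hne, ∏ i, (D.c i : ℚ) ^ e i, ?_⟩
  set φ : ℤ[X] →+* RatFunc ℚ := (algebraMap ℚ[X] (RatFunc ℚ)).comp
    (Polynomial.mapRingHom (Int.castRingHom ℚ)) with hφ
  have hinj : Function.Injective φ := (IsFractionRing.injective ℚ[X] (RatFunc ℚ)).comp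
    (Polynomial.map_injective _ Int.cast_injective)
  have hφF : ∀ i, algebraMap ℚ[X] (RatFunc ℚ) ((F i).map (Int.castRingHom ℚ)) =
      algebraMap ℚ (RatFunc ℚ) (D.c i) * ∏ s, φ (D.P s) ^ D.μ s i := fun i => by
    change φ (F i) = _
    conv_lhs => rw [D.eq_prod i]
    rw [map_mul, map_prod]
    congr 1
    · simp [hφ]
    · simp
  have h1 : ∀ s, ∏ i, (φ (D.P s) ^ D.μ s i) ^ e i = 1 := fun s => by
    have hs : φ (D.P s) ≠ 0 := by
      rw [Ne, map_eq_zero_iff φ hinj]; exact (D.irreducible s).ne_zero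
    have h0 := congrFun he s
    simp only [Matrix.mulVec, dotProduct, FactorData.expMatrix, Matrix.of_apply] at h0
    simp only [← zpow_natCast, ← zpow_mul]
    have : ∀ t : Finset (Fin m), ∏ i ∈ t, φ (D.P s) ^ ((D.μ s i : ℤ) * e i) =
        φ (D.P s) ^ (∑ i ∈ t, (D.μ s i : ℤ) * e i) := fun t => by
      induction t using Finset.induction_on with
      | empty => simp
      | insert a t ha ih => rw [Finset.prod_insert ha, Finset.sum_insert ha, zpow_add₀ hs, ih]
    rw [this, h0]; simp
  simp only [hφF, mul_zpow, Finset.prod_mul_distrib, map_prod, map_zpow₀, ← Finset.prod_zpow]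
  rw [Finset.prod_comm, Finset.prod_congr rfl (fun s _ => h1 s)]
  simp

/-- For multiplicatively independent polynomials, only boundedly many tuples in a cyclic group are
killed by the exponent matrix, and only the trivial one if the group order is prime to the last
invariant factor. -/
theorem FactorData.exists_invariantFactor_bound {m : ℕ} (hm : 1 ≤ m) {F : Fin m → ℤ[X]}
    (D : FactorData F) (hF : MultIndep F) :
    ∃ (β : ℤ) (B : ℕ), IsLastInvFactor F β ∧
      ∀ (A : Type) [CommGroup A] [Finite A] [IsCyclic A],
        Nat.card {x : Fin m → A // monomialMap D.expMatrix x = 1} ≤ B ∧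
        ((Nat.card A).Coprime β.natAbs → ∀ x : Fin m → A, monomialMap D.expMatrix x = 1 → x = 1) := by
  obtain ⟨E, ⟨P, Q, hP, hQ, rfl⟩, hoff, hchain⟩ := exists_smith_form D.expMatrix
  set E := P * D.expMatrix * Q with hE
  have hcol : ∀ t : Fin m, ∃ s, E s t ≠ 0 := fun t => by
    by_contra! h
    have hEt : E.mulVec (Pi.single t 1) = 0 := by
      rw [Matrix.mulVec_single_one]; funext s; exact h s
    have h1 : D.expMatrix.mulVec (Q.mulVec (Pi.single t 1)) = 0 := by
      have h2 : P⁻¹.mulVec (E.mulVec (Pi.single t 1)) =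
          D.expMatrix.mulVec (Q.mulVec (Pi.single t 1)) := by
        rw [hE, Matrix.mulVec_mulVec, Matrix.mulVec_mulVec, Matrix.mul_assoc P,
          ← Matrix.mul_assoc, Matrix.nonsing_inv_mul _ hP, Matrix.one_mul]
      rw [← h2, hEt, Matrix.mulVec_zero]
    have h3 := D.eq_zero_of_mulVec hF h1
    have h4 : (Pi.single t 1 : Fin m → ℤ) = 0 := by
      have := congrArg Q⁻¹.mulVec h3
      rwa [Matrix.mulVec_mulVec, Matrix.nonsing_inv_mul _ hQ, Matrix.one_mulVec,
        Matrix.mulVec_zero] at this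
    simpa using congrFun h4 t
  choose r hr using hcol
  have hrt : ∀ t, (r t : ℕ) = t := fun t => by
    by_contra h
    exact hr t (hoff _ _ h)
  have hmM : m ≤ D.M := by
    have h1 := hrt ⟨m - 1, by omega⟩
    have h2 := (r ⟨m - 1, by omega⟩).2
    simp only at h1
    omega
  set last : Fin m := ⟨m - 1, by omega⟩ with hlast
  have hd : ∀ t, ∃ s, ∀ t', E s t' = if t' = t then E (r t) t else 0 := fun t =>
    ⟨r t, fun t' => by
      split_ifs with h
      · rw [h]
      · exact hoff _ _ fun h' => h (Fin.ext (by rw [← h', hrt]))⟩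
  have hdvd : ∀ t, E (r t) t ∣ E (r last) last := fun t =>
    hchain _ _ _ _ (hrt t) (hrt last) (by
      rw [hrt, hrt]
      have := t.2
      simp only [hlast]
      omega)
  refine ⟨E (r last) last, ∏ t, (E (r t) t).natAbs, ⟨D.M, D.P, D.c, D.μ, D.irreducible,
    fun s => (D.irreducible s).isPrimitive (D.natDegree_pos s).ne', D.not_associated,
    D.eq_prod, D.used, P, Q, hP, hQ, hoff, fun s s' t t' h h' h'' => hchain _ _ _ _ h h' (by omega),
    fun s t h h' => ?_⟩, fun A _ _ _ => ⟨card_monomialMap_eq_one_le hQ hr hd, fun hcop x hx =>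
      eq_one_of_monomialMap_eq_one hQ (fun t => hcop.coprime_dvd_right ?_) hd hx⟩⟩
  · rw [min_eq_right hmM] at h'
    have ht : t = last := Fin.ext (by simp only [hlast]; omega)
    have hs : s = r last := Fin.ext (by rw [hrt, h, ht])
    rw [ht, hs]; rfl
  · exact Int.natAbs_dvd_natAbs.2 (hdvd t)

theorem FactorData.separable_map_rat {m : ℕ} {F : Fin m → ℤ[X]} (D : FactorData F) :
    ((∏ s, D.P s).map (Int.castRingHom ℚ)).Separable := by
  have hprim : ∀ s, (D.P s).IsPrimitive := fun s =>
    (D.irreducible s).isPrimitive (D.natDegree_pos s).ne'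
  have hirr : ∀ s, Irreducible ((D.P s).map (Int.castRingHom ℚ)) := fun s =>
    (Polynomial.IsPrimitive.Int.irreducible_iff_irreducible_map_cast (hprim s)).1 (D.irreducible s)
  rw [Polynomial.map_prod]
  refine Polynomial.separable_prod (fun s s' hss => ?_) fun s => (hirr s).separable
  refine (hirr s).coprime_iff_not_dvd.2 fun h => D.not_associated s s' hss ?_
  exact (D.irreducible s).associated_of_dvd (D.irreducible s')
    ((Polynomial.IsPrimitive.Int.dvd_iff_map_cast_dvd_map_cast _ _ (hprim s)).2 h)

theorem exists_intCast_bezout {f : ℤ[X]} (hf : (f.map (Int.castRingHom ℚ)).Separable) :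
    ∃ (n : ℤ) (a b : ℤ[X]), n ≠ 0 ∧ a * f + b * derivative f = Polynomial.C n := by
  obtain ⟨a, b, hab⟩ := hf
  obtain ⟨u, hu0, hu⟩ := IsLocalization.integerNormalization_spec (nonZeroDivisors ℤ) a
  obtain ⟨v, hv0, hv⟩ := IsLocalization.integerNormalization_spec (nonZeroDivisors ℤ) b
  set a' := IsLocalization.integerNormalization (nonZeroDivisors ℤ) a
  set b' := IsLocalization.integerNormalization (nonZeroDivisors ℤ) b
  refine ⟨u * v, Polynomial.C v * a', Polynomial.C u * b',
    mul_ne_zero (nonZeroDivisors.ne_zero hu0) (nonZeroDivisors.ne_zero hv0), ?_⟩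
  apply Polynomial.map_injective (Int.castRingHom ℚ) Int.cast_injective
  have hu' : a'.map (Int.castRingHom ℚ) = Polynomial.C (u : ℚ) * a := by
    have : a'.map (algebraMap ℤ ℚ) = _ := hu
    rw [algebraMap_int_eq] at this
    rw [this]; ext; simp
  have hv' : b'.map (Int.castRingHom ℚ) = Polynomial.C (v : ℚ) * b := by
    have : b'.map (algebraMap ℤ ℚ) = _ := hv
    rw [algebraMap_int_eq] at this
    rw [this]; ext; simp
  rw [derivative_map] at hab
  simp only [Polynomial.map_add, Polynomial.map_mul, Polynomial.map_C, hu', hv',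
    Int.coe_castRingHom, Polynomial.C_mul]
  linear_combination (Polynomial.C (u : ℚ) * Polynomial.C (v : ℚ)) * hab

theorem FactorData.exists_good {m : ℕ} {F : Fin m → ℤ[X]} (D : FactorData F) :
    ∃ n : ℕ, 0 < n ∧ ∀ p : ℕ, p.Prime → ¬ p ∣ n → (∀ i, (D.c i : ZMod p) ≠ 0) ∧
      (∀ s, ((D.P s).leadingCoeff : ZMod p) ≠ 0) ∧
      Squarefree ((∏ s, D.P s).map (Int.castRingHom (ZMod p))) := by
  obtain ⟨n, a, b, hn, hab⟩ := exists_intCast_bezout (FactorData.separable_map_rat D)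
  set n' : ℤ := n * (∏ i, D.c i) * ∏ s, (D.P s).leadingCoeff with hn'
  have hne : n' ≠ 0 := mul_ne_zero (mul_ne_zero hn (Finset.prod_ne_zero_iff.2 fun i _ =>
    D.c_ne_zero i)) (Finset.prod_ne_zero_iff.2 fun s _ =>
      Polynomial.leadingCoeff_ne_zero.2 (D.irreducible s).ne_zero)
  refine ⟨n'.natAbs, Int.natAbs_pos.2 hne, fun p hp hpn => ?_⟩
  have : Fact p.Prime := ⟨hp⟩
  have hcast : (n' : ZMod p) ≠ 0 := by
    rw [Ne, ZMod.intCast_zmod_eq_zero_iff_dvd]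
    intro h
    exact hpn (by simpa using Int.natAbs_dvd_natAbs.2 h)
  simp only [hn', Int.cast_mul, Int.cast_prod] at hcast
  refine ⟨fun i => ?_, fun s => ?_, ?_⟩
  · exact Finset.prod_ne_zero_iff.1 (right_ne_zero_of_mul (left_ne_zero_of_mul hcast)) i
      (Finset.mem_univ i)
  · exact Finset.prod_ne_zero_iff.1 (right_ne_zero_of_mul hcast) s (Finset.mem_univ s)
  · have hnp : (n : ZMod p) ≠ 0 := left_ne_zero_of_mul (left_ne_zero_of_mul hcast)
    apply Polynomial.Separable.squarefree
    have h := congrArg (Polynomial.map (Int.castRingHom (ZMod p))) hab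
    simp only [Polynomial.map_add, Polynomial.map_mul, Polynomial.map_C, Int.coe_castRingHom] at h
    refine ⟨Polynomial.C (n : ZMod p)⁻¹ * a.map (Int.castRingHom (ZMod p)),
      Polynomial.C (n : ZMod p)⁻¹ * b.map (Int.castRingHom (ZMod p)), ?_⟩
    rw [derivative_map, mul_assoc, mul_assoc, ← mul_add, h, ← Polynomial.C_mul,
      inv_mul_cancel₀ hnp, Polynomial.C_1]

/-- The local character sum over units. -/
def unitCharSum {m p : ℕ} [NeZero p] (F : Fin m → ℤ[X]) (χ : Fin m → MulChar (ZMod p) ℂ) : ℂ :=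
  ∑ v : (ZMod p)ˣ, ∏ i, χ i (aeval (v : ZMod p) (F i))

theorem norm_mulChar_le_one {p : ℕ} [NeZero p] (χ : MulChar (ZMod p) ℂ) (a : ZMod p) : ‖χ a‖ ≤ 1 :=
  DirichletCharacter.norm_le_one χ a

theorem norm_prod_mulChar_le_one {ι : Type*} [Fintype ι] {p : ℕ} [NeZero p]
    (χ : ι → MulChar (ZMod p) ℂ) (a : ι → ZMod p) : ‖∏ i, χ i (a i)‖ ≤ 1 := by
  rw [norm_prod]
  exact Finset.prod_le_one (fun _ _ => norm_nonneg _) fun i _ => norm_mulChar_le_one _ _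

theorem norm_unitCharSum_le_totient {m p : ℕ} [NeZero p] (F : Fin m → ℤ[X])
    (χ : Fin m → MulChar (ZMod p) ℂ) : ‖unitCharSum F χ‖ ≤ p.totient := by
  refine (norm_sum_le _ _).trans ?_
  refine (Finset.sum_le_sum fun v _ => norm_prod_mulChar_le_one χ _).trans ?_
  simp [ZMod.card_units_eq_totient]

theorem prod_mulChar_apply {ι : Type*} [Fintype ι] {p : ℕ} [Fact p.Prime]
    (χ : ι → MulChar (ZMod p) ℂ) {e : ι → ℕ} (he : ∃ i, 0 < e i) (a : ZMod p) :
    (∏ i, χ i ^ (e i : ℤ)) a = ∏ i, χ i a ^ e i := by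
  by_cases ha : a = 0
  · rw [ha, MulChar.map_zero]
    obtain ⟨i, hi⟩ := he
    exact (Finset.prod_eq_zero (Finset.mem_univ i) (by
      rw [MulChar.map_zero, zero_pow hi.ne'])).symm
  · have h : ∀ t : Finset ι, (∏ i ∈ t, χ i ^ (e i : ℤ)) a = ∏ i ∈ t, χ i a ^ e i := fun t => by
      induction t using Finset.induction_on with
      | empty => simp [MulChar.one_apply (isUnit_iff_ne_zero.2 ha)]
      | insert i t hi ih =>
        rw [Finset.prod_insert hi, Finset.prod_insert hi, MulChar.mul_apply, ih, zpow_natCast]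
        congr 1
        by_cases h0 : e i = 0
        · simp [h0, MulChar.one_apply (isUnit_iff_ne_zero.2 ha)]
        · rw [MulChar.pow_apply' _ h0]
    exact h _

theorem FactorData.norm_unitCharSum_le {m p : ℕ} [Fact p.Prime] {F : Fin m → ℤ[X]}
    (D : FactorData F) (hlc : ∀ s, ((D.P s).leadingCoeff : ZMod p) ≠ 0)
    (hsq : Squarefree ((∏ s, D.P s).map (Int.castRingHom (ZMod p))))
    {χ : Fin m → MulChar (ZMod p) ℂ} (hχ : monomialMap D.expMatrix χ ≠ 1) :
    ‖unitCharSum F χ‖ ≤ ((∑ s, (D.P s).natDegree : ℕ) + 1) * Real.sqrt p := by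
  set ψ := monomialMap D.expMatrix χ with hψ
  set l : Fin D.M → ZMod p := fun s => ((D.P s).leadingCoeff : ZMod p) with hl
  set R : Fin D.M → (ZMod p)[X] := fun s => (D.P s).map (Int.castRingHom (ZMod p)) with hR
  have hRl : ∀ s, (R s).leadingCoeff = l s := fun s =>
    Polynomial.leadingCoeff_map_of_leadingCoeff_ne_zero _ (by simpa using hlc s)
  have hRd : ∀ s, (R s).natDegree = (D.P s).natDegree := fun s =>
    Polynomial.natDegree_map_of_leadingCoeff_ne_zero _ (by simpa using hlc s)
  have hR0 : ∀ s, R s ≠ 0 := fun s => by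
    rw [← Polynomial.leadingCoeff_ne_zero, hRl]; exact hlc s
  set Q : Fin D.M → (ZMod p)[X] := fun s => R s * Polynomial.C (l s)⁻¹ with hQ
  have hQm : ∀ s, (Q s).Monic := fun s => by
    simp only [hQ, ← hRl]; exact Polynomial.monic_mul_leadingCoeff_inv (hR0 s)
  have hQd : ∀ s, (Q s).natDegree = (D.P s).natDegree := fun s => by
    rw [← hRd]; exact Polynomial.natDegree_mul_C (inv_ne_zero (hlc s))
  have hRQ : ∀ s x, (R s).eval x = l s * (Q s).eval x := fun s x => by
    simp only [hQ, Polynomial.eval_mul, Polynomial.eval_C]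
    rw [mul_comm, mul_assoc, inv_mul_cancel₀ (hlc s), mul_one]
  have hQsq : Squarefree (∏ s, Q s) := by
    rw [Polynomial.map_prod] at hsq
    refine hsq.squarefree_of_dvd ?_
    simp only [hQ, Finset.prod_mul_distrib]
    have hu : IsUnit (∏ s, Polynomial.C (l s)⁻¹) := by
      rw [← map_prod]
      exact Polynomial.isUnit_C.2 (isUnit_iff_ne_zero.2
        (Finset.prod_ne_zero_iff.2 fun s _ => inv_ne_zero (hlc s)))
    exact hu.mul_right_dvd.2 dvd_rfl
  set κ : ℂ := (∏ i, χ i (D.c i)) * ∏ s, ψ s (l s) with hκ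
  have hκ1 : ‖κ‖ ≤ 1 := by
    rw [hκ, norm_mul]
    exact mul_le_one₀ (norm_prod_mulChar_le_one _ _) (norm_nonneg _) (norm_prod_mulChar_le_one _ _)
  have hpt : ∀ x : ZMod p, ∏ i, χ i (aeval x (F i)) = κ * ∏ s, ψ s ((Q s).eval x) := fun x => by
    have h1 : ∀ i, aeval x (F i) = (D.c i : ZMod p) * ∏ s, (R s).eval x ^ D.μ s i := fun i => by
      conv_lhs => rw [D.eq_prod i]
      simp only [map_mul, map_prod, map_pow, hR, Polynomial.eval_map,
        Polynomial.aeval_def, Polynomial.eval₂_C, algebraMap_int_eq, Int.coe_castRingHom]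
    have h2 : ∀ s, ψ s ((R s).eval x) = ∏ i, χ i ((R s).eval x) ^ D.μ s i := fun s =>
      prod_mulChar_apply χ (D.used s) _
    simp only [h1, map_mul, map_prod, map_pow, Finset.prod_mul_distrib]
    rw [Finset.prod_comm, Finset.prod_congr rfl fun s _ => (h2 s).symm]
    simp only [hRQ, map_mul, Finset.prod_mul_distrib, hκ, mul_assoc]
  have hp1 : 1 ≤ Real.sqrt p := by
    rw [Real.one_le_sqrt]
    exact_mod_cast (Fact.out : p.Prime).one_le
  have hsum : unitCharSum F χ = κ * (∑ x : ZMod p, ∏ s, ψ s ((Q s).eval x)) -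
      ∏ i, χ i (aeval (0 : ZMod p) (F i)) := by
    rw [Finset.mul_sum, ← Finset.sum_congr rfl fun x _ => hpt x, eq_sub_iff_add_eq,
      ← Finset.sum_erase_add _ _ (Finset.mem_univ (0 : ZMod p)), unitCharSum]
    congr 1
    refine Finset.sum_bij' (fun v _ => (v : ZMod p))
      (fun x hx => Units.mk0 x (Finset.ne_of_mem_erase hx)) ?_ ?_ ?_ ?_ ?_ <;> simp
  obtain ⟨s, hs⟩ := Function.ne_iff.1 hχ
  have hw := weil_bound hQm (fun s => by rw [hQd]; exact D.natDegree_pos s) hQsq ⟨s, hs⟩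
  rw [Polynomial.natDegree_prod _ _ fun s _ => (hQm s).ne_zero,
    Finset.sum_congr rfl fun s _ => hQd s] at hw
  rw [hsum]
  calc _ ≤ ‖κ * (∑ x : ZMod p, ∏ s, ψ s ((Q s).eval x))‖ +
        ‖∏ i, χ i (aeval (0 : ZMod p) (F i))‖ := norm_sub_le _ _
    _ ≤ 1 * ((∑ s, (D.P s).natDegree : ℕ) * Real.sqrt p) + 1 := by
        rw [norm_mul]
        gcongr
        exact norm_prod_mulChar_le_one _ _
    _ ≤ _ := by rw [one_mul, add_mul, one_mul]; gcongr

/-- Detecting the congruences by characters. -/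
theorem totient_pow_mul_VNK_le {K N p : ℕ} [NeZero p] (F : Fin K → Fin N → ℤ[X])
    {w : Fin K → ZMod p} (hw : ∀ i, IsUnit (w i)) :
    (p.totient : ℝ) ^ K * VNK F p w ≤
      ∑ χ : Fin K → MulChar (ZMod p) ℂ, ∏ j, ‖unitCharSum (fun i => F i j) (χ)‖ := by
  have key : (p.totient : ℂ) ^ K * VNK F p w =
      ∑ χ : Fin K → MulChar (ZMod p) ℂ, (∏ i, χ i (w i)⁻¹) *
        ∏ j, unitCharSum (fun i => F i j) χ := by
    have h1 : ∀ χ : Fin K → MulChar (ZMod p) ℂ, (∏ i, χ i (w i)⁻¹) *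
        ∏ j, unitCharSum (fun i => F i j) χ = ∑ v : Fin N → (ZMod p)ˣ,
          ∏ i, χ i (w i)⁻¹ * χ i (∏ j, aeval ((v j : ZMod p)) (F i j)) := fun χ => by
      simp only [unitCharSum]
      rw [Finset.prod_univ_sum, Finset.mul_sum, Fintype.piFinset_univ]
      refine Finset.sum_congr rfl fun v _ => ?_
      rw [Finset.prod_mul_distrib, Finset.prod_comm]
      simp only [map_prod]
    simp only [h1]
    rw [Finset.sum_comm]
    have h2 : ∀ v : Fin N → (ZMod p)ˣ, ∑ χ : Fin K → MulChar (ZMod p) ℂ,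
        ∏ i, χ i (w i)⁻¹ * χ i (∏ j, aeval ((v j : ZMod p)) (F i j)) =
        if ∀ i, (∏ j, aeval ((v j : ZMod p)) (F i j)) = w i then (p.totient : ℂ) ^ K else 0 :=
      fun v => by
        have h3 := Finset.prod_univ_sum (fun _ : Fin K =>
          (Finset.univ : Finset (MulChar (ZMod p) ℂ))) (fun i χ => χ (w i)⁻¹ *
            χ (∏ j, aeval ((v j : ZMod p)) (F i j)))
        rw [Fintype.piFinset_univ] at h3
        rw [← h3]
        have h4 : ∀ i, ∑ χ : MulChar (ZMod p) ℂ, χ (w i)⁻¹ *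
            χ (∏ j, aeval ((v j : ZMod p)) (F i j)) =
            if (∏ j, aeval ((v j : ZMod p)) (F i j)) = w i then (p.totient : ℂ) else 0 :=
          fun i => by
            have := DirichletCharacter.sum_char_inv_mul_char_eq ℂ (hw i)
              (∏ j, aeval ((v j : ZMod p)) (F i j))
            simp only [eq_comm (a := w i)] at this
            exact this
        simp only [h4]
        split_ifs with h
        · simp [h]
        · push Not at h
          obtain ⟨i, hi⟩ := h
          exact Finset.prod_eq_zero (Finset.mem_univ i) (if_neg hi)
    simp only [h2]
    rw [← Finset.sum_filter, Finset.sum_const, VNK, Nat.card_eq_fintype_card,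
      Fintype.card_subtype, nsmul_eq_mul, mul_comm]
  have h5 : (p.totient : ℝ) ^ K * VNK F p w = ‖(p.totient : ℂ) ^ K * VNK F p w‖ := by simp
  rw [h5, key]
  refine (norm_sum_le _ _).trans (Finset.sum_le_sum fun χ _ => ?_)
  rw [norm_mul, norm_prod (f := fun j => unitCharSum (fun i => F i j) χ)]
  exact mul_le_of_le_one_left (Finset.prod_nonneg fun _ _ => norm_nonneg _)
    (norm_prod_mulChar_le_one _ _)

theorem card_mulChar_eq (p : ℕ) [Fact p.Prime] : Nat.card (MulChar (ZMod p) ℂ) = p.totient := by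
  rw [Nat.card_congr (MulChar.mulEquiv_units (ZMod p) ℂ).some.toEquiv, Nat.card_eq_fintype_card,
    ZMod.card_units_eq_totient]

theorem isCyclic_mulChar (p : ℕ) [Fact p.Prime] : IsCyclic (MulChar (ZMod p) ℂ) := by
  obtain ⟨ψ, hψ⟩ := exists_mulChar_generator p
  exact ⟨ψ, hψ⟩

/-- The count modulo a prime of good reduction: main term from the characters killed by one of the
exponent matrices, error term from the Weil bound. -/
theorem totient_pow_mul_VNK_le_card_add {K L N p : ℕ} [Fact p.Prime] {G : Fin K → Fin L → ℤ[X]}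
    (D : ∀ r, FactorData (fun i => G i r))
    (hlc : ∀ r s, (((D r).P s).leadingCoeff : ZMod p) ≠ 0)
    (hsq : ∀ r, Squarefree ((∏ s, (D r).P s).map (Int.castRingHom (ZMod p))))
    {F : Fin K → Fin N → ℤ[X]} (hF : ∀ j, ∃ r, ∀ i, F i j = G i r)
    {w : Fin K → ZMod p} (hw : ∀ i, IsUnit (w i)) :
    (p.totient : ℝ) ^ K * VNK F p w ≤
      (Finset.univ.filter fun χ : Fin K → MulChar (ZMod p) ℂ =>
        ∃ r, monomialMap (D r).expMatrix χ = 1).card * (p.totient : ℝ) ^ N +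
      (p.totient : ℝ) ^ K *
        (((∑ r, ∑ s, ((D r).P s).natDegree : ℕ) + 1) * Real.sqrt p) ^ N := by
  refine (totient_pow_mul_VNK_le F hw).trans ?_
  rw [← Finset.sum_filter_add_sum_filter_not Finset.univ
    (fun χ : Fin K → MulChar (ZMod p) ℂ => ∃ r, monomialMap (D r).expMatrix χ = 1)]
  refine add_le_add ?_ ?_
  · rw [← nsmul_eq_mul]
    refine Finset.sum_le_card_nsmul _ _ _ fun χ _ => ?_
    refine (Finset.prod_le_prod (fun _ _ => norm_nonneg _) fun j _ =>
      norm_unitCharSum_le_totient (fun i => F i j) χ).trans ?_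
    simp
  · have hcard : (Finset.univ : Finset (Fin K → MulChar (ZMod p) ℂ)).card = p.totient ^ K := by
      rw [Finset.card_univ, ← Nat.card_eq_fintype_card, Nat.card_fun, card_mulChar_eq]
      simp
    have hle : ((Finset.univ.filter fun χ : Fin K → MulChar (ZMod p) ℂ =>
        ¬ ∃ r, monomialMap (D r).expMatrix χ = 1).card : ℝ) ≤ (p.totient : ℝ) ^ K := by
      rw [← Nat.cast_pow, ← hcard]
      exact_mod_cast Finset.card_filter_le _ _
    refine le_trans ?_ (mul_le_mul_of_nonneg_right hle (by positivity))
    rw [← nsmul_eq_mul]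
    refine Finset.sum_le_card_nsmul _ _ _ fun χ hχ => ?_
    have hχ' : ∀ r, monomialMap (D r).expMatrix χ ≠ 1 := by simpa using hχ
    have hj : ∀ j, ‖unitCharSum (fun i => F i j) χ‖ ≤
        ((∑ r, ∑ s, ((D r).P s).natDegree : ℕ) + 1) * Real.sqrt p := fun j => by
      obtain ⟨r, hr⟩ := hF j
      rw [funext hr]
      refine ((D r).norm_unitCharSum_le (hlc r) (hsq r) (hχ' r)).trans ?_
      gcongr
      exact Finset.single_le_sum (f := fun r => ∑ s, ((D r).P s).natDegree)
        (fun _ _ => Nat.zero_le _) (Finset.mem_univ r)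
    refine (Finset.prod_le_prod (fun _ _ => norm_nonneg _) fun j _ => hj j).trans ?_
    simp

theorem VNK_le_totient_pow {K N q : ℕ} [NeZero q] (F : Fin K → Fin N → ℤ[X]) (w : Fin K → ZMod q) :
    VNK F q w ≤ q.totient ^ N := by
  refine (Nat.card_le_card_of_injective _ Subtype.val_injective).trans ?_
  rw [Nat.card_fun, Nat.card_eq_fintype_card, ZMod.card_units_eq_totient]
  simp

theorem VNK_div_le_one {K N q : ℕ} [NeZero q] (F : Fin K → Fin N → ℤ[X]) (w : Fin K → ZMod q) :
    (VNK F q w : ℝ) / (q.totient : ℝ) ^ N ≤ 1 :=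
  div_le_one_of_le₀ (by exact_mod_cast VNK_le_totient_pow F w) (by positivity)

theorem exists_local_estimate {K L : ℕ} (hK : 1 ≤ K) {G : Fin K → Fin L → ℤ[X]}
    (hG : ∀ i r, 0 < (G i r).natDegree) (hMI : ∀ r, MultIndep (fun i => G i r)) {N : ℕ}
    {F : Fin K → Fin N → ℤ[X]} (hF : ∀ j, ∃ r, ∀ i, F i j = G i r) :
    ∃ (c B : ℝ) (p₀ : ℕ), 1 ≤ c ∧ 1 ≤ B ∧ 0 < p₀ ∧ ∀ (p : ℕ), p.Prime → p₀ < p →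
      ∀ w : Fin K → ZMod p, (∀ i, IsUnit (w i)) →
        (p.totient : ℝ) ^ K * VNK F p w ≤ B * (p.totient : ℝ) ^ N +
          (p.totient : ℝ) ^ K * (c * Real.sqrt p) ^ N ∧
        ∀ B₀ : ℝ, B₀ < p → (∀ r, IFH (fun i => G i r) B₀ p) →
          (p.totient : ℝ) ^ K * VNK F p w ≤ (p.totient : ℝ) ^ N +
            (p.totient : ℝ) ^ K * (c * Real.sqrt p) ^ N := by
  have hG0 : ∀ i r, G i r ≠ 0 := fun i r h => by simpa [h] using hG i r
  let D : ∀ r, FactorData (fun i => G i r) := fun r =>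
    (nonempty_factorData fun i => hG0 i r).some
  choose n hn hgood using fun r => (D r).exists_good
  choose β b hβ hb using fun r => (D r).exists_invariantFactor_bound hK (hMI r)
  refine ⟨(∑ r, ∑ s, ((D r).P s).natDegree : ℕ) + 1, ((∑ r, b r : ℕ) : ℝ) + 1, (∑ r, n r) + 1,
    le_add_of_nonneg_left (Nat.cast_nonneg _), le_add_of_nonneg_left (Nat.cast_nonneg _),
    Nat.succ_pos _, fun p hp hpn w hw => ?_⟩
  have : Fact p.Prime := ⟨hp⟩
  have := isCyclic_mulChar p
  have hg : ∀ r, _ := fun r => hgood r p hp fun h => by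
    have h1 := Nat.le_of_dvd (hn r) h
    have h2 := Finset.single_le_sum (f := n) (fun _ _ => Nat.zero_le _) (Finset.mem_univ r)
    omega
  have key := totient_pow_mul_VNK_le_card_add D (fun r => (hg r).2.1) (fun r => (hg r).2.2) hF hw
  refine ⟨key.trans ?_, fun B₀ hB₀ hI => key.trans ?_⟩
  · gcongr
    have h1 : (Finset.univ.filter fun χ : Fin K → MulChar (ZMod p) ℂ =>
        ∃ r, monomialMap (D r).expMatrix χ = 1) ⊆ Finset.univ.biUnion fun r =>
        Finset.univ.filter fun χ => monomialMap (D r).expMatrix χ = 1 := fun χ hχ => by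
      simpa using hχ
    have h2 := (Finset.card_le_card h1).trans Finset.card_biUnion_le
    have h3 : ∀ r, (Finset.univ.filter fun χ : Fin K → MulChar (ZMod p) ℂ =>
        monomialMap (D r).expMatrix χ = 1).card ≤ b r := fun r => by
      have := (hb r (MulChar (ZMod p) ℂ)).1
      rwa [Nat.card_eq_fintype_card, Fintype.card_subtype] at this
    have h4 := h2.trans (Finset.sum_le_sum fun r _ => h3 r)
    have h5 : ((Finset.univ.filter fun χ : Fin K → MulChar (ZMod p) ℂ =>
        ∃ r, monomialMap (D r).expMatrix χ = 1).card : ℝ) ≤ (∑ r, b r : ℕ) := by exact_mod_cast h4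
    linarith
  · refine add_le_add_left (mul_le_of_le_one_left (by positivity) ?_) _
    have h1 : (Finset.univ.filter fun χ : Fin K → MulChar (ZMod p) ℂ =>
        ∃ r, monomialMap (D r).expMatrix χ = 1) ⊆ {1} := fun χ hχ => by
      obtain ⟨r, hr⟩ := (Finset.mem_filter.1 hχ).2
      refine Finset.mem_singleton.2 ((hb r (MulChar (ZMod p) ℂ)).2 ?_ χ hr)
      have h2 := hI r (β r) (hβ r) p hp dvd_rfl hB₀
      rw [card_mulChar_eq, Nat.totient_prime hp]
      rw [Int.gcd_eq_natAbs] at h2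
      have h3 : ((p : ℤ) - 1).natAbs = p - 1 := by have := hp.one_le; omega
      rwa [h3] at h2
    have := Finset.card_le_card h1
    rw [Finset.card_singleton] at this
    exact_mod_cast this

theorem half_le_totient_prime {p : ℕ} (hp : p.Prime) : (p : ℝ) / 2 ≤ p.totient := by
  rw [Nat.totient_prime hp, Nat.cast_sub hp.one_le]
  have : (2 : ℝ) ≤ p := by exact_mod_cast hp.two_le
  push_cast
  linarith

theorem div_pow_le_of_mul_le {φ V X B : ℝ} {K N : ℕ} (hφ : 0 < φ)
    (h : φ ^ K * V ≤ B * φ ^ N + φ ^ K * X ^ N) : V / φ ^ N ≤ (φ ^ K)⁻¹ * B + (X / φ) ^ N := by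
  have hK : (0 : ℝ) < φ ^ K := by positivity
  have hN : (0 : ℝ) < φ ^ N := by positivity
  rw [div_pow, div_le_iff₀ hN, add_mul, div_mul_cancel₀ _ hN.ne']
  have : V ≤ (φ ^ K)⁻¹ * (B * φ ^ N + φ ^ K * X ^ N) := by
    rw [inv_mul_eq_div, le_div_iff₀ hK]; linarith
  refine this.trans (le_of_eq ?_)
  field_simp

theorem sqrt_div_totient_le {p : ℕ} (hp : p.Prime) {c : ℝ} (hc : 0 ≤ c) :
    c * Real.sqrt p / p.totient ≤ 2 * c / Real.sqrt p := by
  have hp0 : (0 : ℝ) < p := by exact_mod_cast hp.pos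
  have h := half_le_totient_prime hp
  rw [div_le_div_iff₀ (by linarith) (Real.sqrt_pos.2 hp0), mul_assoc, Real.mul_self_sqrt hp0.le]
  nlinarith

theorem exists_local_bound {K L : ℕ} (hK : 1 ≤ K) {G : Fin K → Fin L → ℤ[X]}
    (hG : ∀ i r, 0 < (G i r).natDegree) (hMI : ∀ r, MultIndep (fun i => G i r)) {N : ℕ}
    {F : Fin K → Fin N → ℤ[X]} (hF : ∀ j, ∃ r, ∀ i, F i j = G i r) :
    ∃ c : ℝ, 1 ≤ c ∧ ∀ p : ℕ, p.Prime → ∀ w : Fin K → ZMod p, (∀ i, IsUnit (w i)) →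
      (VNK F p w : ℝ) / (p.totient : ℝ) ^ N ≤ c * (p : ℝ) ^ (-(min (K : ℝ) ((N : ℝ) / 2))) := by
  obtain ⟨c, B, p₀, hc, hB, hp₀, h⟩ := exists_local_estimate hK hG hMI hF
  set m := min (K : ℝ) ((N : ℝ) / 2) with hm
  have hm0 : 0 ≤ m := le_min (by positivity) (by positivity)
  have hp₀' : (1 : ℝ) ≤ p₀ := by exact_mod_cast hp₀
  have hp₀m : (1 : ℝ) ≤ (p₀ : ℝ) ^ m := Real.one_le_rpow hp₀' hm0
  refine ⟨(p₀ : ℝ) ^ m + 2 ^ K * B + (2 * c) ^ N, ?_, fun p hp w hw => ?_⟩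
  · have h1 : (0 : ℝ) ≤ 2 ^ K * B := by positivity
    have h2 : (0 : ℝ) ≤ (2 * c) ^ N := by positivity
    linarith
  have : NeZero p := ⟨hp.ne_zero⟩
  have hp0 : (0 : ℝ) < p := by exact_mod_cast hp.pos
  have hp1 : (1 : ℝ) ≤ p := by exact_mod_cast hp.one_le
  have hpm : (0 : ℝ) < (p : ℝ) ^ (-m) := by positivity
  rcases le_or_gt p p₀ with hle | hlt
  · refine (VNK_div_le_one F w).trans ?_
    have h1 : (1 : ℝ) ≤ (p₀ : ℝ) ^ m * (p : ℝ) ^ (-m) := by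
      rw [Real.rpow_neg hp0.le, ← div_eq_mul_inv, one_le_div (by positivity)]
      exact Real.rpow_le_rpow hp0.le (by exact_mod_cast hle) hm0
    refine h1.trans (mul_le_mul_of_nonneg_right ?_ hpm.le)
    have h1 : (0 : ℝ) ≤ 2 ^ K * B := by positivity
    have h2 : (0 : ℝ) ≤ (2 * c) ^ N := by positivity
    linarith
  · have hφ := half_le_totient_prime hp
    have hφ0 : (0 : ℝ) < p.totient := by linarith
    refine (div_pow_le_of_mul_le hφ0 (h p hp hlt w hw).1).trans ?_
    have h1 : ((p.totient : ℝ) ^ K)⁻¹ * B ≤ 2 ^ K * B * (p : ℝ) ^ (-m) := by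
      have h2 : ((p.totient : ℝ) ^ K)⁻¹ ≤ 2 ^ K * (p : ℝ) ^ (-m) := by
        have h3 : ((p.totient : ℝ) ^ K)⁻¹ ≤ (((p : ℝ) / 2) ^ K)⁻¹ := by gcongr
        have h4 : (p : ℝ) ^ (-(K : ℝ)) ≤ (p : ℝ) ^ (-m) :=
          Real.rpow_le_rpow_of_exponent_le hp1 (neg_le_neg (min_le_left _ _))
        rw [Real.rpow_neg hp0.le, Real.rpow_natCast] at h4
        refine h3.trans ?_
        rw [div_pow, inv_div, div_eq_mul_inv]
        gcongr
      nlinarith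
    have h2 : (c * Real.sqrt p / p.totient) ^ N ≤ (2 * c) ^ N * (p : ℝ) ^ (-m) := by
      have h3 : (c * Real.sqrt p / p.totient) ^ N ≤ (2 * c / Real.sqrt p) ^ N :=
        pow_le_pow_left₀ (by positivity) (sqrt_div_totient_le hp (by linarith)) N
      have h4 : (p : ℝ) ^ (-((N : ℝ) / 2)) ≤ (p : ℝ) ^ (-m) :=
        Real.rpow_le_rpow_of_exponent_le hp1 (neg_le_neg (min_le_right _ _))
      have h5 : (p : ℝ) ^ (-((N : ℝ) / 2)) = (Real.sqrt p ^ N)⁻¹ := by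
        rw [Real.rpow_neg hp0.le, Real.sqrt_eq_rpow, ← Real.rpow_natCast, ← Real.rpow_mul hp0.le]
        congr 2; ring
      refine h3.trans ?_
      rw [div_pow, div_eq_mul_inv, ← h5]
      gcongr
    have h3 : 0 ≤ (p₀ : ℝ) ^ m * (p : ℝ) ^ (-m) := by positivity
    linarith

theorem exists_local_bound_of_IFH {K L : ℕ} (hK : 1 ≤ K) {B₀ : ℝ} {G : Fin K → Fin L → ℤ[X]}
    (hG : ∀ i r, 0 < (G i r).natDegree) (hMI : ∀ r, MultIndep (fun i => G i r)) {N : ℕ}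
    (hN : 2 * K + 1 ≤ N) {F : Fin K → Fin N → ℤ[X]} (hF : ∀ j, ∃ r, ∀ i, F i j = G i r) :
    ∃ c : ℝ, 0 < c ∧ ∀ p : ℕ, p.Prime → (∀ r, IFH (fun i => G i r) B₀ p) →
      ∀ w : Fin K → ZMod p, (∀ i, IsUnit (w i)) →
      (VNK F p w : ℝ) / (p.totient : ℝ) ^ N ≤
        ((p.totient : ℝ) ^ K)⁻¹ * Real.exp (c * (1 / Real.sqrt p)) := by
  obtain ⟨c, B, p₀, hc, -, hp₀, h⟩ := exists_local_estimate hK hG hMI hF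
  set p₁ : ℕ := p₀ + ⌈B₀⌉₊ with hp₁
  have hp₁0 : (0 : ℝ) < p₁ := by exact_mod_cast (by omega : 0 < p₁)
  refine ⟨(p₁ : ℝ) ^ K * Real.sqrt p₁ + (2 * c) ^ N, by positivity, fun p hp hI w hw => ?_⟩
  have : NeZero p := ⟨hp.ne_zero⟩
  have hp0 : (0 : ℝ) < p := by exact_mod_cast hp.pos
  have hp1 : (1 : ℝ) ≤ p := by exact_mod_cast hp.one_le
  have hφ := half_le_totient_prime hp
  have hφ0 : (0 : ℝ) < p.totient := by linarith
  have hφp : (p.totient : ℝ) ≤ p := by exact_mod_cast Nat.totient_le p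
  have hs0 : 0 < Real.sqrt p := Real.sqrt_pos.2 hp0
  have hs1 : 1 ≤ Real.sqrt p := Real.one_le_sqrt.2 hp1
  have hexp := Real.add_one_le_exp (((p₁ : ℝ) ^ K * Real.sqrt p₁ + (2 * c) ^ N) * (1 / Real.sqrt p))
  rw [inv_mul_eq_div, le_div_iff₀ (by positivity)]
  refine le_trans ?_ hexp
  have hx1 : 0 ≤ (p₁ : ℝ) ^ K * Real.sqrt p₁ * (1 / Real.sqrt p) := by positivity
  have hx2 : 0 ≤ (2 * c) ^ N * (1 / Real.sqrt p) := by positivity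
  rw [add_mul]
  rcases le_or_gt p p₁ with hle | hlt
  · have hle' : (p : ℝ) ≤ p₁ := by exact_mod_cast hle
    have h1 : (VNK F p w : ℝ) / (p.totient : ℝ) ^ N * (p.totient : ℝ) ^ K ≤ 1 * (p₁ : ℝ) ^ K := by
      gcongr
      · exact VNK_div_le_one F w
      · exact (Nat.totient_le p).trans hle
    have h2 : (p₁ : ℝ) ^ K * 1 ≤ (p₁ : ℝ) ^ K * (Real.sqrt p₁ * (1 / Real.sqrt p)) := by
      gcongr
      rw [mul_one_div, one_le_div hs0]
      exact Real.sqrt_le_sqrt hle'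
    rw [← mul_assoc] at h2
    linarith
  · have hB : B₀ < p := (Nat.le_ceil B₀).trans_lt (by exact_mod_cast (by omega : ⌈B₀⌉₊ < p))
    have h1 := (h p hp (by omega) w hw).2 B₀ hB hI
    rw [← one_mul ((p.totient : ℝ) ^ N)] at h1
    have h2 := mul_le_mul_of_nonneg_right (div_pow_le_of_mul_le hφ0 h1)
      (by positivity : (0 : ℝ) ≤ (p.totient : ℝ) ^ K)
    refine h2.trans ?_
    rw [add_mul, mul_one, inv_mul_cancel₀ (by positivity)]
    have h3 : (c * Real.sqrt p / p.totient) ^ N * (p.totient : ℝ) ^ K ≤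
        (2 * c) ^ N * (1 / Real.sqrt p) := by
      have h4 : (c * Real.sqrt p / p.totient) ^ N ≤ (2 * c / Real.sqrt p) ^ N :=
        pow_le_pow_left₀ (by positivity) (sqrt_div_totient_le hp (by linarith)) N
      calc (c * Real.sqrt p / p.totient) ^ N * (p.totient : ℝ) ^ K
          ≤ (2 * c / Real.sqrt p) ^ N * (p : ℝ) ^ K := by gcongr
        _ = (2 * c) ^ N * (Real.sqrt p ^ (2 * K) / Real.sqrt p ^ N) := by
            rw [pow_mul, Real.sq_sqrt hp0.le, div_pow]; ring
        _ ≤ (2 * c) ^ N * (1 / Real.sqrt p) := by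
            gcongr ?_ * ?_
            rw [div_le_div_iff₀ (by positivity) hs0, one_mul, ← pow_succ]
            exact pow_le_pow_right₀ hs1 hN
    linarith

theorem zmod_eq_of_forall_castHom_eq {q : ℕ} [NeZero q] (hq : Squarefree q) {a b : ZMod q}
    (h : ∀ p (hp : p ∈ q.primeFactors), ZMod.castHom (Nat.dvd_of_mem_primeFactors hp) (ZMod p) a =
      ZMod.castHom (Nat.dvd_of_mem_primeFactors hp) (ZMod p) b) : a = b := by
  rw [← sub_eq_zero]
  set d := a - b with hd
  have hdvd : ∀ p ∈ q.primeFactors, p ∣ d.val := fun p hp => by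
    have h0 : ZMod.castHom (Nat.dvd_of_mem_primeFactors hp) (ZMod p) d = 0 := by
      rw [hd, map_sub, h p hp, sub_self]
    rw [← ZMod.natCast_zmod_val d, map_natCast] at h0
    exact (ZMod.natCast_eq_zero_iff _ _).1 h0
  have h1 : ∏ p ∈ q.primeFactors, p ∣ d.val :=
    Finset.prod_primes_dvd _ (fun p hp => (Nat.prime_of_mem_primeFactors hp).prime) hdvd
  rw [Nat.prod_primeFactors_of_squarefree hq] at h1
  rw [← ZMod.natCast_zmod_val d]
  exact (ZMod.natCast_eq_zero_iff _ _).2 h1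

/-- The count modulo a squarefree number is at most the product of the counts modulo primes. -/
theorem VNK_le_prod {K N q : ℕ} [NeZero q] (hq : Squarefree q) (F : Fin K → Fin N → ℤ[X])
    (w : Fin K → ZMod q) :
    VNK F q w ≤ ∏ p : q.primeFactors, VNK F (p : ℕ)
      fun i => ZMod.castHom (Nat.dvd_of_mem_primeFactors p.2) (ZMod (p : ℕ)) (w i) := by
  simp only [VNK]
  rw [← Nat.card_pi]
  have hne : ∀ p : q.primeFactors, NeZero (p : ℕ) := fun p =>
    ⟨(Nat.prime_of_mem_primeFactors p.2).ne_zero⟩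
  let f : {v : Fin N → (ZMod q)ˣ // ∀ i, (∏ j, aeval ((v j : ZMod q)) (F i j)) = w i} →
      ∀ p : q.primeFactors, {v : Fin N → (ZMod (p : ℕ))ˣ // ∀ i,
        (∏ j, aeval ((v j : ZMod (p : ℕ))) (F i j)) =
          ZMod.castHom (Nat.dvd_of_mem_primeFactors p.2) (ZMod (p : ℕ)) (w i)} := fun v p =>
    ⟨fun j => Units.map (ZMod.castHom (Nat.dvd_of_mem_primeFactors p.2) (ZMod (p : ℕ))) (v.1 j),
      fun i => by
        rw [← v.2 i, map_prod]
        refine Finset.prod_congr rfl fun j _ => ?_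
        rw [Polynomial.aeval_def, Polynomial.aeval_def, Polynomial.hom_eval₂]
        congr 1
        exact RingHom.ext_int _ _⟩
  refine Nat.card_le_card_of_injective f fun v v' h => Subtype.ext (funext fun j => Units.ext ?_)
  refine zmod_eq_of_forall_castHom_eq hq fun p hp => ?_
  exact congrArg Units.val (congrFun (congrArg Subtype.val (congrFun h ⟨p, hp⟩)) j)

theorem totient_eq_prod_totient {q : ℕ} (hq : Squarefree q) :
    q.totient = ∏ p ∈ q.primeFactors, p.totient := by
  conv_lhs => rw [← Nat.prod_primeFactors_of_squarefree hq]
  have h : ∀ s : Finset ℕ, (∀ p ∈ s, p.Prime) → (∏ p ∈ s, p).totient = ∏ p ∈ s, p.totient := by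
    intro s
    induction s using Finset.induction_on with
    | empty => simp
    | insert a s ha ih =>
      intro hs
      rw [Finset.prod_insert ha, Finset.prod_insert ha, Nat.totient_mul, ih fun p hp =>
        hs p (Finset.mem_insert_of_mem hp)]
      refine Nat.Coprime.prod_right fun p hp => (Nat.coprime_primes (hs a (by simp))
        (hs p (Finset.mem_insert_of_mem hp))).2 fun h => ha (h ▸ hp)
  exact h _ fun p => Nat.prime_of_mem_primeFactors

/-- Local bounds for the density of solutions multiply up. -/
theorem VNK_div_le_prod {K N q : ℕ} [NeZero q] (hq : Squarefree q) (F : Fin K → Fin N → ℤ[X])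
    {w : Fin K → ZMod q} (hw : ∀ i, IsUnit (w i)) {b : ℕ → ℝ}
    (hb : ∀ p ∈ q.primeFactors, ∀ w : Fin K → ZMod p, (∀ i, IsUnit (w i)) →
      (VNK F p w : ℝ) / (p.totient : ℝ) ^ N ≤ b p) :
    (VNK F q w : ℝ) / (q.totient : ℝ) ^ N ≤ ∏ p ∈ q.primeFactors, b p := by
  have h1 : (VNK F q w : ℝ) ≤ ∏ p : q.primeFactors, (VNK F (p : ℕ)
      (fun i => ZMod.castHom (Nat.dvd_of_mem_primeFactors p.2) (ZMod (p : ℕ)) (w i)) : ℝ) := by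
    exact_mod_cast VNK_le_prod hq F w
  rw [totient_eq_prod_totient hq, Nat.cast_prod, ← Finset.prod_pow]
  rw [← Finset.prod_coe_sort q.primeFactors b,
    ← Finset.prod_coe_sort q.primeFactors (fun p => ((p.totient : ℕ) : ℝ) ^ N)]
  refine (div_le_div_of_nonneg_right h1 (by positivity)).trans ?_
  rw [← Finset.prod_div_distrib]
  exact Finset.prod_le_prod (fun _ _ => by positivity) fun p _ =>
    hb p p.2 _ fun i => (hw i).map _

theorem sum_one_div_sqrt_le (S : Finset ℕ) (hS : ∀ n ∈ S, 0 < n) :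
    ∑ n ∈ S, 1 / Real.sqrt n ≤ 2 * Real.sqrt S.card := by
  induction S using Finset.induction_on_max with
  | empty => simp
  | insert a s hs ih =>
    have ha : a ∉ s := fun h => lt_irrefl _ (hs a h)
    rw [Finset.sum_insert ha, Finset.card_insert_of_notMem ha]
    have ih' := ih fun n hn => hS n (Finset.mem_insert_of_mem hn)
    have hcard : s.card + 1 ≤ a := by
      have : s ⊆ Finset.Ico 1 a := fun n hn => Finset.mem_Ico.2
        ⟨hS n (Finset.mem_insert_of_mem hn), hs n hn⟩
      have h1 := Finset.card_le_card this
      rw [Nat.card_Ico] at h1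
      have := hS a (by simp)
      omega
    set k : ℝ := (s.card : ℝ) with hk
    have hk0 : 0 ≤ k := Nat.cast_nonneg _
    push_cast
    have h2 : 1 / Real.sqrt a ≤ 1 / Real.sqrt (k + 1) := by
      apply one_div_le_one_div_of_le (Real.sqrt_pos.2 (by linarith))
      exact Real.sqrt_le_sqrt (by rw [hk]; exact_mod_cast hcard)
    have h3 : 1 / Real.sqrt (k + 1) ≤ 2 * Real.sqrt (k + 1) - 2 * Real.sqrt k := by
      have hx := Real.sqrt_pos.2 (by linarith : (0 : ℝ) < k + 1)
      have hy := Real.sqrt_nonneg k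
      have hx2 := Real.sq_sqrt (by linarith : (0 : ℝ) ≤ k + 1)
      have hy2 := Real.sq_sqrt hk0
      rw [div_le_iff₀ hx]
      nlinarith [sq_nonneg (Real.sqrt (k + 1) - Real.sqrt k)]
    linarith

theorem card_primeFactors_le_log {q : ℕ} (hq : 0 < q) :
    (q.primeFactors.card : ℝ) ≤ 4 * Real.log (3 * q) := by
  have h1 : 2 ^ q.primeFactors.card ≤ q := by
    refine (Finset.pow_card_le_prod _ _ _ fun p hp =>
      (Nat.prime_of_mem_primeFactors hp).two_le).trans
        (Nat.le_of_dvd hq (Nat.prod_primeFactors_dvd q))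
  have hq' : (0 : ℝ) < q := by exact_mod_cast hq
  have h2 : (q.primeFactors.card : ℝ) * Real.log 2 ≤ Real.log q := by
    rw [← Real.log_pow]
    exact Real.log_le_log (by positivity) (by exact_mod_cast h1)
  have h3 : Real.log q ≤ Real.log (3 * q) := Real.log_le_log hq' (by linarith)
  have h4 := Real.log_two_gt_d9
  have h5 : (0 : ℝ) ≤ q.primeFactors.card := Nat.cast_nonneg _
  nlinarith

theorem VNK_count_squarefree
    (K L : ℕ) (hK : 1 ≤ K) (hL : 1 ≤ L)
    (B₀ : ℝ) (hB₀ : 0 < B₀)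
    (G : Fin K → Fin L → Polynomial ℤ)
    (hGnc : ∀ i r, 0 < (G i r).natDegree)
    (hGMI : ∀ r, MultIndep (fun i => G i r))
    (D₀ : ℕ) (hD₀ : D₀ = Finset.univ.sup fun r : Fin L => ∑ i, (G i r).natDegree)
    (N : ℕ) (hN : 1 ≤ N)
    (F : Fin K → Fin N → Polynomial ℤ)
    (hF : ∀ j : Fin N, ∃ j' : Fin L, ∀ i, F i j = G i j') :
    ((2 * K + 1 ≤ N) →
      ∃ A : ℝ, 0 < A ∧
        ∀ q : ℕ, 0 < q → Squarefree q →
          (∀ r : Fin L, IFH (fun i => G i r) B₀ q) →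
          ∀ w : Fin K → ZMod q, (∀ i, IsUnit (w i)) →
            (VNK F q w : ℝ) / (q.totient : ℝ) ^ N ≤
              ((q.totient : ℝ) ^ K)⁻¹ * Real.exp (A * Real.sqrt (Real.log (3 * (q : ℝ))))) ∧
    (∃ A' : ℝ, 0 < A' ∧
      ∀ q : ℕ, 0 < q → Squarefree q →
        ∀ w : Fin K → ZMod q, (∀ i, IsUnit (w i)) →
          (VNK F q w : ℝ) / (q.totient : ℝ) ^ N ≤
            (q : ℝ) ^ (-(min (K : ℝ) ((N : ℝ) / 2))) *
              Real.exp (A' * q.primeFactors.card)) := by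
  constructor
  · intro h2K
    obtain ⟨c, hc, h⟩ := exists_local_bound_of_IFH (B₀ := B₀) hK hGnc hGMI h2K hF
    refine ⟨c * 4, by positivity, fun q hq hsq hI w hw => ?_⟩
    have : NeZero q := ⟨hq.ne'⟩
    refine (VNK_div_le_prod hsq F hw fun p hp w hw => h p (Nat.prime_of_mem_primeFactors hp)
      (fun r β hβ ℓ hℓ hℓp hℓB => hI r β hβ ℓ hℓ (hℓp.trans (Nat.dvd_of_mem_primeFactors hp)) hℓB)
      w hw).trans ?_
    rw [Finset.prod_mul_distrib, ← Real.exp_sum, Finset.prod_inv_distrib, Finset.prod_pow,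
      ← Finset.mul_sum, totient_eq_prod_totient hsq, Nat.cast_prod, mul_assoc]
    gcongr
    refine (sum_one_div_sqrt_le _ fun n hn => Nat.pos_of_mem_primeFactors hn).trans ?_
    have h1 := Real.sqrt_le_sqrt (card_primeFactors_le_log hq)
    rw [Real.sqrt_mul (by norm_num), show (4 : ℝ) = 2 ^ 2 by norm_num,
      Real.sqrt_sq (by norm_num)] at h1
    linarith
  · obtain ⟨c, hc, h⟩ := exists_local_bound hK hGnc hGMI hF
    refine ⟨Real.log c + 1, by have := Real.log_nonneg hc; linarith, fun q hq hsq w hw => ?_⟩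
    have : NeZero q := ⟨hq.ne'⟩
    refine (VNK_div_le_prod hsq F hw fun p hp => h p (Nat.prime_of_mem_primeFactors hp)).trans ?_
    rw [Finset.prod_mul_distrib, Finset.prod_const,
      Real.finsetProd_rpow _ _ (fun p _ => Nat.cast_nonneg p), ← Nat.cast_prod,
      Nat.prod_primeFactors_of_squarefree hsq, mul_comm]
    gcongr
    rw [mul_comm, Real.exp_nat_mul]
    gcongr
    rw [Real.exp_add, Real.exp_log (by linarith)]
    exact le_mul_of_one_le_right (by linarith) (Real.one_le_exp zero_le_one)
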